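/- Assume n ≥ 4·v_{G₀}² and σ > 0. Then for all t ≥ 0, |ℙ(W > t)/(1 − Φ(t)) − 1| ≤ 50·c_{G₀}·exp(c_{G₀}·t²·s(t))·(1 + t²)·s(t), where s(t) := (1 + t/min{√Ψ_min, 1})·(q·Ψ_min)^{−1/2}·exp(5·D·t/σ) and c_{G₀} := 2^{9/2 + (15/2)·e_{G₀}} · (v_{G₀}!)⁴ · e_{G₀} / aut(G₀)^{3/2}. -/

import Mathlib

open MeasureTheory ProbabilityTheory
open scoped Classical

/-- Standard normal distribution function Φ. -/
noncomputable def stdNormalCDF (z : ℝ) : ℝ :=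
  ∫ x in Set.Iic z, Real.exp (-x ^ 2 / 2) / Real.sqrt (2 * Real.pi)

/-- `Γ ⊆ E(K_n)` is a copy of `G₀` if it is the image of the edge set of `G₀` under an
injection of the vertices. -/
noncomputable def copyFinset {V₀ : Type*} [Fintype V₀] [DecidableEq V₀]
    (G₀ : SimpleGraph V₀) [DecidableRel G₀.Adj] (n : ℕ) :
    Finset (Finset (Sym2 (Fin n))) :=
  Finset.univ.filter (fun Γ => ∃ f : V₀ ↪ Fin n, Γ = G₀.edgeFinset.image (Sym2.map ⇑f))

/-- The product `B_Γ = ∏_{k∈Γ} B_k` of edge indicators. -/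
noncomputable def prodB {Ω : Type*} {n : ℕ} (B : Sym2 (Fin n) → Ω → ℝ)
    (Γ : Finset (Sym2 (Fin n))) (ω : Ω) : ℝ :=
  ∏ k ∈ Γ, B k ω

/-- `σ = √Var(∑_{Γ∈𝓜} B_Γ)`. -/
noncomputable def subgraphSigma {V₀ : Type*} [Fintype V₀] [DecidableEq V₀]
    (G₀ : SimpleGraph V₀) [DecidableRel G₀.Adj] (n : ℕ)
    {Ω : Type*} [MeasurableSpace Ω] (μ : Measure Ω) (B : Sym2 (Fin n) → Ω → ℝ) : ℝ :=
  Real.sqrt ((∫ ω, (∑ Γ ∈ copyFinset G₀ n, prodB B Γ ω) ^ 2 ∂μ) -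
    (∫ ω, ∑ Γ ∈ copyFinset G₀ n, prodB B Γ ω ∂μ) ^ 2)

/-- The standardized subgraph count `W = σ^{−1} ∑_{Γ∈𝓜} B_Γ^c`. -/
noncomputable def subgraphW {V₀ : Type*} [Fintype V₀] [DecidableEq V₀]
    (G₀ : SimpleGraph V₀) [DecidableRel G₀.Adj] (n : ℕ)
    {Ω : Type*} [MeasurableSpace Ω] (μ : Measure Ω) (B : Sym2 (Fin n) → Ω → ℝ)
    (ω : Ω) : ℝ :=
  (subgraphSigma G₀ n μ B)⁻¹ *
    ∑ Γ ∈ copyFinset G₀ n, (prodB B Γ ω - ∫ ω', prodB B Γ ω' ∂μ)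

/-- `Ψ_min = min{ n^{v_H} p^{e_H} : H ⊆ G₀ a subgraph with at least one edge }`. -/
noncomputable def PsiMin {V₀ : Type*} [Fintype V₀] [DecidableEq V₀]
    (G₀ : SimpleGraph V₀) [DecidableRel G₀.Adj] (n : ℕ) (p : ℝ) : ℝ :=
  sInf {x : ℝ | ∃ S ⊆ G₀.edgeFinset, S.Nonempty ∧
    x = (n : ℝ) ^ (Finset.univ.filter (fun v : V₀ => ∃ e ∈ S, v ∈ e)).card * p ^ S.card}

/-- `s(t) = (1 + t/min{√Ψ_min, 1})·(q·Ψ_min)^{−1/2}·exp(5Dt/σ)`. -/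
noncomputable def sFun (Ψ σ q : ℝ) (D : ℕ) (t : ℝ) : ℝ :=
  (1 + t / min (Real.sqrt Ψ) 1) * (1 / Real.sqrt (q * Ψ)) *
    Real.exp (5 * (D : ℝ) * t / σ)

/-- `c_{G₀} = 2^{9/2 + (15/2)e_{G₀}} · (v_{G₀}!)⁴ · e_{G₀} / aut(G₀)^{3/2}`. -/
noncomputable def cConst {V₀ : Type*} [Fintype V₀] [DecidableEq V₀]
    (G₀ : SimpleGraph V₀) [DecidableRel G₀.Adj] : ℝ :=
  (2 : ℝ) ^ ((9 : ℝ) / 2 + 15 / 2 * (G₀.edgeFinset.card : ℝ)) *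
    ((Fintype.card V₀).factorial : ℝ) ^ 4 * (G₀.edgeFinset.card : ℝ) /
    (Nat.card (G₀ ≃g G₀) : ℝ) ^ ((3 : ℝ) / 2)

set_option linter.unusedSectionVars false
set_option linter.unusedSimpArgs false
set_option linter.unusedVariables false

section Cube
variable {ι : Type*} [Fintype ι] [DecidableEq ι]

/-- Weight of a configuration. -/
noncomputable def wt (p : ℝ) (X : Finset ι) : ℝ := ∏ k, if k ∈ X then p else 1 - p

/-- Expectation on the cube. -/
noncomputable def Ex (p : ℝ) (F : Finset ι → ℝ) : ℝ := ∑ X : Finset ι, wt p X * F X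

theorem Ex_add (p : ℝ) (F G : Finset ι → ℝ) : Ex p (fun X => F X + G X) = Ex p F + Ex p G := by
  simp [Ex, mul_add, Finset.sum_add_distrib]

theorem Ex_sub (p : ℝ) (F G : Finset ι → ℝ) : Ex p (fun X => F X - G X) = Ex p F - Ex p G := by
  simp [Ex, mul_sub, Finset.sum_sub_distrib]

theorem Ex_mul (p c : ℝ) (F : Finset ι → ℝ) : Ex p (fun X => c * F X) = c * Ex p F := by
  simp only [Ex, Finset.mul_sum]
  exact Finset.sum_congr rfl fun X _ => by ring

theorem Ex_mul' (p c : ℝ) (F : Finset ι → ℝ) : Ex p (fun X => F X * c) = Ex p F * c := by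
  simp only [Ex, Finset.sum_mul]
  exact Finset.sum_congr rfl fun X _ => by ring

theorem Ex_sum {κ : Type*} (p : ℝ) (s : Finset κ) (F : κ → Finset ι → ℝ) :
    Ex p (fun X => ∑ i ∈ s, F i X) = ∑ i ∈ s, Ex p (F i) := by
  simp only [Ex, Finset.mul_sum]
  exact Finset.sum_comm

theorem wt_nonneg {p : ℝ} (hp : 0 ≤ p) (hp1 : p ≤ 1) (X : Finset ι) : 0 ≤ wt p X := by
  unfold wt
  refine Finset.prod_nonneg fun k _ => ?_
  split_ifs <;> linarith

theorem Ex_mono {p : ℝ} (hp : 0 ≤ p) (hp1 : p ≤ 1) {F G : Finset ι → ℝ} (h : ∀ X, F X ≤ G X) :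
    Ex p F ≤ Ex p G :=
  Finset.sum_le_sum fun X _ => mul_le_mul_of_nonneg_left (h X) (wt_nonneg hp hp1 X)

theorem Ex_nonneg {p : ℝ} (hp : 0 ≤ p) (hp1 : p ≤ 1) {F : Finset ι → ℝ} (h : ∀ X, 0 ≤ F X) :
    0 ≤ Ex p F :=
  Finset.sum_nonneg fun X _ => mul_nonneg (wt_nonneg hp hp1 X) (h X)

theorem abs_Ex_le {p : ℝ} (hp : 0 ≤ p) (hp1 : p ≤ 1) (F : Finset ι → ℝ) :
    |Ex p F| ≤ Ex p (fun X => |F X|) := by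
  refine (Finset.abs_sum_le_sum_abs _ _).trans (le_of_eq ?_)
  exact Finset.sum_congr rfl fun X _ => by rw [abs_mul, abs_of_nonneg (wt_nonneg hp hp1 X)]

theorem Ex_zero (p : ℝ) : Ex p (fun _ : Finset ι => (0:ℝ)) = 0 := by simp [Ex]

/-- sum over configurations split along one coordinate -/
theorem sum_split (k : ι) (H : Finset ι → ℝ) :
    ∑ X : Finset ι, H X = ∑ Y ∈ (Finset.univ.erase k).powerset, (H Y + H (insert k Y)) := by
  have h1 : (Finset.univ : Finset (Finset ι)) = (insert k (Finset.univ.erase k)).powerset := by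
    rw [Finset.insert_erase (Finset.mem_univ k), Finset.powerset_univ]
  rw [h1, Finset.sum_powerset_insert (Finset.notMem_erase k _), Finset.sum_add_distrib]

theorem wt_split (p : ℝ) (k : ι) (Y : Finset ι) (hk : k ∉ Y) :
    wt p Y = (1 - p) * ∏ j ∈ Finset.univ.erase k, (if j ∈ Y then p else 1 - p) ∧
    wt p (insert k Y) = p * ∏ j ∈ Finset.univ.erase k, (if j ∈ Y then p else 1 - p) := by
  unfold wt
  constructor
  · rw [← Finset.mul_prod_erase _ _ (Finset.mem_univ k)]
    simp [hk]
  · rw [← Finset.mul_prod_erase _ _ (Finset.mem_univ k)]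
    simp only [Finset.mem_insert_self, if_true]
    congr 1
    refine Finset.prod_congr rfl fun j hj => ?_
    have : j ≠ k := Finset.ne_of_mem_erase hj
    simp [this]

/-- conditioning on one coordinate -/
theorem Ex_cond (p : ℝ) (k : ι) (F : Finset ι → ℝ) :
    Ex p F = p * Ex p (fun X => F (insert k X)) + (1 - p) * Ex p (fun X => F (X.erase k)) := by
  unfold Ex
  rw [sum_split k, sum_split k (fun X => wt p X * F (insert k X)),
    sum_split k (fun X => wt p X * F (X.erase k)), Finset.mul_sum, Finset.mul_sum,
    ← Finset.sum_add_distrib]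
  refine Finset.sum_congr rfl fun Y hY => ?_
  have hk : k ∉ Y := fun h => by
    have := Finset.mem_powerset.1 hY h
    simp at this
  obtain ⟨h1, h2⟩ := wt_split p k Y hk
  rw [h1, h2, Finset.insert_idem, Finset.erase_insert hk, Finset.erase_eq_of_notMem hk]
  ring

theorem Ex_one (p : ℝ) : Ex p (fun _ : Finset ι => (1:ℝ)) = 1 := by
  unfold Ex wt
  have := Finset.prod_add (fun _ : ι => p) (fun _ => 1 - p) Finset.univ
  simp only [add_sub_cancel, Finset.prod_const_one, Finset.powerset_univ] at this
  refine Eq.trans ?_ this.symm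
  refine Finset.sum_congr rfl fun X _ => ?_
  simp only [mul_one]
  rw [Finset.prod_ite]
  congr 2
  · congr 1; ext; simp
  · congr 1; ext; simp

theorem Ex_const (p c : ℝ) : Ex p (fun _ : Finset ι => c) = c := by
  have := Ex_mul (ι := ι) p c (fun _ => 1)
  rw [Ex_one] at this
  simpa using this

theorem Ex_indep (p : ℝ) (A : Finset ι) : ∀ (F G : Finset ι → ℝ)
    (_ : ∀ X, F (X ∩ A) = F X) (_ : ∀ X, G (X \ A) = G X),
    Ex p (fun X => F X * G X) = Ex p F * Ex p G := by
  induction A using Finset.induction_on with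
  | empty =>
    intro F G hF hG
    have : ∀ X, F X = F ∅ := fun X => by rw [← hF X]; simp
    have h2 : F = fun _ => F ∅ := funext this
    rw [h2, Ex_const, Ex_mul]
  | insert k A hk ih =>
    intro F G hF hG
    have hG1 : ∀ X, G (insert k X) = G X := fun X => by
      rw [← hG, ← hG X]; congr 1; ext; simp; try tauto
    have hG2 : ∀ X, G (X.erase k) = G X := fun X => by
      rw [← hG, ← hG X]; congr 1; ext; simp; try tauto
    have hG3 : ∀ X, G (X \ A) = G X := fun X => by
      rw [← hG, ← hG X]; congr 1; ext; simp; try tauto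
    rw [Ex_cond p k, Ex_cond p k F]
    simp only [hG1, hG2]
    rw [ih (fun X => F (insert k X)) G ?_ hG3, ih (fun X => F (X.erase k)) G ?_ hG3]
    · ring
    · intro X
      show F _ = F _
      rw [← hF, ← hF (X.erase k)]; congr 1; ext; simp; try tauto
    · intro X
      show F _ = F _
      rw [← hF, ← hF (insert k X)]; congr 1; ext; simp; try tauto

/-- indicator that `A ⊆ X`: this is `B_A`. -/
noncomputable def bi (A X : Finset ι) : ℝ := if A ⊆ X then 1 else 0

theorem bi_nonneg (A X : Finset ι) : 0 ≤ bi A X := by unfold bi; split_ifs <;> norm_num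
theorem bi_le_one (A X : Finset ι) : bi A X ≤ 1 := by unfold bi; split_ifs <;> norm_num
theorem bi_mul (A C X : Finset ι) : bi A X * bi C X = bi (A ∪ C) X := by
  unfold bi
  by_cases h1 : A ⊆ X <;> by_cases h2 : C ⊆ X <;> simp [h1, h2, Finset.union_subset_iff]

theorem Ex_bi (p : ℝ) (A : Finset ι) : Ex p (bi A) = p ^ A.card := by
  induction A using Finset.induction_on with
  | empty => simp [Ex_one, show (bi (∅ : Finset ι)) = fun _ => 1 by ext; simp [bi]]
  | insert k A hk ih =>
    rw [Ex_cond p k]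
    have h1 : (fun X => bi (insert k A) (insert k X)) = bi A := by
      ext X; unfold bi
      simp only [Finset.insert_subset_insert_iff hk]
    have h2 : (fun X : Finset ι => bi (insert k A) (X.erase k)) = fun _ => 0 := by
      ext X; unfold bi
      rw [if_neg]
      intro h
      have := h (Finset.mem_insert_self k A)
      simp at this
    rw [h1, h2, ih, Ex_zero, Finset.card_insert_of_notMem hk]
    ring

/-- centred coordinate -/
noncomputable def ce (p : ℝ) (k : ι) (X : Finset ι) : ℝ := bi {k} X - p

theorem ce_insert (p : ℝ) (k : ι) (X : Finset ι) : ce p k (insert k X) = 1 - p := by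
  simp [ce, bi]
theorem ce_erase (p : ℝ) (k : ι) (X : Finset ι) : ce p k (X.erase k) = - p := by
  simp [ce, bi]

/-- integration by parts -/
theorem Ex_ce (p : ℝ) (k : ι) (F : Finset ι → ℝ) :
    Ex p (fun X => ce p k X * F X) =
      p * (1 - p) * Ex p (fun X => F (insert k X) - F (X.erase k)) := by
  rw [Ex_cond p k, Ex_sub]
  simp only [ce_insert, ce_erase]
  rw [Ex_mul, Ex_mul]
  ring

theorem Ex_cauchy {p : ℝ} (hp : 0 ≤ p) (hp1 : p ≤ 1) (Y G : Finset ι → ℝ) (hG : ∀ X, 0 ≤ G X) :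
    (Ex p (fun X => |Y X| * G X)) ^ 2 ≤ Ex p (fun X => Y X ^ 2 * G X) * Ex p G := by
  unfold Ex
  refine Finset.sum_sq_le_sum_mul_sum_of_sq_le_mul _ ?_ ?_ ?_
  · intro X _
    exact mul_nonneg (wt_nonneg hp hp1 X) (mul_nonneg (sq_nonneg _) (hG X))
  · intro X _
    exact mul_nonneg (wt_nonneg hp hp1 X) (hG X)
  · intro X _
    have := sq_abs (Y X)
    simp only [← this]
    exact le_of_eq (by ring)

/-- telescoping of `B_Γ - p^{|Γ|}` -/
theorem telescope (p : ℝ) (Γ : Finset ι) : ∃ c : ι → Finset ι, (∀ k ∈ Γ, c k ⊆ Γ.erase k) ∧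
    ∀ X, bi Γ X - p ^ Γ.card =
      ∑ k ∈ Γ, ce p k X * (p ^ (Γ.card - 1 - (c k).card) * bi (c k) X) := by
  induction Γ using Finset.induction_on with
  | empty => exact ⟨fun _ => ∅, by simp, by simp [bi]⟩
  | insert a Γ ha ih =>
    obtain ⟨c, hc, hsum⟩ := ih
    refine ⟨fun k => if k = a then Γ else c k, ?_, ?_⟩
    · intro k hk
      by_cases h : k = a
      · subst h; simp [ha]
      · simp only [h, if_false]
        have hk' : k ∈ Γ := by simpa [h] using hk
        refine (hc k hk').trans ?_
        exact Finset.erase_subset_erase _ (Finset.subset_insert _ _)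
    · intro X
      rw [Finset.sum_insert ha, Finset.card_insert_of_notMem ha]
      simp only [if_true, Nat.add_sub_cancel, Nat.sub_self, pow_zero, one_mul]
      have h1 : ∑ k ∈ Γ, ce p k X * (p ^ (Γ.card - (if k = a then Γ else c k).card) *
          bi (if k = a then Γ else c k) X) =
          p * ∑ k ∈ Γ, ce p k X * (p ^ (Γ.card - 1 - (c k).card) * bi (c k) X) := by
        rw [Finset.mul_sum]
        refine Finset.sum_congr rfl fun k hk => ?_
        have hka : k ≠ a := fun h => ha (h ▸ hk)
        simp only [hka, if_false]
        have h2 := Finset.card_le_card (hc k hk)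
        rw [Finset.card_erase_of_mem hk] at h2
        have h3 : 0 < Γ.card := Finset.card_pos.2 ⟨k, hk⟩
        have h4 : Γ.card - (c k).card = (Γ.card - 1 - (c k).card) + 1 := by omega
        rw [h4, pow_succ]; ring
      rw [h1, ← hsum X, Finset.insert_eq, ← bi_mul]
      unfold ce
      ring

end Cube

section Gauss

/-- normal density -/
noncomputable def gphi (x : ℝ) : ℝ := Real.exp (-x ^ 2 / 2) / Real.sqrt (2 * Real.pi)

theorem gphi_pos (x : ℝ) : 0 < gphi x := by unfold gphi; positivity

theorem gphi_cont : Continuous gphi := by unfold gphi; fun_prop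

theorem gphi_eq (x : ℝ) : gphi x = gaussianPDFReal 0 1 x := by
  simp [gphi, gaussianPDFReal]; ring

theorem gphi_int : Integrable gphi := by
  have : gphi = gaussianPDFReal 0 1 := funext gphi_eq
  rw [this]; exact integrable_gaussianPDFReal 0 1

theorem gphi_total : ∫ x, gphi x = 1 := by
  have : gphi = gaussianPDFReal 0 1 := funext gphi_eq
  rw [this]; exact integral_gaussianPDFReal_eq_one 0 (by norm_num)

theorem cdf_def (z : ℝ) : stdNormalCDF z = ∫ x in Set.Iic z, gphi x := rfl

theorem cdf_deriv (z : ℝ) : HasDerivAt stdNormalCDF (gphi z) z := by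
  have h : ∀ y, stdNormalCDF y = stdNormalCDF 0 + ∫ x in (0:ℝ)..y, gphi x := by
    intro y
    rw [cdf_def, cdf_def, ← intervalIntegral.integral_Iic_sub_Iic gphi_int.integrableOn
      gphi_int.integrableOn]
    ring
  have h2 : stdNormalCDF = fun y => stdNormalCDF 0 + ∫ x in (0:ℝ)..y, gphi x := funext h
  rw [h2]
  exact (intervalIntegral.integral_hasDerivAt_right (gphi_int.intervalIntegrable)
    (gphi_cont.stronglyMeasurableAtFilter _ _) gphi_cont.continuousAt).const_add _

theorem cdf_tail (z : ℝ) : 1 - stdNormalCDF z = ∫ x in Set.Ioi z, gphi x := by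
  have := intervalIntegral.integral_Iic_add_Ioi (b := z) gphi_int.integrableOn
    gphi_int.integrableOn (μ := volume)
  rw [gphi_total] at this
  rw [cdf_def]; linarith

theorem cdf_neg (z : ℝ) : stdNormalCDF (-z) = 1 - stdNormalCDF z := by
  rw [cdf_tail, cdf_def]
  have h := integral_comp_neg_Iic (-z) gphi
  rw [neg_neg] at h
  rw [← h]
  congr 1; ext x; simp [gphi]

theorem cdf_nonneg (z : ℝ) : 0 ≤ stdNormalCDF z := by
  rw [cdf_def]; exact integral_nonneg fun x => (gphi_pos x).le

theorem tail_nonneg (z : ℝ) : 0 ≤ 1 - stdNormalCDF z := by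
  rw [← cdf_neg]; exact cdf_nonneg _

theorem tail_tendsto : Filter.Tendsto (fun z => 1 - stdNormalCDF z) Filter.atTop (nhds 0) := by
  have h : Filter.Tendsto (fun z : ℝ => ∫ x in Set.Iic z, gphi x) Filter.atTop
      (nhds (∫ x, gphi x)) := by
    refine AECover.integral_tendsto_of_countably_generated (aecover_Iic Filter.tendsto_id) gphi_int
  rw [gphi_total] at h
  have h2 := h.const_sub 1
  rw [sub_self] at h2
  exact h2

theorem gphi_tendsto : Filter.Tendsto gphi Filter.atTop (nhds 0) := by
  unfold gphi
  have h1 : Filter.Tendsto (fun x : ℝ => x ^ 2 / 2) Filter.atTop Filter.atTop :=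
    (Filter.tendsto_pow_atTop (by norm_num)).atTop_div_const (by norm_num)
  have h2 := (Real.tendsto_exp_neg_atTop_nhds_zero.comp h1).div_const (Real.sqrt (2 * Real.pi))
  simp only [zero_div] at h2
  refine h2.congr fun x => ?_
  simp [neg_div]

theorem gphi_deriv (x : ℝ) : HasDerivAt gphi (-x * gphi x) x := by
  have h1 : HasDerivAt (fun x : ℝ => -x ^ 2 / 2) (-x) x := by
    have := ((hasDerivAt_pow 2 x).neg).div_const 2
    exact this.congr_deriv (by simp; ring)
  have h2 := (h1.exp).div_const (Real.sqrt (2 * Real.pi))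
  exact h2.congr_deriv (by unfold gphi; ring)

/-- nonnegativity from decrease to zero -/
theorem nonneg_of_decr (H H' : ℝ → ℝ) (a : ℝ) (hd : ∀ x, a ≤ x → HasDerivAt H (H' x) x)
    (hneg : ∀ x, a ≤ x → H' x ≤ 0) (hl : Filter.Tendsto H Filter.atTop (nhds 0)) : 0 ≤ H a := by
  have hanti : AntitoneOn H (Set.Ici a) := by
    refine antitoneOn_of_deriv_nonpos (convex_Ici a)
      (fun x hx => (hd x hx).continuousAt.continuousWithinAt)
      (fun x hx => ?_) (fun x hx => ?_)
    · rw [interior_Ici] at hx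
      exact (hd x (le_of_lt hx)).differentiableAt.differentiableWithinAt
    · rw [interior_Ici] at hx
      rw [(hd x (le_of_lt hx)).deriv]; exact hneg x (le_of_lt hx)
  refine le_of_tendsto hl ?_
  filter_upwards [Filter.eventually_ge_atTop a] with x hx
  exact hanti (Set.self_mem_Ici) hx hx

theorem tail_deriv (x : ℝ) : HasDerivAt (fun x => 1 - stdNormalCDF x) (-gphi x) x :=
  (cdf_deriv x).const_sub 1

theorem tail_pos (z : ℝ) : 0 < 1 - stdNormalCDF z := by
  have h1 : 1 - stdNormalCDF (z+1) < 1 - stdNormalCDF z := by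
    have : StrictMono stdNormalCDF := by
      refine strictMono_of_deriv_pos fun x => ?_
      rw [(cdf_deriv x).deriv]; exact gphi_pos x
    have := this (show z < z + 1 by linarith)
    linarith
  linarith [tail_nonneg (z+1)]

theorem mills_upper (x : ℝ) : x * (1 - stdNormalCDF x) ≤ gphi x := by
  rcases le_or_gt x 0 with hx | hx
  · have := tail_nonneg x
    nlinarith [gphi_pos x]
  · have key : 0 ≤ gphi x / x - (1 - stdNormalCDF x) := by
      refine nonneg_of_decr (fun x => gphi x / x - (1 - stdNormalCDF x))
        (fun x => ((-x * gphi x) * x - gphi x * 1) / x ^ 2 - (-gphi x)) x ?_ ?_ ?_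
      · intro y hy
        exact ((gphi_deriv y).div (hasDerivAt_id y) (by show y ≠ 0; linarith)).sub (tail_deriv y)
      · intro y hy
        have hy0 : 0 < y := by linarith
        have : ((-y * gphi y) * y - gphi y * 1) / y ^ 2 - (-gphi y) = - (gphi y / y ^ 2) := by
          field_simp; ring
        rw [this]
        have := gphi_pos y
        simp; positivity
      · have h := (gphi_tendsto.mul tendsto_inv_atTop_zero).sub tail_tendsto
        simpa [div_eq_mul_inv] using h
    have h3 : gphi x / x * x = gphi x := by field_simp
    nlinarith

theorem mills_lower (x : ℝ) : x * gphi x ≤ (1 + x ^ 2) * (1 - stdNormalCDF x) := by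
  rcases le_or_gt x 0 with hx | hx
  · have := tail_nonneg x
    have h2 := gphi_pos x
    have : x * gphi x ≤ 0 := by nlinarith
    have : 0 ≤ (1 + x ^ 2) * (1 - stdNormalCDF x) := by positivity
    linarith
  · have key : 0 ≤ (1 - stdNormalCDF x) - gphi x * (x / (1 + x ^ 2)) := by
      refine nonneg_of_decr (fun x => (1 - stdNormalCDF x) - gphi x * (x / (1 + x ^ 2)))
        (fun x => -gphi x - ((-x * gphi x) * (x / (1 + x ^ 2)) +
          gphi x * ((1 * (1 + x ^ 2) - x * (2 * x)) / (1 + x ^ 2) ^ 2))) x ?_ ?_ ?_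
      · intro y hy
        have h1 : HasDerivAt (fun x : ℝ => 1 + x ^ 2) (2 * y) y := by
          have := (hasDerivAt_pow 2 y).const_add 1
          simpa using this
        exact (tail_deriv y).sub ((gphi_deriv y).mul
          ((hasDerivAt_id y).div h1 (by show (1 + y ^ 2) ≠ 0; positivity)))
      · intro y hy
        have : -gphi y - ((-y * gphi y) * (y / (1 + y ^ 2)) +
          gphi y * ((1 * (1 + y ^ 2) - y * (2 * y)) / (1 + y ^ 2) ^ 2))
            = - (2 * gphi y / (1 + y ^ 2) ^ 2) := by
          field_simp; ring
        rw [this]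
        have := gphi_pos y
        simp; positivity
      · have hb : Filter.Tendsto (fun x : ℝ => gphi x * (x / (1 + x ^ 2))) Filter.atTop (nhds 0) := by
          refine squeeze_zero_norm (a := gphi) (fun y => ?_) gphi_tendsto
          rw [norm_mul, Real.norm_of_nonneg (gphi_pos y).le]
          refine mul_le_of_le_one_right (gphi_pos y).le ?_
          rw [norm_div, Real.norm_eq_abs, Real.norm_of_nonneg (by positivity), div_le_one (by positivity)]
          nlinarith [sq_abs y, sq_nonneg (|y| - 1)]
        simpa using tail_tendsto.sub hb
    have h3 : gphi x * (x / (1 + x ^ 2)) * (1 + x ^ 2) = x * gphi x := by field_simp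
    nlinarith

theorem tail_lower (x : ℝ) (hx : 0 ≤ x) : gphi x ≤ (1 + x) * (1 - stdNormalCDF x) := by
  have key : 0 ≤ (1 - stdNormalCDF x) - gphi x / (1 + x) := by
    refine nonneg_of_decr (fun x => (1 - stdNormalCDF x) - gphi x / (1 + x))
      (fun x => -gphi x - ((-x * gphi x) * (1 + x) - gphi x * 1) / (1 + x) ^ 2) x ?_ ?_ ?_
    · intro y hy
      exact (tail_deriv y).sub ((gphi_deriv y).div ((hasDerivAt_id y).const_add 1)
        (by show (1 + y) ≠ 0; linarith))
    · intro y hy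
      have hy0 : 0 ≤ y := by linarith
      have : -gphi y - ((-y * gphi y) * (1 + y) - gphi y * 1) / (1 + y) ^ 2
          = - (y * gphi y / (1 + y) ^ 2) := by
        field_simp; ring
      rw [this]
      have := gphi_pos y
      simp; positivity
    · have hb : Filter.Tendsto (fun x : ℝ => gphi x / (1 + x)) Filter.atTop (nhds 0) := by
        have h := gphi_tendsto.mul (tendsto_inv_atTop_zero.comp
          (Filter.tendsto_atTop_add_const_left _ (1:ℝ) Filter.tendsto_id))
        simpa [div_eq_mul_inv] using h
      simpa using tail_tendsto.sub hb
  have h3 : gphi x / (1 + x) * (1 + x) = gphi x := by field_simp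
  nlinarith

/-- Mills ratio -/
noncomputable def mR (x : ℝ) : ℝ := (1 - stdNormalCDF x) / gphi x

theorem mR_nonneg (x : ℝ) : 0 ≤ mR x := div_nonneg (tail_nonneg x) (gphi_pos x).le

theorem mR_deriv (x : ℝ) : HasDerivAt mR (x * mR x - 1) x := by
  have h := (tail_deriv x).div (gphi_deriv x) (gphi_pos x).ne'
  have h0 := (gphi_pos x).ne'
  exact h.congr_deriv (by unfold mR; field_simp; ring)

theorem mR_mul_le (x : ℝ) : x * mR x ≤ 1 := by
  unfold mR
  rw [← mul_div_assoc, div_le_one (gphi_pos x)]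
  exact mills_upper x

theorem mR_mono : Monotone (fun x => x * mR x) := by
  have hd : ∀ x, HasDerivAt (fun x => x * mR x) (1 * mR x + x * (x * mR x - 1)) x := fun x =>
    (hasDerivAt_id x).mul (mR_deriv x)
  refine monotone_of_deriv_nonneg (fun x => (hd x).differentiableAt) fun x => ?_
  rw [(hd x).deriv]
  have h : x ≤ (1 + x ^ 2) * mR x := by
    unfold mR
    rw [← mul_div_assoc, le_div_iff₀ (gphi_pos x)]
    exact mills_lower x
  nlinarith

theorem mvt_aux (F : ℝ → ℝ) (c : ℝ) (hd : ∀ x, HasDerivAt F (c + x * F x) x)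
    (hm : Monotone (fun x => x * F x)) (a b : ℝ) (hab : a ≤ b) :
    (c + a * F a) * (b - a) ≤ F b - F a ∧ F b - F a ≤ (c + b * F b) * (b - a) := by
  have hdiff : DifferentiableOn ℝ F (interior (Set.Icc a b)) :=
    fun x _ => (hd x).differentiableAt.differentiableWithinAt
  have hcont : ContinuousOn F (Set.Icc a b) := fun x _ => (hd x).continuousAt.continuousWithinAt
  constructor
  · refine (convex_Icc a b).mul_sub_le_image_sub_of_le_deriv hcont hdiff (fun x hx => ?_) a
      ⟨le_rfl, hab⟩ b ⟨hab, le_rfl⟩ hab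
    rw [interior_Icc] at hx
    rw [(hd x).deriv]
    have := hm (le_of_lt hx.1)
    simp only at this; linarith
  · refine (convex_Icc a b).image_sub_le_mul_sub_of_deriv_le hcont hdiff (fun x hx => ?_) a
      ⟨le_rfl, hab⟩ b ⟨hab, le_rfl⟩ hab
    rw [interior_Icc] at hx
    rw [(hd x).deriv]
    have := hm (le_of_lt hx.2)
    simp only at this; linarith

/-- indicator of `w > z` -/
noncomputable def hstep (z w : ℝ) : ℝ := if z < w then 1 else 0

theorem stein_solution (z : ℝ) : ∃ f : ℝ → ℝ, Monotone (fun w => w * f w) ∧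
    (∀ a b, a ≤ b →
      (a * f a - hstep z b + (1 - stdNormalCDF z)) * (b - a) ≤ f b - f a ∧
      f b - f a ≤ (b * f b - hstep z a + (1 - stdNormalCDF z)) * (b - a)) ∧
    (∀ w, w ≤ 0 → w ≤ z → |w * f w| ≤ 1 - stdNormalCDF z) ∧
    (∀ w, 0 ≤ w → w ≤ z → |w * f w| ≤ (1 - stdNormalCDF z) *
      (Real.sqrt (2 * Real.pi) * (w * Real.exp (w ^ 2 / 2)))) ∧
    (∀ w, 0 ≤ w → z < w → |w * f w| ≤ 1) := by
  set κ := 1 - stdNormalCDF z with hκ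
  have hκ0 : 0 ≤ κ := tail_nonneg z
  have hΦ0 := cdf_nonneg z
  set F1 : ℝ → ℝ := fun w => κ * mR (-w) with hF1
  set F2 : ℝ → ℝ := fun w => stdNormalCDF z * mR w with hF2
  have d1 : ∀ x, HasDerivAt F1 (κ + x * F1 x) x := fun x => by
    have := ((mR_deriv (-x)).comp x (hasDerivAt_neg x)).const_mul κ
    exact this.congr_deriv (by simp only [hF1]; ring)
  have d2 : ∀ x, HasDerivAt F2 ((κ - 1) + x * F2 x) x := fun x => by
    have := (mR_deriv x).const_mul (stdNormalCDF z)
    exact this.congr_deriv (by simp only [hF2]; rw [hκ]; ring)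
  have m1 : Monotone (fun x => x * F1 x) := fun x y hxy => by
    have := mR_mono (neg_le_neg hxy)
    simp only [hF1] at this ⊢
    nlinarith [mul_le_mul_of_nonneg_left this hκ0]
  have m2 : Monotone (fun x => x * F2 x) := fun x y hxy => by
    have := mR_mono hxy
    simp only [hF2] at this ⊢
    nlinarith [mul_le_mul_of_nonneg_left this hΦ0]
  have hz : F1 z = F2 z := by
    simp only [hF1, hF2]
    unfold mR
    rw [cdf_neg, show gphi (-z) = gphi z by simp [gphi]]
    rw [hκ]; ring
  refine ⟨fun w => if w ≤ z then F1 w else F2 w, ?_, ?_, ?_, ?_, ?_⟩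
  · intro a b hab
    simp only
    by_cases hb : b ≤ z
    · rw [if_pos hb, if_pos (hab.trans hb)]; exact m1 hab
    · rw [if_neg hb]
      push Not at hb
      by_cases ha : a ≤ z
      · rw [if_pos ha]
        calc a * F1 a ≤ z * F1 z := m1 ha
          _ = z * F2 z := by rw [hz]
          _ ≤ _ := m2 hb.le
      · rw [if_neg ha]; exact m2 hab
  · intro a b hab
    simp only [hstep]
    by_cases hb : b ≤ z
    · rw [if_pos hb, if_pos (hab.trans hb), if_neg (not_lt.2 hb), if_neg (not_lt.2 (hab.trans hb))]
      have := mvt_aux F1 κ d1 m1 a b hab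
      constructor <;> nlinarith [this.1, this.2]
    · rw [if_neg hb, if_pos (not_le.1 hb)]
      push Not at hb
      by_cases ha : a ≤ z
      · rw [if_pos ha, if_neg (not_lt.2 ha)]
        have h1 := mvt_aux F1 κ d1 m1 a z ha
        have h2 := mvt_aux F2 (κ - 1) d2 m2 z b hb.le
        have e1 : a * F1 a ≤ z * F1 z := m1 ha
        have e2 : z * F2 z ≤ b * F2 b := m2 hb.le
        rw [hz] at h1 e1
        constructor
        · nlinarith [h1.1, h2.1, mul_nonneg (sub_nonneg.2 e1) (sub_nonneg.2 hb.le)]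
        · nlinarith [h1.2, h2.2, mul_nonneg (sub_nonneg.2 e2) (sub_nonneg.2 ha)]
      · rw [if_neg ha, if_pos (not_le.1 ha)]
        have := mvt_aux F2 (κ - 1) d2 m2 a b hab
        constructor <;> nlinarith [this.1, this.2]
  · intro w hw hwz
    simp only
    rw [if_pos hwz]
    have h1 := mR_mul_le (-w)
    have h2 : 0 ≤ (-w) * mR (-w) := mul_nonneg (by linarith) (mR_nonneg _)
    have : w * F1 w = - (κ * (-w * mR (-w))) := by simp only [hF1]; ring
    rw [this, abs_neg, abs_of_nonneg (mul_nonneg hκ0 h2)]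
    exact mul_le_of_le_one_right hκ0 h1
  · intro w hw hwz
    simp only
    rw [if_pos hwz]
    have h2 : 0 ≤ w * mR (-w) := mul_nonneg hw (mR_nonneg _)
    have : w * F1 w = κ * (w * mR (-w)) := by simp only [hF1]; ring
    rw [this, abs_of_nonneg (mul_nonneg hκ0 h2)]
    refine mul_le_mul_of_nonneg_left ?_ hκ0
    have h3 : mR (-w) ≤ Real.sqrt (2 * Real.pi) * Real.exp (w ^ 2 / 2) := by
      unfold mR
      rw [div_le_iff₀ (gphi_pos _)]
      have : Real.sqrt (2 * Real.pi) * Real.exp (w ^ 2 / 2) * gphi (-w) = 1 := by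
        unfold gphi
        have h5 : Real.sqrt (2 * Real.pi) ≠ 0 := by positivity
        rw [mul_div_assoc', mul_assoc, ← Real.exp_add, neg_sq,
          show w ^ 2 / 2 + -w ^ 2 / 2 = 0 by ring]
        field_simp; simp
      rw [this]; linarith [cdf_nonneg (-w)]
    calc w * mR (-w) ≤ w * (Real.sqrt (2 * Real.pi) * Real.exp (w ^ 2 / 2)) :=
          mul_le_mul_of_nonneg_left h3 hw
      _ = _ := by ring
  · intro w hw hwz
    simp only
    rw [if_neg (not_le.2 hwz)]
    have h2 : 0 ≤ w * mR w := mul_nonneg hw (mR_nonneg _)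
    have : w * F2 w = stdNormalCDF z * (w * mR w) := by simp only [hF2]; ring
    rw [this, abs_of_nonneg (mul_nonneg hΦ0 h2)]
    have h4 := mR_mul_le w
    have h5 : stdNormalCDF z ≤ 1 := by linarith
    nlinarith

end Gauss

section Stein

variable {ι : Type*} [Fintype ι] [DecidableEq ι]

/-- data for the Stein argument -/
structure SteinData (p : ℝ) (W : Finset ι → ℝ) (ρ d : ι → Finset ι → ℝ) : Prop where
  hp : 0 ≤ p
  hp1 : p ≤ 1
  ρ0 : ∀ k X, 0 ≤ ρ k X
  d0 : ∀ k X, 0 ≤ d k X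
  ρi : ∀ k X, ρ k (insert k X) = ρ k X
  ρe : ∀ k X, ρ k (X.erase k) = ρ k X
  di : ∀ k X, d k (insert k X) = d k X
  de : ∀ k X, d k (X.erase k) = d k X
  hd : ∀ k X, W (insert k X) - W (X.erase k) = d k X
  hW : ∀ X, W X = ∑ k, ce p k X * ρ k X
  var : Ex p (fun X => W X ^ 2) = 1

/-- first remainder -/
noncomputable def stT (p : ℝ) (ρ d : ι → Finset ι → ℝ) (X : Finset ι) : ℝ :=
  p * (1 - p) * ∑ k, ρ k X * d k X - 1

/-- second remainder -/
noncomputable def stS (p : ℝ) (ρ d : ι → Finset ι → ℝ) (X : Finset ι) : ℝ :=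
  ∑ k, ce p k X * (ρ k X * d k X)

variable {p : ℝ} {W : Finset ι → ℝ} {ρ d : ι → Finset ι → ℝ}

theorem SteinData.ibp (H : SteinData p W ρ d) (F : Finset ι → ℝ) :
    Ex p (fun X => W X * F X) =
      p * (1 - p) * ∑ k, Ex p (fun X => ρ k X * (F (insert k X) - F (X.erase k))) := by
  have : (fun X => W X * F X) = fun X => ∑ k, ce p k X * (ρ k X * F X) := by
    funext X
    rw [H.hW X, Finset.sum_mul]
    exact Finset.sum_congr rfl fun k _ => by ring
  rw [this, Ex_sum, Finset.mul_sum]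
  refine Finset.sum_congr rfl fun k _ => ?_
  rw [Ex_ce]
  congr 2
  funext X
  rw [H.ρi, H.ρe]; ring

theorem SteinData.ExS (H : SteinData p W ρ d) (F : Finset ι → ℝ) :
    Ex p (fun X => stS p ρ d X * F X) =
      p * (1 - p) * ∑ k, Ex p (fun X => ρ k X * d k X * (F (insert k X) - F (X.erase k))) := by
  have : (fun X => stS p ρ d X * F X) = fun X => ∑ k, ce p k X * (ρ k X * d k X * F X) := by
    funext X
    rw [stS, Finset.sum_mul]
    exact Finset.sum_congr rfl fun k _ => by ring
  rw [this, Ex_sum, Finset.mul_sum]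
  refine Finset.sum_congr rfl fun k _ => ?_
  rw [Ex_ce]
  congr 2
  funext X
  rw [H.ρi, H.ρe, H.di, H.de]; ring

theorem ExT (F : Finset ι → ℝ) :
    p * (1 - p) * ∑ k, Ex p (fun X => ρ k X * d k X * F X) =
      Ex p F + Ex p (fun X => stT p ρ d X * F X) := by
  rw [← Ex_add, ← Ex_sum, ← Ex_mul]
  congr 1
  funext X
  rw [stT, ← Finset.sum_mul]; ring

theorem SteinData.ExT0 (H : SteinData p W ρ d) : Ex p (stT p ρ d) = 0 := by
  have h1 := H.ibp W
  have h2 := ExT (p := p) (ρ := ρ) (d := d) (fun _ => 1)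
  simp only [H.hd] at h1
  simp only [mul_one] at h2
  rw [← h1, Ex_one] at h2
  have h3 := H.var
  simp only [pow_two] at h3
  have h4 : Ex p (fun X => stT p ρ d X) = Ex p (stT p ρ d) := rfl
  linarith

theorem SteinData.le_ins (H : SteinData p W ρ d) (k : ι) (X : Finset ι) : W X ≤ W (insert k X) := by
  by_cases h : k ∈ X
  · rw [Finset.insert_eq_of_mem h]
  · have := H.hd k X
    rw [Finset.erase_eq_of_notMem h] at this
    linarith [H.d0 k X]

theorem SteinData.er_le (H : SteinData p W ρ d) (k : ι) (X : Finset ι) : W (X.erase k) ≤ W X := by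
  by_cases h : k ∈ X
  · have := H.hd k X
    rw [Finset.insert_eq_of_mem h] at this
    linarith [H.d0 k X]
  · rw [Finset.erase_eq_of_notMem h]

theorem SteinData.er_ins (H : SteinData p W ρ d) (k : ι) (X : Finset ι) :
    W (X.erase k) ≤ W (insert k X) := (H.er_le k X).trans (H.le_ins k X)

/-- total remainder -/
noncomputable def stR (p : ℝ) (ρ d : ι → Finset ι → ℝ) (X : Finset ι) : ℝ :=
  |stT p ρ d X| + |stS p ρ d X|

theorem hstep_mono (z : ℝ) : Monotone (hstep z) := by
  intro a b hab
  unfold hstep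
  split_ifs <;> first | linarith | norm_num

theorem SteinData.stein_bound (H : SteinData p W ρ d) (z : ℝ) (f : ℝ → ℝ)
    (hmono : Monotone (fun w => w * f w))
    (hf : ∀ a b, a ≤ b →
      (a * f a - hstep z b + (1 - stdNormalCDF z)) * (b - a) ≤ f b - f a ∧
      f b - f a ≤ (b * f b - hstep z a + (1 - stdNormalCDF z)) * (b - a)) :
    |Ex p (fun X => hstep z (W X)) - (1 - stdNormalCDF z)| ≤
      Ex p (fun X => stR p ρ d X * (|W X * f (W X)| + hstep z (W X))) := by
  set κ := 1 - stdNormalCDF z with hκ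
  set g : ℝ → ℝ := fun w => w * f w with hg
  have hpq : 0 ≤ p * (1 - p) := mul_nonneg H.hp (by linarith [H.hp1])
  have key : ∀ k X, |ρ k X * (f (W (insert k X)) - f (W (X.erase k))) -
      ρ k X * d k X * (g (W X) - hstep z (W X) + κ)| ≤
      ρ k X * d k X * ((g (W (insert k X)) + hstep z (W (insert k X))) -
        (g (W (X.erase k)) + hstep z (W (X.erase k)))) := by
    intro k X
    obtain ⟨h1, h2⟩ := hf _ _ (H.er_ins k X)
    rw [H.hd] at h1 h2
    have a1 : g (W (X.erase k)) ≤ g (W X) := hmono (H.er_le k X)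
    have a2 : g (W X) ≤ g (W (insert k X)) := hmono (H.le_ins k X)
    have a3 := hstep_mono z (H.er_le k X)
    have a4 := hstep_mono z (H.le_ins k X)
    have hr := H.ρ0 k X
    have hd := H.d0 k X
    change (g (W (X.erase k)) - _ + _) * _ ≤ _ at h1
    change _ ≤ (g (W (insert k X)) - _ + _) * _ at h2
    rw [mul_assoc, ← mul_sub, mul_assoc, abs_mul, abs_of_nonneg hr]
    refine mul_le_mul_of_nonneg_left ?_ hr
    rw [abs_le]
    constructor <;> nlinarith
  have e1 := H.ibp (fun X => f (W X))
  have e2 := ExT (p := p) (ρ := ρ) (d := d) (fun X => g (W X) - hstep z (W X) + κ)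
  have e3 := H.ExS (fun X => g (W X) + hstep z (W X))
  have e4 : |Ex p (fun X => W X * f (W X)) -
      p * (1 - p) * ∑ k, Ex p (fun X => ρ k X * d k X * (g (W X) - hstep z (W X) + κ))| ≤
      Ex p (fun X => stS p ρ d X * (g (W X) + hstep z (W X))) := by
    rw [e1, e3, ← mul_sub, ← Finset.sum_sub_distrib, abs_mul, abs_of_nonneg hpq]
    refine mul_le_mul_of_nonneg_left ?_ hpq
    refine (Finset.abs_sum_le_sum_abs _ _).trans (Finset.sum_le_sum fun k _ => ?_)
    rw [← Ex_sub]
    exact (abs_Ex_le H.hp H.hp1 _).trans (Ex_mono H.hp H.hp1 (key k))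
  rw [e2] at e4
  have e5 : Ex p (fun X => g (W X) - hstep z (W X) + κ) =
      Ex p (fun X => W X * f (W X)) - Ex p (fun X => hstep z (W X)) + κ := by
    rw [Ex_add, Ex_sub, Ex_const]
  have e6 : Ex p (fun X => stT p ρ d X * (g (W X) - hstep z (W X) + κ)) =
      Ex p (fun X => stT p ρ d X * (g (W X) - hstep z (W X))) := by
    simp only [mul_add]
    rw [Ex_add, Ex_mul']
    have := H.ExT0
    have h4 : Ex p (fun X => stT p ρ d X) = Ex p (stT p ρ d) := rfl
    rw [this]; ring
  rw [e5, e6] at e4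
  have hh0 : ∀ w, 0 ≤ hstep z w := fun w => by unfold hstep; split_ifs <;> norm_num
  have e7 : |Ex p (fun X => stT p ρ d X * (g (W X) - hstep z (W X)))| ≤
      Ex p (fun X => |stT p ρ d X| * (|W X * f (W X)| + hstep z (W X))) := by
    refine (abs_Ex_le H.hp H.hp1 _).trans (Ex_mono H.hp H.hp1 fun X => ?_)
    rw [abs_mul]
    refine mul_le_mul_of_nonneg_left ?_ (abs_nonneg _)
    refine (abs_sub _ _).trans ?_
    rw [abs_of_nonneg (hh0 _)]
  have e8 : Ex p (fun X => stS p ρ d X * (g (W X) + hstep z (W X))) ≤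
      Ex p (fun X => |stS p ρ d X| * (|W X * f (W X)| + hstep z (W X))) := by
    refine Ex_mono H.hp H.hp1 fun X => ?_
    refine (le_abs_self _).trans ?_
    rw [abs_mul]
    refine mul_le_mul_of_nonneg_left ?_ (abs_nonneg _)
    refine (abs_add_le _ _).trans ?_
    rw [abs_of_nonneg (hh0 _)]
  have e9 : Ex p (fun X => stR p ρ d X * (|W X * f (W X)| + hstep z (W X))) =
      Ex p (fun X => |stT p ρ d X| * (|W X * f (W X)| + hstep z (W X))) +
      Ex p (fun X => |stS p ρ d X| * (|W X * f (W X)| + hstep z (W X))) := by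
    rw [← Ex_add]; congr 1; funext X; rw [stR]; ring
  rw [e9]
  rw [abs_le] at e4 e7 ⊢
  constructor <;> linarith [e4.1, e4.2, e7.1, e7.2]

/-- moment generating function -/
noncomputable def mg (p : ℝ) (W : Finset ι → ℝ) (τ : ℝ) : ℝ := Ex p (fun X => Real.exp (τ * W X))

theorem mg_nonneg {p : ℝ} (hp : 0 ≤ p) (hp1 : p ≤ 1) (W : Finset ι → ℝ) (τ : ℝ) : 0 ≤ mg p W τ :=
  Ex_nonneg hp hp1 fun X => (Real.exp_pos _).le

theorem mg_zero (p : ℝ) (W : Finset ι → ℝ) : mg p W 0 = 1 := by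
  unfold mg; simp [Ex_one]

theorem mg_deriv (p : ℝ) (W : Finset ι → ℝ) (τ : ℝ) :
    HasDerivAt (mg p W) (Ex p (fun X => W X * Real.exp (τ * W X))) τ := by
  unfold mg Ex
  refine HasDerivAt.fun_sum fun X _ => ?_
  refine HasDerivAt.const_mul _ ?_
  have := ((hasDerivAt_id τ).mul_const (W X)).exp
  exact this.congr_deriv (by simp; ring)

theorem SteinData.mg_bound (H : SteinData p W ρ d) (z b : ℝ) (hb : 0 ≤ b)
    (hR : ∀ τ, 0 ≤ τ → τ ≤ z → Ex p (fun X => stR p ρ d X * Real.exp (τ * W X)) ≤ b * mg p W τ)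
    (τ : ℝ) (h0 : 0 ≤ τ) (hτ : τ ≤ z) : mg p W τ ≤ Real.exp (τ ^ 2 / 2 + τ ^ 2 * b / 2) := by
  have hpq : 0 ≤ p * (1 - p) := mul_nonneg H.hp (by linarith [H.hp1])
  have hder : ∀ x, 0 ≤ x → x ≤ z →
      Ex p (fun X => W X * Real.exp (x * W X)) ≤ x * (1 + b) * mg p W x := by
    intro x hx hxz
    rw [H.ibp (fun X => Real.exp (x * W X))]
    have e2 := ExT (p := p) (ρ := ρ) (d := d) (fun X => Real.exp (x * W X))
    have e3 := H.ExS (fun X => Real.exp (x * W X))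
    have key : ∀ k X, ρ k X * (Real.exp (x * W (insert k X)) - Real.exp (x * W (X.erase k))) ≤
        x * (ρ k X * d k X * Real.exp (x * W X)) + x * (ρ k X * d k X *
          (Real.exp (x * W (insert k X)) - Real.exp (x * W (X.erase k)))) := by
      intro k X
      have hr := H.ρ0 k X
      have hd := H.d0 k X
      have a1 : Real.exp (x * W (X.erase k)) ≤ Real.exp (x * W X) :=
        Real.exp_le_exp.2 (mul_le_mul_of_nonneg_left (H.er_le k X) hx)
      have a2 : Real.exp (x * W (insert k X)) - Real.exp (x * W (X.erase k)) ≤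
          x * d k X * Real.exp (x * W (insert k X)) := by
        have h1 := Real.add_one_le_exp (x * W (X.erase k) - x * W (insert k X))
        have h2 : Real.exp (x * W (X.erase k)) = Real.exp (x * W (insert k X)) *
          Real.exp (x * W (X.erase k) - x * W (insert k X)) := by rw [← Real.exp_add]; ring_nf
        have h3 := H.hd k X
        rw [h2, ← h3]
        nlinarith [Real.exp_pos (x * W (insert k X))]
      have a3 : x * d k X * Real.exp (x * W (insert k X)) ≤ x * d k X * (Real.exp (x * W X) +
          (Real.exp (x * W (insert k X)) - Real.exp (x * W (X.erase k)))) :=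
        mul_le_mul_of_nonneg_left (by linarith) (mul_nonneg hx hd)
      have := mul_le_mul_of_nonneg_left (a2.trans a3) hr
      linarith
    have e4 : p * (1 - p) * ∑ k, Ex p (fun X => ρ k X *
        (Real.exp (x * W (insert k X)) - Real.exp (x * W (X.erase k)))) ≤
        x * (p * (1 - p) * ∑ k, Ex p (fun X => ρ k X * d k X * Real.exp (x * W X))) +
        x * (p * (1 - p) * ∑ k, Ex p (fun X => ρ k X * d k X *
          (Real.exp (x * W (insert k X)) - Real.exp (x * W (X.erase k))))) := by
      have : ∑ k, Ex p (fun X => ρ k X *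
        (Real.exp (x * W (insert k X)) - Real.exp (x * W (X.erase k)))) ≤
        x * (∑ k, Ex p (fun X => ρ k X * d k X * Real.exp (x * W X))) +
        x * (∑ k, Ex p (fun X => ρ k X * d k X *
          (Real.exp (x * W (insert k X)) - Real.exp (x * W (X.erase k))))) := by
        rw [Finset.mul_sum, Finset.mul_sum, ← Finset.sum_add_distrib]
        refine Finset.sum_le_sum fun k _ => ?_
        rw [← Ex_mul, ← Ex_mul, ← Ex_add]
        exact Ex_mono H.hp H.hp1 (key k)
      have := mul_le_mul_of_nonneg_left this hpq
      linarith
    rw [e2, ← e3] at e4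
    have e5 : Ex p (fun X => stT p ρ d X * Real.exp (x * W X)) +
        Ex p (fun X => stS p ρ d X * Real.exp (x * W X)) ≤ b * mg p W x := by
      refine le_trans ?_ (hR x hx hxz)
      rw [← Ex_add]
      refine Ex_mono H.hp H.hp1 fun X => ?_
      rw [← add_mul, stR]
      exact mul_le_mul_of_nonneg_right (add_le_add (le_abs_self _) (le_abs_self _))
        (Real.exp_pos _).le
    have e6 : Ex p (fun X => Real.exp (x * W X)) = mg p W x := rfl
    rw [e6] at e4
    have := mul_le_mul_of_nonneg_left e5 hx
    linarith
  -- Gronwall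
  set K : ℝ → ℝ := fun x => mg p W x * Real.exp (-(x ^ 2 / 2 + x ^ 2 * b / 2)) with hK
  have hKd : ∀ x, HasDerivAt K (Ex p (fun X => W X * Real.exp (x * W X)) *
      Real.exp (-(x ^ 2 / 2 + x ^ 2 * b / 2)) + mg p W x *
      (Real.exp (-(x ^ 2 / 2 + x ^ 2 * b / 2)) * (-(x * (1 + b))))) x := by
    intro x
    refine (mg_deriv p W x).mul ?_
    refine HasDerivAt.exp ?_
    have := ((((hasDerivAt_pow 2 x).div_const 2).add
      (((hasDerivAt_pow 2 x).mul_const b).div_const 2))).neg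
    exact this.congr_deriv (by simp; ring)
  have hanti : AntitoneOn K (Set.Icc 0 z) := by
    refine antitoneOn_of_deriv_nonpos (convex_Icc 0 z)
      (fun x _ => (hKd x).continuousAt.continuousWithinAt)
      (fun x _ => (hKd x).differentiableAt.differentiableWithinAt) ?_
    intro x hx
    rw [interior_Icc] at hx
    rw [(hKd x).deriv]
    have h1 := hder x hx.1.le hx.2.le
    have h2 := Real.exp_pos (-(x ^ 2 / 2 + x ^ 2 * b / 2))
    nlinarith
  have h1 := hanti ⟨le_rfl, h0.trans hτ⟩ ⟨h0, hτ⟩ h0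
  simp only [hK, mg_zero] at h1
  have h3 : Real.exp (-((0:ℝ) ^ 2 / 2 + 0 ^ 2 * b / 2)) = 1 := by norm_num
  rw [h3, Real.exp_neg, ← div_eq_mul_inv, div_le_iff₀ (Real.exp_pos _)] at h1
  linarith

theorem expsq_le (w z : ℝ) (hw : 0 ≤ w) (hwz : w ≤ z) : w * Real.exp (w ^ 2 / 2) ≤
    ∑ j ∈ Finset.range (⌊z⌋₊ + 1), ((j:ℝ) + 1) * Real.exp (1 / 2 - (j:ℝ) ^ 2 / 2 + j * w) := by
  have hj : ⌊w⌋₊ ∈ Finset.range (⌊z⌋₊ + 1) :=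
    Finset.mem_range.2 (Nat.lt_succ_of_le (Nat.floor_le_floor hwz))
  refine le_trans ?_ (Finset.single_le_sum (f := fun j : ℕ => ((j:ℝ) + 1) *
    Real.exp (1 / 2 - (j:ℝ) ^ 2 / 2 + j * w)) (fun i _ => by positivity) hj)
  have h1 := Nat.floor_le hw
  have h2 := (Nat.lt_floor_add_one w).le
  refine mul_le_mul h2 (Real.exp_le_exp.2 ?_) (Real.exp_pos _).le (by positivity)
  nlinarith

theorem SteinData.final (H : SteinData p W ρ d) (z b : ℝ) (hz : 0 ≤ z) (hb : 0 ≤ b)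
    (hR : ∀ τ, 0 ≤ τ → τ ≤ z →
      Ex p (fun X => stR p ρ d X * Real.exp (τ * W X)) ≤ b * mg p W τ) :
    |Ex p (fun X => hstep z (W X)) - (1 - stdNormalCDF z)| ≤
      (1 - stdNormalCDF z) * (50 * b * Real.exp (b * z ^ 2) * (1 + z ^ 2)) := by
  obtain ⟨f, hmono, hf, hb1, hb2, hb3⟩ := stein_solution z
  refine (H.stein_bound z f hmono hf).trans ?_
  set κ := 1 - stdNormalCDF z with hκ
  have hκ0 : 0 ≤ κ := tail_nonneg z
  have hR0 : ∀ X, 0 ≤ stR p ρ d X := fun X => add_nonneg (abs_nonneg _) (abs_nonneg _)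
  have hpi : Real.sqrt (2 * Real.pi) ≤ 3 := by
    rw [Real.sqrt_le_left (by norm_num)]
    linarith [Real.pi_le_four]
  set E := Real.exp (b * z ^ 2) with hE
  have hE1 : 1 ≤ E := Real.one_le_exp (by positivity)
  have hτ : ∀ τ, 0 ≤ τ → τ ≤ z → Ex p (fun X => stR p ρ d X * Real.exp (τ * W X)) ≤
      b * (Real.exp (τ ^ 2 / 2) * E) := by
    intro τ h0 h1
    refine (hR τ h0 h1).trans (mul_le_mul_of_nonneg_left ?_ hb)
    refine (H.mg_bound z b hb hR τ h0 h1).trans ?_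
    rw [hE, ← Real.exp_add, Real.exp_le_exp]
    have : τ ^ 2 ≤ z ^ 2 := pow_le_pow_left₀ h0 h1 2
    nlinarith
  set J := ⌊z⌋₊ + 1 with hJ
  have pt : ∀ X, |W X * f (W X)| + hstep z (W X) ≤ κ * Real.exp (0 * W X) +
      (κ * 3 * ∑ j ∈ Finset.range J, ((j:ℝ) + 1) * Real.exp (1 / 2 - (j:ℝ) ^ 2 / 2 + j * W X) +
      2 * Real.exp (-z ^ 2 + z * W X)) := by
    intro X
    have n1 : 0 ≤ ∑ j ∈ Finset.range J, ((j:ℝ) + 1) *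
      Real.exp (1 / 2 - (j:ℝ) ^ 2 / 2 + j * W X) := Finset.sum_nonneg fun i _ => by positivity
    have n2 := Real.exp_pos (-z ^ 2 + z * W X)
    have n3 := mul_nonneg hκ0 n1
    rw [zero_mul, Real.exp_zero, mul_one]
    rcases le_or_gt (W X) z with hwz | hwz
    · have hh : hstep z (W X) = 0 := by unfold hstep; rw [if_neg (not_lt.2 hwz)]
      rw [hh, add_zero]
      rcases le_or_gt (W X) 0 with hw | hw
      · have := hb1 _ hw hwz
        linarith
      · have h1 := hb2 _ hw.le hwz
        have h2 := expsq_le _ _ hw.le hwz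
        have h4 : 0 ≤ W X * Real.exp (W X ^ 2 / 2) := by positivity
        have h3 : Real.sqrt (2 * Real.pi) * (W X * Real.exp (W X ^ 2 / 2)) ≤ 3 *
          ∑ j ∈ Finset.range J, ((j:ℝ) + 1) * Real.exp (1 / 2 - (j:ℝ) ^ 2 / 2 + j * W X) :=
          mul_le_mul hpi h2 h4 (by norm_num)
        have h5 := mul_le_mul_of_nonneg_left h3 hκ0
        linarith
    · have hh : hstep z (W X) = 1 := by unfold hstep; rw [if_pos hwz]
      have h1 := hb3 _ (hz.trans hwz.le) hwz
      have h2 : 1 ≤ Real.exp (-z ^ 2 + z * W X) := Real.one_le_exp (by nlinarith)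
      rw [hh]
      linarith
  have step1 : Ex p (fun X => stR p ρ d X * (|W X * f (W X)| + hstep z (W X))) ≤
      κ * Ex p (fun X => stR p ρ d X * Real.exp (0 * W X)) +
      (∑ j ∈ Finset.range J, (κ * 3 * ((j:ℝ) + 1) * Real.exp (1 / 2 - (j:ℝ) ^ 2 / 2)) *
        Ex p (fun X => stR p ρ d X * Real.exp (j * W X)) +
      2 * Real.exp (-z ^ 2) * Ex p (fun X => stR p ρ d X * Real.exp (z * W X))) := by
    simp only [← Ex_mul]
    rw [← Ex_sum, ← Ex_add, ← Ex_add]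
    refine Ex_mono H.hp H.hp1 fun X => ?_
    refine (mul_le_mul_of_nonneg_left (pt X) (hR0 X)).trans (le_of_eq ?_)
    simp only [Real.exp_add, Finset.mul_sum, mul_add]
    congr 1
    · ring
    · congr 1
      · exact Finset.sum_congr rfl fun j _ => by ring
      · ring
  refine step1.trans ?_
  have q0 := hτ 0 le_rfl hz
  have qz := hτ z hz le_rfl
  have qj : ∀ j ∈ Finset.range J, (κ * 3 * ((j:ℝ) + 1) * Real.exp (1 / 2 - (j:ℝ) ^ 2 / 2)) *
        Ex p (fun X => stR p ρ d X * Real.exp (j * W X)) ≤ (κ * 6 * b * E) * ((j:ℝ) + 1) := by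
    intro j hj
    have hjz : (j:ℝ) ≤ z := by
      have : j ≤ ⌊z⌋₊ := Nat.lt_succ_iff.1 (Finset.mem_range.1 hj)
      exact (Nat.cast_le.2 this).trans (Nat.floor_le hz)
    have h1 := hτ j (Nat.cast_nonneg j) hjz
    have h2 : 0 ≤ κ * 3 * ((j:ℝ) + 1) * Real.exp (1 / 2 - (j:ℝ) ^ 2 / 2) := by positivity
    refine (mul_le_mul_of_nonneg_left h1 h2).trans ?_
    have h3 : Real.exp (1 / 2 - (j:ℝ) ^ 2 / 2) * Real.exp ((j:ℝ) ^ 2 / 2) = Real.exp (1/2) := by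
      rw [← Real.exp_add]; ring_nf
    have h4 : Real.exp (1/2) ≤ 2 := by
      have h5 : Real.exp (1/2) * Real.exp (1/2) = Real.exp 1 := by rw [← Real.exp_add]; norm_num
      have := Real.exp_one_lt_d9
      nlinarith [Real.exp_pos (1/2)]
    calc _ = κ * 3 * ((j:ℝ) + 1) * b * E * (Real.exp (1 / 2 - (j:ℝ) ^ 2 / 2) *
            Real.exp ((j:ℝ) ^ 2 / 2)) := by ring
      _ ≤ κ * 3 * ((j:ℝ) + 1) * b * E * 2 := by
        rw [h3]; exact mul_le_mul_of_nonneg_left h4 (by positivity)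
      _ = _ := by ring
  have hsum : ∑ j ∈ Finset.range J, ((j:ℝ) + 1) ≤ 2 * (1 + z ^ 2) := by
    have h1 : ∀ m : ℕ, ∑ j ∈ Finset.range (m + 1), ((j:ℝ) + 1) = (m + 1) * (m + 2) / 2 := by
      intro m
      induction m with
      | zero => norm_num
      | succ m ih => rw [Finset.sum_range_succ, ih]; push_cast; ring
    rw [hJ, h1]
    have h2 := Nat.floor_le hz
    have h3 : (0:ℝ) ≤ (⌊z⌋₊ : ℝ) := Nat.cast_nonneg _
    nlinarith [sq_nonneg (z - 1/2)]
  have qsum := (Finset.sum_le_sum qj)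
  rw [← Finset.mul_sum] at qsum
  have qsum2 := qsum.trans (mul_le_mul_of_nonneg_left hsum (by positivity))
  have hez : 2 * Real.exp (-z ^ 2) * Ex p (fun X => stR p ρ d X * Real.exp (z * W X)) ≤
      12 * κ * b * E * (1 + z ^ 2) := by
    refine (mul_le_mul_of_nonneg_left qz (by positivity)).trans ?_
    have h1 : Real.exp (-z ^ 2) * Real.exp (z ^ 2 / 2) = Real.exp (-z ^ 2 / 2) := by
      rw [← Real.exp_add]; ring_nf
    have h2 : Real.exp (-z ^ 2 / 2) = Real.sqrt (2 * Real.pi) * gphi z := by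
      unfold gphi
      have : Real.sqrt (2 * Real.pi) ≠ 0 := by positivity
      field_simp
    have h3 := tail_lower z hz
    have h4 : Real.sqrt (2 * Real.pi) * gphi z ≤ 3 * ((1 + z) * κ) :=
      mul_le_mul hpi h3 (gphi_pos z).le (by norm_num)
    have h5 : 1 + z ≤ 2 * (1 + z ^ 2) := by nlinarith [sq_nonneg (z - 1/2)]
    calc _ = 2 * b * E * (Real.exp (-z ^ 2) * Real.exp (z ^ 2 / 2)) := by ring
      _ ≤ 2 * b * E * (3 * ((1 + z) * κ)) := by
        rw [h1, h2]; exact mul_le_mul_of_nonneg_left h4 (by positivity)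
      _ = 6 * b * E * κ * (1 + z) := by ring
      _ ≤ 6 * b * E * κ * (2 * (1 + z ^ 2)) := mul_le_mul_of_nonneg_left h5 (by positivity)
      _ = _ := by ring
  have q0' : κ * Ex p (fun X => stR p ρ d X * Real.exp (0 * W X)) ≤ κ * (b * E) := by
    refine mul_le_mul_of_nonneg_left ?_ hκ0
    simpa using q0
  have hκbE : 0 ≤ κ * (b * E) := by positivity
  nlinarith [mul_nonneg hκbE (sq_nonneg z)]

end Stein

section Tilt

variable {ι : Type*} [Fintype ι] [DecidableEq ι]

/-- indicator of meeting -/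
noncomputable def mee (A C : Finset ι) : ℝ := if Disjoint A C then 0 else 1

theorem mee_nonneg (A C : Finset ι) : 0 ≤ mee A C := by unfold mee; split_ifs <;> norm_num
theorem mee_le_one (A C : Finset ι) : mee A C ≤ 1 := by unfold mee; split_ifs <;> norm_num
theorem mee_comm (A C : Finset ι) : mee A C = mee C A := by
  unfold mee; simp only [disjoint_comm]

theorem mee_union (A C E : Finset ι) : mee A (C ∪ E) = mee A C + mee A E - mee A C * mee A E := by
  unfold mee
  simp only [Finset.disjoint_union_right]
  by_cases h1 : Disjoint A C <;> by_cases h2 : Disjoint A E <;> simp [h1, h2]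

theorem mee_union_le (A C E : Finset ι) : mee A (C ∪ E) ≤ mee A C + mee A E := by
  rw [mee_union]; nlinarith [mee_nonneg A C, mee_nonneg A E]

theorem bi_sdiff (Γ X α : Finset ι) : bi Γ (X \ α) = (1 - mee Γ α) * bi Γ X := by
  unfold bi mee
  simp only [Finset.subset_sdiff]
  by_cases h1 : Γ ⊆ X <;> by_cases h2 : Disjoint Γ α <;> simp [h1, h2]

/-- count -/
noncomputable def NN (M : Finset (Finset ι)) (X : Finset ι) : ℝ := ∑ Γ ∈ M, bi Γ X

/-- standardized count -/
noncomputable def WW (M : Finset (Finset ι)) (p σ : ℝ) (X : Finset ι) : ℝ :=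
  σ⁻¹ * (NN M X - Ex p (NN M))

theorem WW_sdiff (M : Finset (Finset ι)) (p σ : ℝ) (X α : Finset ι) :
    WW M p σ (X \ α) = WW M p σ X - σ⁻¹ * ∑ Γ ∈ M, mee Γ α * bi Γ X := by
  unfold WW NN
  simp only [bi_sdiff, sub_mul, one_mul, Finset.sum_sub_distrib]
  ring

theorem tilt {p σ t : ℝ} (hp : 0 ≤ p) (hp1 : p ≤ 1) (hσ : 0 < σ) (ht : 0 ≤ t)
    (M : Finset (Finset ι)) (A : Finset ι) (R : ℝ) (hR : ∑ Γ ∈ M, mee Γ A ≤ R)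
    (Z : Finset ι → ℝ) (hZ0 : ∀ X, 0 ≤ Z X) (hZ : ∀ X, Z (X ∩ A) = Z X) :
    Ex p (fun X => Z X * Real.exp (t * WW M p σ X)) ≤
      Real.exp (t * R / σ) * Ex p Z * mg p (WW M p σ) t := by
  have h1 : ∀ X, WW M p σ X ≤ WW M p σ (X \ A) + σ⁻¹ * R := by
    intro X
    rw [WW_sdiff]
    have : ∑ Γ ∈ M, mee Γ A * bi Γ X ≤ R :=
      le_trans (Finset.sum_le_sum fun Γ _ =>
        mul_le_of_le_one_right (mee_nonneg _ _) (bi_le_one _ _)) hR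
    have := mul_le_mul_of_nonneg_left this (inv_pos.2 hσ).le
    linarith
  have h2 : ∀ X, WW M p σ (X \ A) ≤ WW M p σ X := by
    intro X
    rw [WW_sdiff]
    have : 0 ≤ ∑ Γ ∈ M, mee Γ A * bi Γ X :=
      Finset.sum_nonneg fun Γ _ => mul_nonneg (mee_nonneg _ _) (bi_nonneg _ _)
    have := mul_nonneg (inv_pos.2 hσ).le this
    linarith
  have h3 : Ex p (fun X => Z X * Real.exp (t * WW M p σ X)) ≤
      Ex p (fun X => Real.exp (t * R / σ) * (Z X * Real.exp (t * WW M p σ (X \ A)))) := by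
    refine Ex_mono hp hp1 fun X => ?_
    have : Real.exp (t * WW M p σ X) ≤ Real.exp (t * R / σ) *
        Real.exp (t * WW M p σ (X \ A)) := by
      rw [← Real.exp_add, Real.exp_le_exp]
      have := mul_le_mul_of_nonneg_left (h1 X) ht
      rw [div_eq_mul_inv]; linarith
    have := mul_le_mul_of_nonneg_left this (hZ0 X)
    linarith
  refine h3.trans ?_
  rw [Ex_mul, mul_assoc]
  refine mul_le_mul_of_nonneg_left ?_ (Real.exp_pos _).le
  rw [Ex_indep p A Z (fun X => Real.exp (t * WW M p σ (X \ A))) hZ (fun X => by simp)]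
  refine mul_le_mul_of_nonneg_left ?_ (Ex_nonneg hp hp1 hZ0)
  exact Ex_mono hp hp1 fun X => Real.exp_le_exp.2 (mul_le_mul_of_nonneg_left (h2 X) ht)

theorem dd_aux (x a b c : ℝ) (ha : 0 ≤ a) (hb : 0 ≤ b) (hc : 0 ≤ c) (hca : c ≤ a) :
    |Real.exp x - Real.exp (x - a) - Real.exp (x - b) + Real.exp (x - (a + b - c))| ≤
      Real.exp x * (a * b + c) := by
  have e1 : Real.exp (x - a) = Real.exp x * Real.exp (-a) := by rw [← Real.exp_add]; ring_nf
  have e2 : Real.exp (x - b) = Real.exp x * Real.exp (-b) := by rw [← Real.exp_add]; ring_nf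
  have e3 : Real.exp (x - (a + b - c)) = Real.exp x * Real.exp (-(a + b - c)) := by
    rw [← Real.exp_add]; ring_nf
  have e4 : Real.exp (-a) * Real.exp (-b) = Real.exp (-(a + b - c)) * Real.exp (-c) := by
    rw [← Real.exp_add, ← Real.exp_add]; ring_nf
  have hx := Real.exp_pos x
  have a1 := Real.add_one_le_exp (-a)
  have a2 := Real.add_one_le_exp (-b)
  have a3 := Real.add_one_le_exp (-c)
  have a4 : Real.exp (-a) ≤ 1 := Real.exp_le_one_iff.2 (by linarith)
  have a5 : Real.exp (-b) ≤ 1 := Real.exp_le_one_iff.2 (by linarith)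
  have a6 : Real.exp (-c) ≤ 1 := Real.exp_le_one_iff.2 (by linarith)
  have a7 : Real.exp (-(a + b - c)) ≤ 1 := Real.exp_le_one_iff.2 (by linarith)
  have a8 := Real.exp_pos (-(a + b - c))
  rw [e1, e2, e3]
  have e5 : Real.exp x - Real.exp x * Real.exp (-a) - Real.exp x * Real.exp (-b) +
      Real.exp x * Real.exp (-(a + b - c)) = Real.exp x * ((1 - Real.exp (-a)) *
      (1 - Real.exp (-b)) + Real.exp (-(a + b - c)) * (1 - Real.exp (-c))) := by
    linear_combination Real.exp x * (-e4)
  rw [e5, abs_of_nonneg]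
  · refine mul_le_mul_of_nonneg_left (add_le_add ?_ ?_) hx.le
    · exact mul_le_mul (by linarith) (by linarith) (by linarith) ha
    · nlinarith
  · refine mul_nonneg hx.le (add_nonneg (mul_nonneg ?_ ?_) (mul_nonneg ?_ ?_)) <;> linarith

/-- double difference -/
theorem double_diff {p σ t : ℝ} (hp : 0 ≤ p) (hp1 : p ≤ 1) (hσ : 0 < σ) (ht : 0 ≤ t)
    (M : Finset (Finset ι)) (α β : Finset ι) (hαβ : Disjoint α β)
    (U V : Finset ι → ℝ) (hU : ∀ X, U (X ∩ α) = U X) (hV : ∀ X, V (X ∩ β) = V X)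
    (hU0 : Ex p U = 0) (hV0 : Ex p V = 0) :
    Ex p (fun X => U X * V X * Real.exp (t * WW M p σ X)) ≤
      (t / σ) ^ 2 * ∑ Γ ∈ M, ∑ Γ' ∈ M, mee Γ α * mee Γ' β *
        Ex p (fun X => |U X| * |V X| * bi (Γ ∪ Γ') X * Real.exp (t * WW M p σ X)) +
      (t / σ) * ∑ Γ ∈ M, mee Γ α * mee Γ β *
        Ex p (fun X => |U X| * |V X| * bi Γ X * Real.exp (t * WW M p σ X)) := by
  have hUd : ∀ X, U (X \ β) = U X := fun X => by
    rw [← hU (X \ β), ← hU X]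
    congr 1
    ext y; simp only [Finset.mem_inter, Finset.mem_sdiff]
    constructor
    · tauto
    · rintro ⟨h1, h2⟩
      exact ⟨⟨h1, fun h3 => Finset.disjoint_left.1 hαβ h2 h3⟩, h2⟩
  have hVd : ∀ X, V (X \ α) = V X := fun X => by
    rw [← hV (X \ α), ← hV X]
    congr 1
    ext y; simp only [Finset.mem_inter, Finset.mem_sdiff]
    constructor
    · tauto
    · rintro ⟨h1, h2⟩
      exact ⟨⟨h1, fun h3 => Finset.disjoint_left.1 hαβ h3 h2⟩, h2⟩
  have z1 : ∀ G : Finset ι → ℝ, Ex p (fun X => U X * V X * G (X \ α)) = 0 := fun G => by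
    have := Ex_indep p α U (fun X => V X * G (X \ α)) hU (fun X => by simp [hVd])
    rw [hU0, zero_mul] at this
    rw [← this]; congr 1; funext X; ring
  have z2 : ∀ G : Finset ι → ℝ, Ex p (fun X => U X * V X * G (X \ β)) = 0 := fun G => by
    have := Ex_indep p β V (fun X => U X * G (X \ β)) hV (fun X => by simp [hUd])
    rw [hV0, zero_mul] at this
    rw [← this]; congr 1; funext X; ring
  set F : Finset ι → ℝ := fun X => Real.exp (t * WW M p σ X) with hF
  have z3 : Ex p (fun X => U X * V X * F X) = Ex p (fun X => U X * V X *
      (F X - F (X \ α) - F (X \ β) + F ((X \ α) \ β))) := by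
    simp only [mul_add, mul_sub]
    rw [Ex_add, Ex_sub, Ex_sub, z1 F, z2 F, z1 (fun X => F (X \ β))]
    ring
  have hpt : ∀ X, |F X - F (X \ α) - F (X \ β) + F ((X \ α) \ β)| ≤ F X *
      ((t / σ) ^ 2 * ((∑ Γ ∈ M, mee Γ α * bi Γ X) * (∑ Γ ∈ M, mee Γ β * bi Γ X)) +
        (t / σ) * ∑ Γ ∈ M, mee Γ α * mee Γ β * bi Γ X) := by
    intro X
    set a := ∑ Γ ∈ M, mee Γ α * bi Γ X with ha
    set b := ∑ Γ ∈ M, mee Γ β * bi Γ X with hb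
    set c := ∑ Γ ∈ M, mee Γ α * mee Γ β * bi Γ X with hc
    have e1 : ∑ Γ ∈ M, mee Γ (α ∪ β) * bi Γ X = a + b - c := by
      rw [ha, hb, hc, ← Finset.sum_add_distrib, ← Finset.sum_sub_distrib]
      exact Finset.sum_congr rfl fun Γ _ => by rw [mee_union]; ring
    have e2 : (X \ α) \ β = X \ (α ∪ β) := by
      ext y; simp only [Finset.mem_sdiff, Finset.mem_union]; tauto
    have hτ : 0 ≤ t / σ := div_nonneg ht hσ.le
    have a0 : 0 ≤ a := Finset.sum_nonneg fun Γ _ => mul_nonneg (mee_nonneg _ _) (bi_nonneg _ _)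
    have b0 : 0 ≤ b := Finset.sum_nonneg fun Γ _ => mul_nonneg (mee_nonneg _ _) (bi_nonneg _ _)
    have c0 : 0 ≤ c := Finset.sum_nonneg fun Γ _ =>
      mul_nonneg (mul_nonneg (mee_nonneg _ _) (mee_nonneg _ _)) (bi_nonneg _ _)
    have ca : c ≤ a := Finset.sum_le_sum fun Γ _ => mul_le_mul_of_nonneg_right
      (mul_le_of_le_one_right (mee_nonneg _ _) (mee_le_one _ _)) (bi_nonneg _ _)
    have := dd_aux (t * WW M p σ X) (t / σ * a) (t / σ * b) (t / σ * c) (by positivity)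
      (by positivity) (by positivity) (mul_le_mul_of_nonneg_left ca hτ)
    rw [e2]
    simp only [hF]
    rw [WW_sdiff, WW_sdiff, WW_sdiff, e1]
    refine le_trans (le_of_eq ?_) (this.trans (le_of_eq ?_))
    · congr 1
      congr 1
      · congr 1
        · congr 2
          ring
        · congr 1; ring
      · congr 1; ring
    · ring
  rw [z3]
  refine (le_abs_self _).trans ((abs_Ex_le hp hp1 _).trans ?_)
  have : ∀ X, |U X * V X * (F X - F (X \ α) - F (X \ β) + F ((X \ α) \ β))| ≤
      (t / σ) ^ 2 * (∑ Γ ∈ M, ∑ Γ' ∈ M, mee Γ α * mee Γ' β *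
        (|U X| * |V X| * bi (Γ ∪ Γ') X * F X)) +
      (t / σ) * ∑ Γ ∈ M, mee Γ α * mee Γ β * (|U X| * |V X| * bi Γ X * F X) := by
    intro X
    rw [abs_mul, abs_mul]
    refine (mul_le_mul_of_nonneg_left (hpt X) (by positivity)).trans (le_of_eq ?_)
    rw [Finset.sum_mul_sum]
    simp only [Finset.mul_sum, mul_add]
    congr 1
    · refine Finset.sum_congr rfl fun Γ _ => Finset.sum_congr rfl fun Γ' _ => ?_
      rw [← bi_mul]; ring
    · exact Finset.sum_congr rfl fun Γ _ => by ring
  refine (Ex_mono hp hp1 this).trans (le_of_eq ?_)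
  rw [Ex_add, Ex_mul, Ex_mul, Ex_sum, Ex_sum]
  simp only [Ex_sum, Ex_mul]
  rfl

end Tilt

section Chain

variable {ι : Type*} [Fintype ι] [DecidableEq ι]

/-- unions of `r` copies -/
inductive UN (M : Finset (Finset ι)) : ℕ → Finset ι → Prop
  | one (Γ : Finset ι) (h : Γ ∈ M) : UN M 1 Γ
  | add (r : ℕ) (A Γ : Finset ι) (hA : UN M r A) (h : Γ ∈ M) : UN M (r + 1) (A ∪ Γ)

theorem mee_cases (A C : Finset ι) : mee A C = 0 ∨ mee A C = 1 := by
  unfold mee; split_ifs <;> simp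

/-- combinatorial hypotheses -/
structure ChainData (M : Finset (Finset ι)) (p : ℝ) (β : ℕ → ℝ) (D : ℝ) : Prop where
  hp : 0 ≤ p
  hp1 : p ≤ 1
  β0 : ∀ r, 0 ≤ β r
  h0 : ∑ Γ ∈ M, p ^ Γ.card ≤ β 0
  hr : ∀ r A, 1 ≤ r → UN M r A → ∑ Γ ∈ M, mee Γ A * p ^ (A ∪ Γ).card ≤ β r * p ^ A.card
  hD : ∀ Γ ∈ M, ∑ Γ' ∈ M, mee Γ' Γ ≤ D

variable {M : Finset (Finset ι)} {p : ℝ} {β : ℕ → ℝ} {D : ℝ}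

theorem UN.pos {r : ℕ} {A : Finset ι} (h : UN M r A) : 1 ≤ r := by
  cases h <;> omega

theorem ChainData.meet (H : ChainData M p β D) {r : ℕ} {A : Finset ι} (h : UN M r A) :
    ∑ Γ ∈ M, mee Γ A ≤ r * D := by
  induction h with
  | one Γ h => simpa using H.hD Γ h
  | add r A Γ hA h ih =>
    have h1 := H.hD Γ h
    calc ∑ Γ' ∈ M, mee Γ' (A ∪ Γ) ≤ ∑ Γ' ∈ M, (mee Γ' A + mee Γ' Γ) :=
          Finset.sum_le_sum fun Γ' _ => mee_union_le _ _ _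
      _ ≤ _ := by rw [Finset.sum_add_distrib]; push_cast; linarith

theorem ChainData.C1 (H : ChainData M p β D) {r : ℕ} {A : Finset ι} (h : UN M r A) :
    ∑ Γ ∈ M, mee Γ A * p ^ (A ∪ Γ).card ≤ β r * p ^ A.card := H.hr r A h.pos h

theorem ChainData.C2 (H : ChainData M p β D) {r : ℕ} {A : Finset ι} (h : UN M r A) :
    ∑ Γ ∈ M, ∑ Γ' ∈ M, mee Γ A * mee Γ' (A ∪ Γ) * p ^ (A ∪ Γ ∪ Γ').card ≤
      β (r + 1) * β r * p ^ A.card := by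
  calc _ = ∑ Γ ∈ M, mee Γ A * ∑ Γ' ∈ M, mee Γ' (A ∪ Γ) * p ^ (A ∪ Γ ∪ Γ').card := by
        simp only [Finset.mul_sum, mul_assoc]
    _ ≤ ∑ Γ ∈ M, mee Γ A * (β (r + 1) * p ^ (A ∪ Γ).card) :=
        Finset.sum_le_sum fun Γ hΓ =>
          mul_le_mul_of_nonneg_left (H.C1 (UN.add r A Γ h hΓ)) (mee_nonneg _ _)
    _ = β (r + 1) * ∑ Γ ∈ M, mee Γ A * p ^ (A ∪ Γ).card := by
        rw [Finset.mul_sum]; exact Finset.sum_congr rfl fun _ _ => by ring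
    _ ≤ β (r + 1) * (β r * p ^ A.card) := mul_le_mul_of_nonneg_left (H.C1 h) (H.β0 _)
    _ = _ := by ring

theorem ChainData.C3 (H : ChainData M p β D) {r : ℕ} {A : Finset ι} (h : UN M r A) :
    ∑ Γ ∈ M, ∑ Γ' ∈ M, ∑ Γ'' ∈ M, mee Γ A * mee Γ' (A ∪ Γ) * mee Γ'' (A ∪ Γ ∪ Γ') *
      p ^ (A ∪ Γ ∪ Γ' ∪ Γ'').card ≤
      β (r + 2) * β (r + 1) * β r * p ^ A.card := by
  calc _ = ∑ Γ ∈ M, mee Γ A * ∑ Γ' ∈ M, ∑ Γ'' ∈ M, mee Γ' (A ∪ Γ) * mee Γ'' (A ∪ Γ ∪ Γ') *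
      p ^ (A ∪ Γ ∪ Γ' ∪ Γ'').card := by
        simp only [Finset.mul_sum, mul_assoc]
    _ ≤ ∑ Γ ∈ M, mee Γ A * (β (r + 2) * β (r + 1) * p ^ (A ∪ Γ).card) :=
        Finset.sum_le_sum fun Γ hΓ =>
          mul_le_mul_of_nonneg_left (H.C2 (UN.add r A Γ h hΓ)) (mee_nonneg _ _)
    _ = β (r + 2) * β (r + 1) * ∑ Γ ∈ M, mee Γ A * p ^ (A ∪ Γ).card := by
        rw [Finset.mul_sum]; exact Finset.sum_congr rfl fun _ _ => by ring
    _ ≤ β (r + 2) * β (r + 1) * (β r * p ^ A.card) :=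
        mul_le_mul_of_nonneg_left (H.C1 h) (mul_nonneg (H.β0 _) (H.β0 _))
    _ = _ := by ring

theorem g2_pt (x y A : Finset ι) : mee y x * mee (x ∪ y) A ≤
    mee x A * mee y (A ∪ x) + mee y A * mee x (A ∪ y) := by
  rw [mee_comm (x ∪ y), mee_union, mee_union, mee_union, mee_comm A x, mee_comm A y, mee_comm x y]
  rcases mee_cases x A with h1 | h1 <;> rcases mee_cases y A with h2 | h2 <;>
    rcases mee_cases y x with h3 | h3 <;> rw [h1, h2, h3] <;> norm_num

theorem g3_pt (x y z A : Finset ι) : mee y x * mee z (x ∪ y) * mee (x ∪ y ∪ z) A ≤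
    mee x A * mee y (A ∪ x) * mee z (A ∪ x ∪ y) + mee y A * mee x (A ∪ y) * mee z (A ∪ y ∪ x) +
    mee z A * mee x (A ∪ z) * mee y (A ∪ z ∪ x) + mee z A * mee y (A ∪ z) * mee x (A ∪ z ∪ y) := by
  rw [mee_comm (x ∪ y ∪ z)]
  simp only [mee_union]
  rw [mee_comm A x, mee_comm A y, mee_comm A z, mee_comm x y, mee_comm x z, mee_comm y z]
  rcases mee_cases x A with h1 | h1 <;> rcases mee_cases y A with h2 | h2 <;>
    rcases mee_cases y x with h3 | h3 <;> rcases mee_cases z A with h4 | h4 <;>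
    rcases mee_cases z x with h5 | h5 <;> rcases mee_cases z y with h6 | h6 <;>
    rw [h1, h2, h3, h4, h5, h6] <;> norm_num

theorem ChainData.G2 (H : ChainData M p β D) {r : ℕ} {A : Finset ι} (h : UN M r A) :
    ∑ x ∈ M, ∑ y ∈ M, mee y x * mee (x ∪ y) A * p ^ (A ∪ (x ∪ y)).card ≤
      2 * (β (r + 1) * β r) * p ^ A.card := by
  have h2 := H.C2 h
  have h3 := h2
  rw [Finset.sum_comm] at h3
  calc _ ≤ ∑ x ∈ M, ∑ y ∈ M, (mee x A * mee y (A ∪ x) * p ^ (A ∪ x ∪ y).card +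
        mee y A * mee x (A ∪ y) * p ^ (A ∪ y ∪ x).card) := by
        refine Finset.sum_le_sum fun x _ => Finset.sum_le_sum fun y _ => ?_
        rw [show A ∪ (x ∪ y) = A ∪ x ∪ y by rw [Finset.union_assoc],
          show A ∪ y ∪ x = A ∪ x ∪ y by rw [Finset.union_right_comm], ← add_mul]
        exact mul_le_mul_of_nonneg_right (g2_pt x y A) (pow_nonneg H.hp _)
    _ ≤ _ := by
        simp only [Finset.sum_add_distrib]
        linarith

theorem ChainData.G3 (H : ChainData M p β D) {r : ℕ} {A : Finset ι} (h : UN M r A) :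
    ∑ x ∈ M, ∑ y ∈ M, ∑ z ∈ M, mee y x * mee z (x ∪ y) * mee (x ∪ y ∪ z) A *
      p ^ (A ∪ (x ∪ y ∪ z)).card ≤ 4 * (β (r + 2) * β (r + 1) * β r) * p ^ A.card := by
  have h1 := H.C3 h
  set f : Finset ι → Finset ι → Finset ι → ℝ := fun x y z =>
    mee x A * mee y (A ∪ x) * mee z (A ∪ x ∪ y) * p ^ (A ∪ x ∪ y ∪ z).card with hf
  change ∑ x ∈ M, ∑ y ∈ M, ∑ z ∈ M, f x y z ≤ _ at h1
  have e2 : ∑ x ∈ M, ∑ y ∈ M, ∑ z ∈ M, f y x z = ∑ x ∈ M, ∑ y ∈ M, ∑ z ∈ M, f x y z :=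
    Finset.sum_comm
  have e3 : ∑ x ∈ M, ∑ y ∈ M, ∑ z ∈ M, f z x y = ∑ x ∈ M, ∑ y ∈ M, ∑ z ∈ M, f x y z := by
    rw [Finset.sum_congr rfl fun x _ => Finset.sum_comm (f := fun y z => f z x y), Finset.sum_comm]
  have e4 : ∑ x ∈ M, ∑ y ∈ M, ∑ z ∈ M, f z y x = ∑ x ∈ M, ∑ y ∈ M, ∑ z ∈ M, f x y z := by
    rw [Finset.sum_comm, Finset.sum_congr rfl fun x _ => Finset.sum_comm (f := fun y z => f z x y),
      Finset.sum_comm]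
  calc _ ≤ ∑ x ∈ M, ∑ y ∈ M, ∑ z ∈ M, (f x y z + f y x z + f z x y + f z y x) := by
        refine Finset.sum_le_sum fun x _ => Finset.sum_le_sum fun y _ =>
          Finset.sum_le_sum fun z _ => ?_
        simp only [hf]
        rw [show A ∪ (x ∪ y ∪ z) = A ∪ x ∪ y ∪ z by simp only [Finset.union_assoc],
          show A ∪ y ∪ x ∪ z = A ∪ x ∪ y ∪ z by rw [Finset.union_right_comm A y x],
          show A ∪ z ∪ x ∪ y = A ∪ x ∪ y ∪ z by
            rw [Finset.union_right_comm A z x, Finset.union_right_comm (A ∪ x) z y],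
          show A ∪ z ∪ y ∪ x = A ∪ x ∪ y ∪ z by
            rw [Finset.union_right_comm (A ∪ z) y x, Finset.union_right_comm A z x,
              Finset.union_right_comm (A ∪ x) z y], ← add_mul, ← add_mul, ← add_mul]
        have := g3_pt x y z A
        rw [show A ∪ z ∪ y = A ∪ z ∪ y from rfl] at this
        exact mul_le_mul_of_nonneg_right this (pow_nonneg H.hp _)
    _ ≤ _ := by
        simp only [Finset.sum_add_distrib]
        rw [e2, e3, e4]
        linarith

/-- sums starting with a free copy -/
theorem ChainData.S2 (H : ChainData M p β D) :
    ∑ x ∈ M, ∑ y ∈ M, mee y x * p ^ (x ∪ y).card ≤ β 0 * β 1 := by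
  calc _ ≤ ∑ x ∈ M, β 1 * p ^ x.card := Finset.sum_le_sum fun x hx => H.C1 (UN.one x hx)
    _ = β 1 * ∑ x ∈ M, p ^ x.card := by rw [Finset.mul_sum]
    _ ≤ β 1 * β 0 := mul_le_mul_of_nonneg_left H.h0 (H.β0 _)
    _ = _ := by ring

theorem ChainData.S3 (H : ChainData M p β D) :
    ∑ x ∈ M, ∑ y ∈ M, ∑ z ∈ M, mee y x * mee z (x ∪ y) * p ^ (x ∪ y ∪ z).card ≤
      β 0 * β 1 * β 2 := by
  calc _ ≤ ∑ x ∈ M, β 2 * β 1 * p ^ x.card := Finset.sum_le_sum fun x hx => H.C2 (UN.one x hx)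
    _ = β 2 * β 1 * ∑ x ∈ M, p ^ x.card := by rw [Finset.mul_sum]
    _ ≤ β 2 * β 1 * β 0 := mul_le_mul_of_nonneg_left H.h0 (mul_nonneg (H.β0 _) (H.β0 _))
    _ = _ := by ring

theorem UN2 {x y : Finset ι} (hx : x ∈ M) (hy : y ∈ M) : UN M 2 (x ∪ y) :=
  UN.add 1 x y (UN.one x hx) hy

theorem UN3 {x y z : Finset ι} (hx : x ∈ M) (hy : y ∈ M) (hz : z ∈ M) : UN M 3 (x ∪ y ∪ z) :=
  UN.add 2 _ z (UN2 hx hy) hz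

/-- first sum -/
theorem ChainData.sum1 (H : ChainData M p β D) :
    ∑ a ∈ M, ∑ b ∈ M, ∑ x ∈ M, ∑ y ∈ M, mee b a * (mee y x * mee (x ∪ y) (a ∪ b) *
      p ^ (a ∪ b ∪ (x ∪ y)).card) ≤ 2 * (β 0 * β 1 * β 2 * β 3) := by
  have h := H.S2
  have hb : 0 ≤ 2 * (β 3 * β 2) := mul_nonneg (by norm_num) (mul_nonneg (H.β0 _) (H.β0 _))
  calc _ = ∑ a ∈ M, ∑ b ∈ M, mee b a * ∑ x ∈ M, ∑ y ∈ M, (mee y x * mee (x ∪ y) (a ∪ b) *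
      p ^ (a ∪ b ∪ (x ∪ y)).card) := by simp only [Finset.mul_sum]
    _ ≤ ∑ a ∈ M, ∑ b ∈ M, mee b a * (2 * (β 3 * β 2) * p ^ (a ∪ b).card) :=
        Finset.sum_le_sum fun a ha => Finset.sum_le_sum fun b hb =>
          mul_le_mul_of_nonneg_left (H.G2 (UN2 ha hb)) (mee_nonneg _ _)
    _ = 2 * (β 3 * β 2) * ∑ a ∈ M, ∑ b ∈ M, mee b a * p ^ (a ∪ b).card := by
        simp only [Finset.mul_sum]
        exact Finset.sum_congr rfl fun _ _ => Finset.sum_congr rfl fun _ _ => by ring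
    _ ≤ 2 * (β 3 * β 2) * (β 0 * β 1) := mul_le_mul_of_nonneg_left h hb
    _ = _ := by ring

/-- third sum -/
theorem ChainData.sum3 (H : ChainData M p β D) :
    ∑ a ∈ M, ∑ b ∈ M, ∑ c ∈ M, ∑ x ∈ M, ∑ y ∈ M, mee b a * mee c (a ∪ b) *
      (mee y x * mee (x ∪ y) (a ∪ b ∪ c) * p ^ (a ∪ b ∪ c ∪ (x ∪ y)).card) ≤
        2 * (β 0 * β 1 * β 2 * β 3 * β 4) := by
  have h := H.S3
  have hb : 0 ≤ 2 * (β 4 * β 3) := mul_nonneg (by norm_num) (mul_nonneg (H.β0 _) (H.β0 _))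
  calc _ = ∑ a ∈ M, ∑ b ∈ M, ∑ c ∈ M, mee b a * mee c (a ∪ b) * ∑ x ∈ M, ∑ y ∈ M,
      (mee y x * mee (x ∪ y) (a ∪ b ∪ c) * p ^ (a ∪ b ∪ c ∪ (x ∪ y)).card) := by
        simp only [Finset.mul_sum]
    _ ≤ ∑ a ∈ M, ∑ b ∈ M, ∑ c ∈ M, mee b a * mee c (a ∪ b) *
        (2 * (β 4 * β 3) * p ^ (a ∪ b ∪ c).card) :=
        Finset.sum_le_sum fun a ha => Finset.sum_le_sum fun b hb => Finset.sum_le_sum fun c hc =>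
          mul_le_mul_of_nonneg_left (H.G2 (UN3 ha hb hc))
            (mul_nonneg (mee_nonneg _ _) (mee_nonneg _ _))
    _ = 2 * (β 4 * β 3) * ∑ a ∈ M, ∑ b ∈ M, ∑ c ∈ M, mee b a * mee c (a ∪ b) *
        p ^ (a ∪ b ∪ c).card := by
        simp only [Finset.mul_sum]
        exact Finset.sum_congr rfl fun _ _ => Finset.sum_congr rfl fun _ _ =>
          Finset.sum_congr rfl fun _ _ => by ring
    _ ≤ 2 * (β 4 * β 3) * (β 0 * β 1 * β 2) := mul_le_mul_of_nonneg_left h hb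
    _ = _ := by ring

theorem pow_split {p : ℝ} (hp : 0 ≤ p) (F G : Finset ι) : p ^ (F ∪ G).card ≤
    p ^ F.card * p ^ G.card + mee G F * p ^ (F ∪ G).card := by
  unfold mee
  split_ifs with h
  · rw [Finset.card_union_of_disjoint h.symm, pow_add]; simp
  · have : 0 ≤ p ^ F.card * p ^ G.card := by positivity
    linarith

/-- second sum -/
theorem ChainData.sum2 (H : ChainData M p β D) :
    ∑ a ∈ M, ∑ b ∈ M, ∑ c ∈ M, ∑ x ∈ M, ∑ y ∈ M, ∑ z ∈ M, mee b a * mee c (a ∪ b) *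
      (mee y x * mee z (x ∪ y) * p ^ (a ∪ b ∪ c ∪ (x ∪ y ∪ z)).card) ≤
        (β 0 * β 1 * β 2) ^ 2 + 4 * (β 0 * β 1 * β 2 * β 3 * β 4 * β 5) := by
  have h := H.S3
  set Q := ∑ x ∈ M, ∑ y ∈ M, ∑ z ∈ M, mee y x * mee z (x ∪ y) * p ^ (x ∪ y ∪ z).card with hQ
  have hQ0 : 0 ≤ Q := Finset.sum_nonneg fun x _ => Finset.sum_nonneg fun y _ =>
    Finset.sum_nonneg fun z _ => mul_nonneg (mul_nonneg (mee_nonneg _ _) (mee_nonneg _ _))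
      (pow_nonneg H.hp _)
  have hB : 0 ≤ 4 * (β 5 * β 4 * β 3) :=
    mul_nonneg (by norm_num) (mul_nonneg (mul_nonneg (H.β0 _) (H.β0 _)) (H.β0 _))
  calc _ = ∑ a ∈ M, ∑ b ∈ M, ∑ c ∈ M, mee b a * mee c (a ∪ b) * ∑ x ∈ M, ∑ y ∈ M, ∑ z ∈ M,
      (mee y x * mee z (x ∪ y) * p ^ (a ∪ b ∪ c ∪ (x ∪ y ∪ z)).card) := by
        simp only [Finset.mul_sum]
    _ ≤ ∑ a ∈ M, ∑ b ∈ M, ∑ c ∈ M, mee b a * mee c (a ∪ b) *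
        ((Q + 4 * (β 5 * β 4 * β 3)) * p ^ (a ∪ b ∪ c).card) := by
        refine Finset.sum_le_sum fun a ha => Finset.sum_le_sum fun b hb =>
          Finset.sum_le_sum fun c hc => mul_le_mul_of_nonneg_left ?_
            (mul_nonneg (mee_nonneg _ _) (mee_nonneg _ _))
        have h3 := H.G3 (UN3 ha hb hc)
        rw [add_mul]
        refine le_trans ?_ (add_le_add (le_refl (Q * p ^ (a ∪ b ∪ c).card)) h3)
        rw [hQ]
        simp only [Finset.sum_mul, ← Finset.sum_add_distrib]
        refine Finset.sum_le_sum fun x _ => Finset.sum_le_sum fun y _ =>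
          Finset.sum_le_sum fun z _ => ?_
        have := mul_le_mul_of_nonneg_left (pow_split H.hp (a ∪ b ∪ c) (x ∪ y ∪ z))
          (mul_nonneg (mee_nonneg y x) (mee_nonneg z (x ∪ y)))
        refine this.trans (le_of_eq ?_)
        ring
    _ = (Q + 4 * (β 5 * β 4 * β 3)) * Q := by
        rw [hQ]
        simp only [Finset.mul_sum]
        exact Finset.sum_congr rfl fun _ _ => Finset.sum_congr rfl fun _ _ =>
          Finset.sum_congr rfl fun _ _ => by ring
    _ ≤ (β 0 * β 1 * β 2 + 4 * (β 5 * β 4 * β 3)) * (β 0 * β 1 * β 2) :=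
        mul_le_mul (by linarith) h hQ0 (by linarith)
    _ = _ := by ring

end Chain

section Pair

variable {ι : Type*} [Fintype ι] [DecidableEq ι]

/-- family of local centred variables -/
structure UData (M : Finset (Finset ι)) (p κ : ℝ)
    (U : Finset ι → Finset ι → Finset ι → ℝ) : Prop where
  κ0 : 0 ≤ κ
  hdep : ∀ a ∈ M, ∀ b ∈ M, ∀ X, U a b (X ∩ (a ∪ b)) = U a b X
  hzero : ∀ a ∈ M, ∀ b ∈ M, Disjoint b a → ∀ X, U a b X = 0
  hmean : ∀ a ∈ M, ∀ b ∈ M, Ex p (U a b) = 0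
  H1 : ∀ a ∈ M, ∀ b ∈ M, ∀ x ∈ M, ∀ y ∈ M, ∀ F,
    Ex p (fun X => |U a b X| * |U x y X| * bi F X) ≤
      κ * (1 - p) * p ^ (a ∪ b ∪ (x ∪ y) ∪ F).card
  H2 : ∀ a ∈ M, ∀ b ∈ M, ∀ x ∈ M, ∀ y ∈ M, Disjoint (a ∪ b) (x ∪ y) → ∀ F,
    Ex p (fun X => |U a b X| * |U x y X| * bi F X) ≤
      κ * (1 - p) ^ 2 * p ^ (a ∪ b ∪ (x ∪ y) ∪ F).card

variable {M : Finset (Finset ι)} {p κ : ℝ} {β : ℕ → ℝ} {D : ℝ}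
  {U : Finset ι → Finset ι → Finset ι → ℝ} {σ t : ℝ}

theorem bi_dep (F A X : Finset ι) (h : F ⊆ A) : bi F (X ∩ A) = bi F X := by
  unfold bi
  simp only [Finset.subset_inter_iff, h, and_true]

theorem UData.dep' (HU : UData M p κ U) {a b : Finset ι} (ha : a ∈ M) (hb : b ∈ M)
    (A X : Finset ι) (h : a ∪ b ⊆ A) : U a b (X ∩ A) = U a b X := by
  rw [← HU.hdep a ha b hb (X ∩ A), ← HU.hdep a ha b hb X, Finset.inter_assoc,
    Finset.inter_eq_right.2 h]

theorem UData.tilted (HU : UData M p κ U) (H : ChainData M p β D) (hσ : 0 < σ) (ht : 0 ≤ t)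
    (hD : 0 ≤ D) {a b x y : Finset ι} (ha : a ∈ M) (hb : b ∈ M) (hx : x ∈ M) (hy : y ∈ M)
    (F : Finset ι) (r : ℕ) (hr : r ≤ 6) (hun : UN M r (a ∪ b ∪ (x ∪ y) ∪ F)) :
    Ex p (fun X => |U a b X| * |U x y X| * bi F X * Real.exp (t * WW M p σ X)) ≤
      Real.exp (6 * D * t / σ) * mg p (WW M p σ) t *
        Ex p (fun X => |U a b X| * |U x y X| * bi F X) := by
  have h1 := tilt H.hp H.hp1 hσ ht M (a ∪ b ∪ (x ∪ y) ∪ F) (6 * D) ?_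
    (fun X => |U a b X| * |U x y X| * bi F X) ?_ ?_
  · refine h1.trans (le_of_eq ?_)
    rw [show t * (6 * D) / σ = 6 * D * t / σ by ring]; ring
  · refine (H.meet hun).trans ?_
    exact mul_le_mul_of_nonneg_right (by exact_mod_cast hr) hD
  · intro X
    exact mul_nonneg (mul_nonneg (abs_nonneg _) (abs_nonneg _)) (bi_nonneg _ _)
  · intro X
    beta_reduce
    rw [HU.dep' ha hb, HU.dep' hx hy, bi_dep]
    · exact Finset.subset_union_right
    · exact Finset.subset_union_right.trans Finset.subset_union_left
    · exact Finset.subset_union_left.trans Finset.subset_union_left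

theorem UData.pair (HU : UData M p κ U) (H : ChainData M p β D) (hσ : 0 < σ) (ht : 0 ≤ t)
    (hD : 0 ≤ D) {a b x y : Finset ι} (ha : a ∈ M) (hb : b ∈ M) (hx : x ∈ M) (hy : y ∈ M) :
    Ex p (fun X => U a b X * U x y X * Real.exp (t * WW M p σ X)) ≤
      Real.exp (6 * D * t / σ) * mg p (WW M p σ) t * κ * (
      (1 - p) * (mee b a * (mee y x * mee (x ∪ y) (a ∪ b) * p ^ (a ∪ b ∪ (x ∪ y)).card)) +
      (1 - p) ^ 2 * (t / σ) ^ 2 * (∑ c ∈ M, ∑ z ∈ M, mee b a * mee c (a ∪ b) *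
        (mee y x * mee z (x ∪ y) * p ^ (a ∪ b ∪ c ∪ (x ∪ y ∪ z)).card)) +
      (1 - p) ^ 2 * (t / σ) * (∑ c ∈ M, mee b a * mee c (a ∪ b) *
        (mee y x * mee (x ∪ y) (a ∪ b ∪ c) * p ^ (a ∪ b ∪ c ∪ (x ∪ y)).card))) := by
  have hq : 0 ≤ 1 - p := by linarith [H.hp1]
  have hτ : 0 ≤ t / σ := div_nonneg ht hσ.le
  have hP : ∀ A : Finset ι, 0 ≤ p ^ A.card := fun A => pow_nonneg H.hp _
  have hm := mg_nonneg H.hp H.hp1 (WW M p σ) t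
  have hK : 0 ≤ Real.exp (6 * D * t / σ) * mg p (WW M p σ) t :=
    mul_nonneg (Real.exp_pos _).le hm
  set K := Real.exp (6 * D * t / σ) * mg p (WW M p σ) t with hKdef
  have n1 : 0 ≤ mee b a * (mee y x * mee (x ∪ y) (a ∪ b) * p ^ (a ∪ b ∪ (x ∪ y)).card) :=
    mul_nonneg (mee_nonneg _ _) (mul_nonneg (mul_nonneg (mee_nonneg _ _) (mee_nonneg _ _)) (hP _))
  have n2 : 0 ≤ ∑ c ∈ M, ∑ z ∈ M, mee b a * mee c (a ∪ b) *
        (mee y x * mee z (x ∪ y) * p ^ (a ∪ b ∪ c ∪ (x ∪ y ∪ z)).card) :=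
    Finset.sum_nonneg fun c _ => Finset.sum_nonneg fun z _ =>
      mul_nonneg (mul_nonneg (mee_nonneg _ _) (mee_nonneg _ _))
        (mul_nonneg (mul_nonneg (mee_nonneg _ _) (mee_nonneg _ _)) (hP _))
  have n3 : 0 ≤ ∑ c ∈ M, mee b a * mee c (a ∪ b) *
        (mee y x * mee (x ∪ y) (a ∪ b ∪ c) * p ^ (a ∪ b ∪ c ∪ (x ∪ y)).card) :=
    Finset.sum_nonneg fun c _ =>
      mul_nonneg (mul_nonneg (mee_nonneg _ _) (mee_nonneg _ _))
        (mul_nonneg (mul_nonneg (mee_nonneg _ _) (mee_nonneg _ _)) (hP _))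
  have m1 := mul_nonneg hq n1
  have m2 := mul_nonneg (mul_nonneg (pow_nonneg hq 2) (pow_nonneg hτ 2)) n2
  have m3 := mul_nonneg (mul_nonneg (pow_nonneg hq 2) hτ) n3
  have hKκ := mul_nonneg hK HU.κ0
  by_cases hba : Disjoint b a
  · refine le_trans (le_of_eq ?_) (mul_nonneg hKκ (add_nonneg (add_nonneg m1 m2) m3))
    simp only [HU.hzero a ha b hb hba, zero_mul, Ex_zero]
  by_cases hyx : Disjoint y x
  · refine le_trans (le_of_eq ?_) (mul_nonneg hKκ (add_nonneg (add_nonneg m1 m2) m3))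
    simp only [HU.hzero x hx y hy hyx, mul_zero, zero_mul, Ex_zero]
  have eba : mee b a = 1 := by unfold mee; rw [if_neg hba]
  have eyx : mee y x = 1 := by unfold mee; rw [if_neg hyx]
  by_cases hd : Disjoint (a ∪ b) (x ∪ y)
  · have h := double_diff H.hp H.hp1 hσ ht M (a ∪ b) (x ∪ y) hd (U a b) (U x y)
      (HU.hdep a ha b hb) (HU.hdep x hx y hy) (HU.hmean a ha b hb) (HU.hmean x hx y hy)
    have b1 : ∑ Γ ∈ M, ∑ Γ' ∈ M, mee Γ (a ∪ b) * mee Γ' (x ∪ y) *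
        Ex p (fun X => |U a b X| * |U x y X| * bi (Γ ∪ Γ') X * Real.exp (t * WW M p σ X)) ≤
        K * κ * ((1 - p) ^ 2 * ∑ c ∈ M, ∑ z ∈ M, mee b a * mee c (a ∪ b) *
        (mee y x * mee z (x ∪ y) * p ^ (a ∪ b ∪ c ∪ (x ∪ y ∪ z)).card)) := by
      simp only [Finset.mul_sum]
      refine Finset.sum_le_sum fun c hc => Finset.sum_le_sum fun z hz => ?_
      have hun : UN M 6 (a ∪ b ∪ (x ∪ y) ∪ (c ∪ z)) := by
        rw [show a ∪ b ∪ (x ∪ y) ∪ (c ∪ z) = a ∪ b ∪ x ∪ y ∪ c ∪ z by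
          simp only [Finset.union_assoc]]
        exact UN.add _ _ _ (UN.add _ _ _ (UN.add _ _ _ (UN3 ha hb hx) hy) hc) hz
      have h1 := HU.tilted H hσ ht hD ha hb hx hy (c ∪ z) 6 le_rfl hun
      have h2 := mul_le_mul_of_nonneg_left (HU.H2 a ha b hb x hx y hy hd (c ∪ z)) hK
      have hs : a ∪ b ∪ (x ∪ y) ∪ (c ∪ z) = a ∪ b ∪ c ∪ (x ∪ y ∪ z) := by
        ext w; simp only [Finset.mem_union]; tauto
      rw [hs] at h2
      have h3 := mul_le_mul_of_nonneg_left (h1.trans h2)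
        (mul_nonneg (mee_nonneg c (a ∪ b)) (mee_nonneg z (x ∪ y)))
      refine h3.trans (le_of_eq ?_)
      rw [eba, eyx]; ring
    have b2 : ∑ Γ ∈ M, mee Γ (a ∪ b) * mee Γ (x ∪ y) *
        Ex p (fun X => |U a b X| * |U x y X| * bi Γ X * Real.exp (t * WW M p σ X)) ≤
        K * κ * ((1 - p) ^ 2 * ∑ c ∈ M, mee b a * mee c (a ∪ b) *
        (mee y x * mee (x ∪ y) (a ∪ b ∪ c) * p ^ (a ∪ b ∪ c ∪ (x ∪ y)).card)) := by
      simp only [Finset.mul_sum]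
      refine Finset.sum_le_sum fun c hc => ?_
      have hun : UN M 5 (a ∪ b ∪ (x ∪ y) ∪ c) := by
        rw [show a ∪ b ∪ (x ∪ y) ∪ c = a ∪ b ∪ x ∪ y ∪ c by
          simp only [Finset.union_assoc]]
        exact UN.add _ _ _ (UN.add _ _ _ (UN3 ha hb hx) hy) hc
      have h1 := HU.tilted H hσ ht hD ha hb hx hy c 5 (by norm_num) hun
      have h2 := mul_le_mul_of_nonneg_left (HU.H2 a ha b hb x hx y hy hd c) hK
      have hs : a ∪ b ∪ (x ∪ y) ∪ c = a ∪ b ∪ c ∪ (x ∪ y) := by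
        ext w; simp only [Finset.mem_union]; tauto
      rw [hs] at h2
      have hle : mee c (x ∪ y) ≤ mee (x ∪ y) (a ∪ b ∪ c) := by
        rw [mee_union (x ∪ y) (a ∪ b) c, mee_comm (x ∪ y) c]
        nlinarith [mee_nonneg (x ∪ y) (a ∪ b), mee_le_one c (x ∪ y)]
      have h3 := mul_le_mul_of_nonneg_left (h1.trans h2)
        (mul_nonneg (mee_nonneg c (a ∪ b)) (mee_nonneg c (x ∪ y)))
      refine h3.trans ?_
      have h4 : 0 ≤ mee c (a ∪ b) * (K * (κ * (1 - p) ^ 2 * p ^ (a ∪ b ∪ c ∪ (x ∪ y)).card)) :=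
        mul_nonneg (mee_nonneg _ _) (mul_nonneg hK (mul_nonneg (mul_nonneg HU.κ0
          (pow_nonneg hq 2)) (hP _)))
      have := mul_le_mul_of_nonneg_left hle h4
      rw [eba, eyx]
      linarith
    refine h.trans ?_
    have c1 := mul_le_mul_of_nonneg_left b1 (pow_nonneg hτ 2)
    have c2 := mul_le_mul_of_nonneg_left b2 hτ
    have c3 := mul_nonneg hKκ m1
    calc _ ≤ _ := add_le_add c1 c2
      _ ≤ _ := by linarith
  · have e1 : mee (x ∪ y) (a ∪ b) = 1 := by
      rw [mee_comm]; unfold mee; rw [if_neg hd]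
    have hun : UN M 4 (a ∪ b ∪ (x ∪ y) ∪ ∅) := by
      rw [show a ∪ b ∪ (x ∪ y) ∪ ∅ = a ∪ b ∪ x ∪ y by simp [Finset.union_assoc]]
      exact UN.add _ _ _ (UN3 ha hb hx) hy
    have h1 := HU.tilted H hσ ht hD ha hb hx hy ∅ 4 (by norm_num) hun
    have h2 := mul_le_mul_of_nonneg_left (HU.H1 a ha b hb x hx y hy ∅) hK
    rw [Finset.union_empty] at h2
    have h0 : Ex p (fun X => U a b X * U x y X * Real.exp (t * WW M p σ X)) ≤
        Ex p (fun X => |U a b X| * |U x y X| * bi ∅ X * Real.exp (t * WW M p σ X)) := by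
      refine Ex_mono H.hp H.hp1 fun X => mul_le_mul_of_nonneg_right ?_ (Real.exp_pos _).le
      have : bi ∅ X = 1 := by simp [bi]
      rw [this, mul_one, ← abs_mul]; exact le_abs_self _
    refine (h0.trans (h1.trans h2)).trans ?_
    have c2 := mul_nonneg hKκ m2
    have c3 := mul_nonneg hKκ m3
    calc _ = K * κ * ((1 - p) * (mee b a * (mee y x * mee (x ∪ y) (a ∪ b) *
          p ^ (a ∪ b ∪ (x ∪ y)).card))) := by rw [eba, eyx, e1]; ring
      _ ≤ _ := by rw [mul_add, mul_add]; linarith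

theorem reord (M : Finset (Finset ι)) (f : Finset ι → Finset ι → Finset ι → ℝ) :
    ∑ x ∈ M, ∑ y ∈ M, ∑ c ∈ M, f x y c = ∑ c ∈ M, ∑ x ∈ M, ∑ y ∈ M, f x y c := by
  rw [Finset.sum_congr rfl fun x _ => Finset.sum_comm (f := fun y c => f x y c), Finset.sum_comm]

/-- tilted second moment -/
theorem UData.second (HU : UData M p κ U) (H : ChainData M p β D) (hσ : 0 < σ) (ht : 0 ≤ t)
    (hD : 0 ≤ D) :
    Ex p (fun X => (∑ a ∈ M, ∑ b ∈ M, U a b X) ^ 2 * Real.exp (t * WW M p σ X)) ≤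
      Real.exp (6 * D * t / σ) * mg p (WW M p σ) t * κ * (
      (1 - p) * (2 * (β 0 * β 1 * β 2 * β 3)) +
      (1 - p) ^ 2 * (t / σ) ^ 2 *
        ((β 0 * β 1 * β 2) ^ 2 + 4 * (β 0 * β 1 * β 2 * β 3 * β 4 * β 5)) +
      (1 - p) ^ 2 * (t / σ) * (2 * (β 0 * β 1 * β 2 * β 3 * β 4))) := by
  have hq : 0 ≤ 1 - p := by linarith [H.hp1]
  have hτ : 0 ≤ t / σ := div_nonneg ht hσ.le
  have hm := mg_nonneg H.hp H.hp1 (WW M p σ) t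
  have hK : 0 ≤ Real.exp (6 * D * t / σ) * mg p (WW M p σ) t :=
    mul_nonneg (Real.exp_pos _).le hm
  have hKκ := mul_nonneg hK HU.κ0
  have e1 : (fun X => (∑ a ∈ M, ∑ b ∈ M, U a b X) ^ 2 * Real.exp (t * WW M p σ X)) =
      fun X => ∑ a ∈ M, ∑ b ∈ M, ∑ x ∈ M, ∑ y ∈ M,
        U a b X * U x y X * Real.exp (t * WW M p σ X) := by
    funext X
    rw [pow_two, mul_assoc, Finset.sum_mul]
    refine Finset.sum_congr rfl fun a _ => ?_
    rw [Finset.sum_mul]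
    refine Finset.sum_congr rfl fun b _ => ?_
    simp only [Finset.sum_mul, Finset.mul_sum, mul_assoc]
  rw [e1]
  simp only [Ex_sum]
  calc _ ≤ ∑ a ∈ M, ∑ b ∈ M, ∑ x ∈ M, ∑ y ∈ M, _ :=
        Finset.sum_le_sum fun a ha => Finset.sum_le_sum fun b hb => Finset.sum_le_sum fun x hx =>
          Finset.sum_le_sum fun y hy => HU.pair H hσ ht hD ha hb hx hy
    _ ≤ _ := by
      simp only [← Finset.mul_sum, Finset.sum_add_distrib]
      refine mul_le_mul_of_nonneg_left ?_ hKκ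
      refine add_le_add (add_le_add ?_ ?_) ?_
      · refine mul_le_mul_of_nonneg_left (le_trans (le_of_eq ?_) H.sum1) hq
        simp only [Finset.mul_sum]
      · refine mul_le_mul_of_nonneg_left (le_trans (le_of_eq ?_) H.sum2)
          (mul_nonneg (pow_nonneg hq 2) (pow_nonneg hτ 2))
        simp only [Finset.mul_sum]
        refine Finset.sum_congr rfl fun a _ => Finset.sum_congr rfl fun b _ => ?_
        exact reord M _
      · refine mul_le_mul_of_nonneg_left (le_trans (le_of_eq ?_) H.sum3)
          (mul_nonneg (pow_nonneg hq 2) hτ)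
        try simp only [Finset.mul_sum]
        refine Finset.sum_congr rfl fun a _ => Finset.sum_congr rfl fun b _ => ?_
        exact reord M _

end Pair

section Conc

variable {ι : Type*} [Fintype ι] [DecidableEq ι]

theorem abs_ce {p : ℝ} (hp : 0 ≤ p) (hp1 : p ≤ 1) (k : ι) (X : Finset ι) :
    |ce p k X| = (1 - 2 * p) * bi {k} X + p := by
  unfold ce bi
  split_ifs
  · rw [abs_of_nonneg (by linarith)]; ring
  · rw [abs_of_nonpos (by linarith)]; ring

theorem Ex_ce1 {p : ℝ} (hp : 0 ≤ p) (hp1 : p ≤ 1) (k : ι) (G : Finset ι) :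
    Ex p (fun X => |ce p k X| * bi G X) =
      (1 - 2 * p) * p ^ (insert k G).card + p * p ^ G.card := by
  have : (fun X => |ce p k X| * bi G X) = fun X => (1 - 2 * p) * bi (insert k G) X + p * bi G X := by
    funext X
    rw [abs_ce hp hp1, Finset.insert_eq, ← bi_mul]; ring
  rw [this, Ex_add, Ex_mul, Ex_mul, ← Ex_bi, ← Ex_bi]

theorem Ex_ce1_le {p : ℝ} (hp : 0 ≤ p) (hp1 : p ≤ 1) (k : ι) (G : Finset ι) :
    Ex p (fun X => |ce p k X| * bi G X) ≤ 2 * (1 - p) * p ^ (insert k G).card := by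
  rw [Ex_ce1 hp hp1]
  by_cases h : k ∈ G
  · rw [Finset.insert_eq_of_mem h]
    nlinarith [pow_nonneg hp G.card]
  · rw [Finset.card_insert_of_notMem h, pow_succ]
    nlinarith [pow_nonneg hp G.card]

theorem Ex_ce2_le {p : ℝ} (hp : 0 ≤ p) (hp1 : p ≤ 1) (k l : ι) (G : Finset ι) :
    Ex p (fun X => |ce p k X| * |ce p l X| * bi G X) ≤
      4 * (1 - p) * p ^ (insert k (insert l G)).card := by
  have h1 : Ex p (fun X => |ce p k X| * |ce p l X| * bi G X) ≤
      Ex p (fun X => |ce p k X| * bi (insert l G) X + p * (|ce p k X| * bi G X)) := by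
    refine Ex_mono hp hp1 fun X => ?_
    rw [abs_ce hp hp1 l, Finset.insert_eq, ← bi_mul]
    have := bi_nonneg {l} X
    have h3 : 0 ≤ |ce p k X| * bi G X := mul_nonneg (abs_nonneg _) (bi_nonneg _ _)
    nlinarith [mul_nonneg (mul_nonneg h3 this) hp]
  refine h1.trans ?_
  rw [Ex_add, Ex_mul]
  have h2 := Ex_ce1_le hp hp1 k (insert l G)
  have h3 := mul_le_mul_of_nonneg_left (Ex_ce1_le hp hp1 k G) hp
  have h4 : p * p ^ (insert k G).card ≤ p ^ (insert k (insert l G)).card := by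
    rw [← pow_succ']
    refine pow_le_pow_of_le_one hp hp1 ?_
    rw [Finset.insert_comm]
    exact Finset.card_insert_le _ _
  have := mul_le_mul_of_nonneg_left h4 (show 0 ≤ 2 * (1 - p) by linarith)
  linarith

theorem Ex_ce2_le' {p : ℝ} (hp : 0 ≤ p) (hp1 : p ≤ 1) (k l : ι) (hkl : k ≠ l) (G : Finset ι) :
    Ex p (fun X => |ce p k X| * |ce p l X| * bi G X) ≤
      4 * (1 - p) ^ 2 * p ^ (insert k (insert l G)).card := by
  have h1 : Ex p (fun X => |ce p k X| * |ce p l X| * bi G X) =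
      Ex p (fun X => (1 - 2 * p) * (|ce p l X| * bi (insert k G) X) +
        p * (|ce p l X| * bi G X)) := by
    congr 1; funext X
    rw [abs_ce hp hp1 k, Finset.insert_eq, ← bi_mul]; ring
  rw [h1, Ex_add, Ex_mul, Ex_mul]
  have hq : 0 ≤ 1 - p := by linarith
  have hf := Ex_ce1_le hp hp1 l G
  by_cases h : k ∈ G
  · rw [Finset.insert_eq_of_mem h, Finset.insert_eq_of_mem (Finset.mem_insert_of_mem h)]
    have := mul_le_mul_of_nonneg_left hf hq
    have h5 : 0 ≤ (1 - p) ^ 2 * p ^ (insert l G).card := by positivity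
    nlinarith
  · have h2 : k ∉ insert l G := by simp [hkl, h]
    have e : Ex p (fun X => |ce p l X| * bi (insert k G) X) =
        p * Ex p (fun X => |ce p l X| * bi G X) := by
      rw [Ex_ce1 hp hp1, Ex_ce1 hp hp1, Finset.insert_comm, Finset.card_insert_of_notMem h2,
        Finset.card_insert_of_notMem h, pow_succ, pow_succ]; ring
    rw [e, Finset.card_insert_of_notMem h2, pow_succ p]
    have := mul_le_mul_of_nonneg_left hf (mul_nonneg hp hq)
    nlinarith

/-- the telescoping sets -/
noncomputable def tc (p : ℝ) (Γ : Finset ι) : ι → Finset ι := Classical.choose (telescope p Γ)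

theorem tc_sub (p : ℝ) (Γ : Finset ι) : ∀ k ∈ Γ, tc p Γ k ⊆ Γ.erase k :=
  (Classical.choose_spec (telescope p Γ)).1

/-- telescoping exponents -/
noncomputable def te (p : ℝ) (Γ : Finset ι) (k : ι) : ℕ := Γ.card - 1 - (tc p Γ k).card

theorem tc_sum (p : ℝ) (Γ : Finset ι) (X : Finset ι) : bi Γ X - p ^ Γ.card =
      ∑ k ∈ Γ, ce p k X * (p ^ te p Γ k * bi (tc p Γ k) X) :=
  (Classical.choose_spec (telescope p Γ)).2 X

theorem tc_card (p : ℝ) (Γ : Finset ι) (k : ι) (hk : k ∈ Γ) :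
    (tc p Γ k).card + te p Γ k + 1 = Γ.card := by
  have h1 := Finset.card_le_card (tc_sub p Γ k hk)
  rw [Finset.card_erase_of_mem hk] at h1
  have h3 : 0 < Γ.card := Finset.card_pos.2 ⟨k, hk⟩
  unfold te; omega

/-- coefficient -/
noncomputable def rho (M : Finset (Finset ι)) (p σ : ℝ) (k : ι) (X : Finset ι) : ℝ :=
  σ⁻¹ * ∑ Γ ∈ M, if k ∈ Γ then p ^ te p Γ k * bi (tc p Γ k) X else 0

/-- discrete derivative -/
noncomputable def ddW (M : Finset (Finset ι)) (σ : ℝ) (k : ι) (X : Finset ι) : ℝ :=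
  σ⁻¹ * ∑ Γ ∈ M, if k ∈ Γ then bi (Γ.erase k) X else 0

theorem bi_ins (k : ι) (G X : Finset ι) (h : k ∉ G) : bi G (insert k X) = bi G X := by
  unfold bi
  simp only [Finset.subset_insert_iff_of_notMem h]

theorem bi_ers (k : ι) (G X : Finset ι) (h : k ∉ G) : bi G (X.erase k) = bi G X := by
  unfold bi
  simp [Finset.subset_erase, h]

theorem tc_not (p : ℝ) (Γ : Finset ι) (k : ι) (hk : k ∈ Γ) : k ∉ tc p Γ k := fun h =>
  by simpa using tc_sub p Γ k hk h

theorem Ex_NN (M : Finset (Finset ι)) (p : ℝ) : Ex p (NN M) = ∑ Γ ∈ M, p ^ Γ.card := by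
  unfold NN
  rw [Ex_sum]
  exact Finset.sum_congr rfl fun Γ _ => Ex_bi p Γ

theorem steinData (M : Finset (Finset ι)) {p σ : ℝ} (hp : 0 ≤ p) (hp1 : p ≤ 1) (hσ : 0 < σ)
    (hvar : σ ^ 2 = Ex p (fun X => NN M X ^ 2) - (Ex p (NN M)) ^ 2) :
    SteinData p (WW M p σ) (rho M p σ) (ddW M σ) where
  hp := hp
  hp1 := hp1
  ρ0 k X := by
    refine mul_nonneg (inv_pos.2 hσ).le (Finset.sum_nonneg fun Γ _ => ?_)
    split_ifs
    · exact mul_nonneg (pow_nonneg hp _) (bi_nonneg _ _)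
    · exact le_rfl
  d0 k X := by
    refine mul_nonneg (inv_pos.2 hσ).le (Finset.sum_nonneg fun Γ _ => ?_)
    split_ifs
    · exact bi_nonneg _ _
    · exact le_rfl
  ρi k X := by
    unfold rho
    congr 1
    refine Finset.sum_congr rfl fun Γ _ => ?_
    split_ifs with h
    · rw [bi_ins _ _ _ (tc_not p Γ k h)]
    · rfl
  ρe k X := by
    unfold rho
    congr 1
    refine Finset.sum_congr rfl fun Γ _ => ?_
    split_ifs with h
    · rw [bi_ers _ _ _ (tc_not p Γ k h)]
    · rfl
  di k X := by
    unfold ddW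
    congr 1
    refine Finset.sum_congr rfl fun Γ _ => ?_
    split_ifs with h
    · rw [bi_ins _ _ _ (by simp)]
    · rfl
  de k X := by
    unfold ddW
    congr 1
    refine Finset.sum_congr rfl fun Γ _ => ?_
    split_ifs with h
    · rw [bi_ers _ _ _ (by simp)]
    · rfl
  hd k X := by
    unfold WW NN ddW
    rw [← mul_sub, sub_sub_sub_cancel_right, ← Finset.sum_sub_distrib]
    congr 1
    refine Finset.sum_congr rfl fun Γ _ => ?_
    split_ifs with h
    · have h1 : bi Γ (X.erase k) = 0 := by
        unfold bi; rw [if_neg]; intro h2; simpa using h2 h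
      have h2 : bi Γ (insert k X) = bi (Γ.erase k) X := by
        unfold bi; simp [Finset.subset_insert_iff]
      rw [h1, h2, sub_zero]
    · rw [bi_ins _ _ _ h, bi_ers _ _ _ h, sub_self]
  hW X := by
    unfold WW rho
    rw [Ex_NN, NN, ← Finset.sum_sub_distrib]
    have : ∀ k, ce p k X * (σ⁻¹ * ∑ Γ ∈ M, if k ∈ Γ then p ^ te p Γ k * bi (tc p Γ k) X else 0) =
        σ⁻¹ * ∑ Γ ∈ M, if k ∈ Γ then ce p k X * (p ^ te p Γ k * bi (tc p Γ k) X) else 0 := by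
      intro k
      rw [mul_left_comm, Finset.mul_sum (a := ce p k X)]
      simp only [mul_ite, mul_zero]
    simp only [this]
    rw [← Finset.mul_sum, Finset.sum_comm]
    congr 1
    refine Finset.sum_congr rfl fun Γ _ => ?_
    rw [tc_sum, ← Finset.sum_filter]
    congr 1
    ext; simp
  var := by
    unfold WW
    have : (fun X => (σ⁻¹ * (NN M X - Ex p (NN M))) ^ 2) = fun X => (σ⁻¹) ^ 2 *
        ((NN M X ^ 2 - (2 * Ex p (NN M)) * NN M X) + (Ex p (NN M)) ^ 2) := by
      funext X; ring
    rw [this, Ex_mul, Ex_add, Ex_sub, Ex_mul, Ex_const]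
    have h2 : Ex p (fun X => NN M X) = Ex p (NN M) := rfl
    have h3 : σ ≠ 0 := hσ.ne'
    field_simp
    linarith

end Conc

section UDs

variable {ι : Type*} [Fintype ι] [DecidableEq ι]

theorem card_aux (A A' F H H' R R' : Finset ι) (h : A ⊆ H ∪ R) (h' : A' ⊆ H' ∪ R') :
    (A ∪ A' ∪ F).card ≤ R.card + R'.card + (H ∪ H' ∪ F).card := by
  have h1 : A ∪ A' ∪ F ⊆ R ∪ R' ∪ (H ∪ H' ∪ F) := by
    intro x hx
    simp only [Finset.mem_union] at hx ⊢
    rcases hx with (hx | hx) | hx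
    · have := h hx; simp only [Finset.mem_union] at this; tauto
    · have := h' hx; simp only [Finset.mem_union] at this; tauto
    · tauto
  have h2 := Finset.card_le_card h1
  have h3 := Finset.card_union_le (R ∪ R') (H ∪ H' ∪ F)
  have h4 := Finset.card_union_le R R'
  omega

/-- the neighbourhood set -/
noncomputable def hh (p : ℝ) (a b : Finset ι) (k : ι) : Finset ι := tc p a k ∪ b.erase k

theorem hh_not (p : ℝ) (a b : Finset ι) (k : ι) (hk : k ∈ a) : k ∉ hh p a b k := by
  simp [hh, tc_not p a k hk]

theorem hh_sub (p : ℝ) (a b : Finset ι) (k : ι) (hk : k ∈ a) : hh p a b k ⊆ a ∪ b := by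
  refine Finset.union_subset_union ?_ (Finset.erase_subset _ _)
  exact (tc_sub p a k hk).trans (Finset.erase_subset _ _)

theorem hh_R (p : ℝ) (a b : Finset ι) (k : ι) (hk : k ∈ a ∩ b) :
    ∃ R : Finset ι, a ∪ b ⊆ hh p a b k ∪ R ∧ R.card = te p a k + 1 := by
  rw [Finset.mem_inter] at hk
  refine ⟨a \ tc p a k, ?_, ?_⟩
  · intro x hx
    simp only [hh, Finset.mem_union, Finset.mem_sdiff, Finset.mem_erase] at hx ⊢
    by_cases h : x = k
    · subst h; have := tc_not p a x hk.1; tauto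
    · tauto
  · rw [Finset.card_sdiff_of_subset ((tc_sub p a k hk.1).trans (Finset.erase_subset _ _))]
    have := tc_card p a k hk.1
    omega

theorem hh_R' (p : ℝ) (a b : Finset ι) (k : ι) (hk : k ∈ a ∩ b) :
    ∃ R : Finset ι, a ∪ b ⊆ insert k (hh p a b k) ∪ R ∧ R.card = te p a k := by
  rw [Finset.mem_inter] at hk
  refine ⟨(a.erase k) \ tc p a k, ?_, ?_⟩
  · intro x hx
    simp only [hh, Finset.mem_union, Finset.mem_sdiff, Finset.mem_erase, Finset.mem_insert] at hx ⊢
    tauto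
  · rw [Finset.card_sdiff_of_subset (tc_sub p a k hk.1), Finset.card_erase_of_mem hk.1]
    have := tc_card p a k hk.1
    omega

/-- first local family -/
noncomputable def UT (p s : ℝ) (a b X : Finset ι) : ℝ :=
  ∑ k ∈ a ∩ b, s * ((p * (1 - p)) * (p ^ te p a k *
    (bi (hh p a b k) X - p ^ (hh p a b k).card)))

/-- second local family -/
noncomputable def US (p s : ℝ) (a b X : Finset ι) : ℝ :=
  ∑ k ∈ a ∩ b, s * (ce p k X * (p ^ te p a k * bi (hh p a b k) X))

theorem local_bound {M : Finset (Finset ι)} {p s Q κ : ℝ} {e : ℕ} (hp : 0 ≤ p) (hp1 : p ≤ 1)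
    (hs : 0 ≤ s) (hQ : 0 ≤ Q) (a b x y F : Finset ι) (ha : a.card = e) (hx : x.card = e)
    (Z Z' : ι → Finset ι → ℝ) (hZ : ∀ k X, 0 ≤ Z k X) (hZ' : ∀ k X, 0 ≤ Z' k X)
    (U U' : Finset ι → ℝ)
    (hU : ∀ X, |U X| ≤ ∑ k ∈ a ∩ b, s * Z k X) (hU' : ∀ X, |U' X| ≤ ∑ k ∈ x ∩ y, s * Z' k X)
    (hb : ∀ k ∈ a ∩ b, ∀ l ∈ x ∩ y, Ex p (fun X => Z k X * Z' l X * bi F X) ≤ Q) :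
    Ex p (fun X => |U X| * |U' X| * bi F X) ≤ (e ^ 2 * s ^ 2) * Q := by
  have h1 : Ex p (fun X => |U X| * |U' X| * bi F X) ≤ Ex p (fun X => ∑ k ∈ a ∩ b, ∑ l ∈ x ∩ y,
      s ^ 2 * (Z k X * Z' l X * bi F X)) := by
    refine Ex_mono hp hp1 fun X => ?_
    have h2 : ∑ k ∈ a ∩ b, ∑ l ∈ x ∩ y, s ^ 2 * (Z k X * Z' l X * bi F X) =
        (∑ k ∈ a ∩ b, s * Z k X) * (∑ k ∈ x ∩ y, s * Z' k X) * bi F X := by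
      rw [Finset.sum_mul_sum, Finset.sum_mul]
      refine Finset.sum_congr rfl fun k _ => ?_
      rw [Finset.sum_mul]
      refine Finset.sum_congr rfl fun l _ => ?_
      ring
    rw [h2]
    refine mul_le_mul_of_nonneg_right ?_ (bi_nonneg _ _)
    exact mul_le_mul (hU X) (hU' X) (abs_nonneg _)
      (Finset.sum_nonneg fun k _ => mul_nonneg hs (hZ k X))
  refine h1.trans ?_
  rw [Ex_sum]
  have h3 : ∀ k ∈ a ∩ b, Ex p (fun X => ∑ l ∈ x ∩ y, s ^ 2 * (Z k X * Z' l X * bi F X)) ≤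
      e * (s ^ 2 * Q) := by
    intro k hk
    rw [Ex_sum]
    refine (Finset.sum_le_card_nsmul _ _ (s ^ 2 * Q) ?_).trans ?_
    · intro l hl
      rw [Ex_mul]
      exact mul_le_mul_of_nonneg_left (hb k hk l hl) (sq_nonneg s)
    · rw [nsmul_eq_mul]
      refine mul_le_mul_of_nonneg_right ?_ (mul_nonneg (sq_nonneg s) hQ)
      rw [← hx]
      exact_mod_cast Finset.card_le_card Finset.inter_subset_left
  refine (Finset.sum_le_card_nsmul _ _ _ h3).trans ?_
  rw [nsmul_eq_mul]
  have : ((a ∩ b).card : ℝ) ≤ e := by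
    rw [← ha]
    exact_mod_cast Finset.card_le_card Finset.inter_subset_left
  have h4 := mul_le_mul_of_nonneg_right this
    (show 0 ≤ (e : ℝ) * (s ^ 2 * Q) by positivity)
  linarith

theorem UT_uData (M : Finset (Finset ι)) {p s : ℝ} {e : ℕ} (hp : 0 ≤ p) (hp1 : p ≤ 1)
    (hs : 0 ≤ s) (hM : ∀ Γ ∈ M, Γ.card = e) : UData M p (4 * e ^ 2 * s ^ 2) (UT p s) := by
  have hq : 0 ≤ 1 - p := by linarith
  have key : ∀ a ∈ M, ∀ b ∈ M, ∀ x ∈ M, ∀ y ∈ M, ∀ F,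
    Ex p (fun X => |UT p s a b X| * |UT p s x y X| * bi F X) ≤
      (4 * e ^ 2 * s ^ 2) * (1 - p) ^ 2 * p ^ (a ∪ b ∪ (x ∪ y) ∪ F).card := by
    intro a ha b hb x hx y hy F
    set m := (a ∪ b ∪ (x ∪ y) ∪ F).card with hm
    have hZ : ∀ a b : Finset ι, ∀ k X, 0 ≤ (1 - p) * (p ^ (te p a k + 1) * bi (hh p a b k) X +
        p ^ (te p a k + 1 + (hh p a b k).card)) := fun a b k X =>
      mul_nonneg hq (add_nonneg (mul_nonneg (pow_nonneg hp _) (bi_nonneg _ _)) (pow_nonneg hp _))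
    have hU : ∀ a b : Finset ι, ∀ X, |UT p s a b X| ≤ ∑ k ∈ a ∩ b, s * ((1 - p) *
        (p ^ (te p a k + 1) * bi (hh p a b k) X + p ^ (te p a k + 1 + (hh p a b k).card))) := by
      intro a b X
      refine (Finset.abs_sum_le_sum_abs _ _).trans (Finset.sum_le_sum fun k _ => ?_)
      rw [abs_mul, abs_of_nonneg hs]
      refine mul_le_mul_of_nonneg_left ?_ hs
      have e1 : p * (1 - p) * (p ^ te p a k * (bi (hh p a b k) X - p ^ (hh p a b k).card)) =
        (1 - p) * (p ^ (te p a k + 1) * bi (hh p a b k) X -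
          p ^ (te p a k + 1 + (hh p a b k).card)) := by ring
      rw [e1, abs_mul, abs_of_nonneg hq]
      refine mul_le_mul_of_nonneg_left ?_ hq
      refine (abs_sub _ _).trans ?_
      rw [abs_of_nonneg (mul_nonneg (pow_nonneg hp _) (bi_nonneg _ _)),
        abs_of_nonneg (pow_nonneg hp _)]
    have := local_bound (M := M) (κ := 0) hp hp1 hs (Q := 4 * (1 - p) ^ 2 * p ^ m) (by positivity) a b x y F
      (hM a ha) (hM x hx) _ _ (hZ a b) (hZ x y) _ _ (hU a b) (hU x y) ?_
    · refine this.trans (le_of_eq ?_); ring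
    intro k hk l hl
    obtain ⟨R, hR, hRc⟩ := hh_R p a b k hk
    obtain ⟨R', hR', hRc'⟩ := hh_R p x y l hl
    have hc := card_aux _ _ F _ _ _ _ hR hR'
    rw [hRc, hRc', ← hm] at hc
    set j := te p a k + 1
    set j' := te p x l + 1
    set H := hh p a b k
    set H' := hh p x y l
    have e2 : (fun X => (1 - p) * (p ^ j * bi H X + p ^ (j + H.card)) *
        ((1 - p) * (p ^ j' * bi H' X + p ^ (j' + H'.card))) * bi F X) = fun X =>
        (1 - p) ^ 2 * (((p ^ (j + j') * bi (H ∪ H' ∪ F) X +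
          p ^ (j + j' + H'.card) * bi (H ∪ F) X) +
          p ^ (j + j' + H.card) * bi (H' ∪ F) X) +
          p ^ (j + j' + H.card + H'.card) * bi F X) := by
      funext X
      rw [← bi_mul (H ∪ H') F, ← bi_mul H H', ← bi_mul H F, ← bi_mul H' F]
      ring
    rw [e2, Ex_mul, Ex_add, Ex_add, Ex_add, Ex_mul, Ex_mul, Ex_mul, Ex_mul]
    have f : ∀ G : Finset ι, Ex p (fun X => bi G X) = p ^ G.card := fun G => Ex_bi p G
    rw [f, f, f, f, ← pow_add, ← pow_add, ← pow_add, ← pow_add]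
    have c1 := Finset.card_union_le (H ∪ F) H'
    have c2 := Finset.card_union_le (H' ∪ F) H
    have c3 := Finset.card_union_le F (H ∪ H')
    have c4 := Finset.card_union_le H H'
    have d1 : H ∪ F ∪ H' = H ∪ H' ∪ F := Finset.union_right_comm _ _ _
    have d2 : H' ∪ F ∪ H = H ∪ H' ∪ F := by
      rw [Finset.union_right_comm, Finset.union_comm H' H]
    have d3 : F ∪ (H ∪ H') = H ∪ H' ∪ F := Finset.union_comm _ _
    rw [d1] at c1
    rw [d2] at c2
    rw [d3] at c3
    have g : ∀ i : ℕ, m ≤ i → p ^ i ≤ p ^ m := fun i hi => pow_le_pow_of_le_one hp hp1 hi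
    have g1 := g (j + j' + (H ∪ H' ∪ F).card) (by omega)
    have g2 := g (j + j' + H'.card + (H ∪ F).card) (by omega)
    have g3 := g (j + j' + H.card + (H' ∪ F).card) (by omega)
    have g4 := g (j + j' + H.card + H'.card + F.card) (by omega)
    have := mul_le_mul_of_nonneg_left (add_le_add (add_le_add (add_le_add g1 g2) g3) g4)
      (sq_nonneg (1 - p))
    refine this.trans (le_of_eq ?_)
    ring
  refine ⟨by positivity, ?_, ?_, ?_, ?_, fun a ha b hb x hx y hy _ F => key a ha b hb x hx y hy F⟩
  · intro a ha b hb X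
    unfold UT
    refine Finset.sum_congr rfl fun k hk => ?_
    rw [bi_dep _ _ _ (hh_sub p a b k (Finset.mem_inter.1 hk).1)]
  · intro a ha b hb hd X
    unfold UT
    rw [Finset.inter_comm, Finset.disjoint_iff_inter_eq_empty.1 hd, Finset.sum_empty]
  · intro a ha b hb
    unfold UT
    rw [Ex_sum]
    refine Finset.sum_eq_zero fun k _ => ?_
    rw [Ex_mul, Ex_mul, Ex_mul, Ex_sub, Ex_const]
    have := Ex_bi p (hh p a b k)
    rw [show Ex p (fun X => bi (hh p a b k) X) = p ^ (hh p a b k).card from this]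
    simp
  · intro a ha b hb x hx y hy F
    refine (key a ha b hb x hx y hy F).trans ?_
    have h5 : 0 ≤ (4 * e ^ 2 * s ^ 2 : ℝ) * p ^ (a ∪ b ∪ (x ∪ y) ∪ F).card := by positivity
    have h6 : (1 - p) ^ 2 ≤ 1 - p := by nlinarith
    nlinarith [mul_le_mul_of_nonneg_left h6 h5]

theorem US_uData (M : Finset (Finset ι)) {p s : ℝ} {e : ℕ} (hp : 0 ≤ p) (hp1 : p ≤ 1)
    (hs : 0 ≤ s) (hM : ∀ Γ ∈ M, Γ.card = e) : UData M p (4 * e ^ 2 * s ^ 2) (US p s) := by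
  have hq : 0 ≤ 1 - p := by linarith
  have key : ∀ a ∈ M, ∀ b ∈ M, ∀ x ∈ M, ∀ y ∈ M, ∀ F, ∀ Q : ℝ, 0 ≤ Q →
    (∀ k ∈ a ∩ b, ∀ l ∈ x ∩ y, ∀ G : Finset ι, Ex p (fun X => |ce p k X| * |ce p l X| * bi G X) ≤
      4 * Q * p ^ (insert k (insert l G)).card) →
    Ex p (fun X => |US p s a b X| * |US p s x y X| * bi F X) ≤
      (4 * e ^ 2 * s ^ 2) * Q * p ^ (a ∪ b ∪ (x ∪ y) ∪ F).card := by
    intro a ha b hb x hx y hy F Q hQ hQ'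
    set m := (a ∪ b ∪ (x ∪ y) ∪ F).card with hm
    have hZ : ∀ a b : Finset ι, ∀ k X, 0 ≤ |ce p k X| * (p ^ te p a k * bi (hh p a b k) X) :=
      fun a b k X => mul_nonneg (abs_nonneg _) (mul_nonneg (pow_nonneg hp _) (bi_nonneg _ _))
    have hU : ∀ a b : Finset ι, ∀ X, |US p s a b X| ≤ ∑ k ∈ a ∩ b, s * (|ce p k X| *
        (p ^ te p a k * bi (hh p a b k) X)) := by
      intro a b X
      refine (Finset.abs_sum_le_sum_abs _ _).trans (le_of_eq (Finset.sum_congr rfl fun k _ => ?_))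
      rw [abs_mul, abs_of_nonneg hs, abs_mul,
        abs_of_nonneg (mul_nonneg (pow_nonneg hp _) (bi_nonneg _ _))]
    have := local_bound (M := M) (κ := 0) hp hp1 hs (Q := 4 * Q * p ^ m) (by positivity) a b x y F
      (hM a ha) (hM x hx) _ _ (hZ a b) (hZ x y) _ _ (hU a b) (hU x y) ?_
    · refine this.trans (le_of_eq ?_); ring
    intro k hk l hl
    obtain ⟨R, hR, hRc⟩ := hh_R' p a b k hk
    obtain ⟨R', hR', hRc'⟩ := hh_R' p x y l hl
    have hc := card_aux _ _ F _ _ _ _ hR hR'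
    rw [hRc, hRc', ← hm] at hc
    set j := te p a k
    set j' := te p x l
    set H := hh p a b k
    set H' := hh p x y l
    have d : insert k H ∪ insert l H' ∪ F = insert k (insert l (H ∪ H' ∪ F)) := by
      ext i; simp only [Finset.mem_union, Finset.mem_insert]; tauto
    rw [d] at hc
    have e2 : (fun X => |ce p k X| * (p ^ j * bi H X) * (|ce p l X| * (p ^ j' * bi H' X)) * bi F X)
        = fun X => p ^ (j + j') * (|ce p k X| * |ce p l X| * bi (H ∪ H' ∪ F) X) := by
      funext X
      rw [← bi_mul (H ∪ H') F, ← bi_mul H H']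
      ring
    rw [e2, Ex_mul]
    refine (mul_le_mul_of_nonneg_left (hQ' k hk l hl _) (pow_nonneg hp _)).trans ?_
    have := pow_le_pow_of_le_one hp hp1 hc
    have := mul_le_mul_of_nonneg_left this (show 0 ≤ 4 * Q by positivity)
    refine le_trans (le_of_eq ?_) this
    rw [pow_add]; ring
  refine ⟨by positivity, ?_, ?_, ?_, ?_, ?_⟩
  · intro a ha b hb X
    unfold US
    refine Finset.sum_congr rfl fun k hk => ?_
    rw [bi_dep _ _ _ (hh_sub p a b k (Finset.mem_inter.1 hk).1)]
    unfold ce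
    rw [bi_dep]
    simpa using Or.inl (Finset.mem_inter.1 hk).1
  · intro a ha b hb hd X
    unfold US
    rw [Finset.inter_comm, Finset.disjoint_iff_inter_eq_empty.1 hd, Finset.sum_empty]
  · intro a ha b hb
    unfold US
    rw [Ex_sum]
    refine Finset.sum_eq_zero fun k hk => ?_
    have hn := hh_not p a b k (Finset.mem_inter.1 hk).1
    rw [Ex_mul, Ex_ce]
    simp only [bi_ins _ _ _ hn, bi_ers _ _ _ hn, sub_self, Ex_zero, mul_zero]
  · intro a ha b hb x hx y hy F
    exact key a ha b hb x hx y hy F _ hq fun k _ l _ G => Ex_ce2_le hp hp1 k l G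
  · intro a ha b hb x hx y hy hd F
    refine key a ha b hb x hx y hy F _ (sq_nonneg _) fun k hk l hl G => Ex_ce2_le' hp hp1 k l ?_ G
    rintro rfl
    exact Finset.disjoint_left.1 hd (Finset.mem_union_left _ (Finset.mem_inter.1 hk).1)
      (Finset.mem_union_left _ (Finset.mem_inter.1 hl).1)

theorem rho_ddW (M : Finset (Finset ι)) (p σ : ℝ) (k : ι) (X : Finset ι) :
    rho M p σ k X * ddW M σ k X = ∑ a ∈ M, ∑ b ∈ M, if k ∈ a ∩ b then
      (σ⁻¹) ^ 2 * (p ^ te p a k * bi (hh p a b k) X) else 0 := by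
  unfold rho ddW
  rw [mul_mul_mul_comm, Finset.sum_mul_sum, Finset.mul_sum]
  refine Finset.sum_congr rfl fun a _ => ?_
  rw [Finset.mul_sum]
  refine Finset.sum_congr rfl fun b _ => ?_
  by_cases h1 : k ∈ a <;> by_cases h2 : k ∈ b <;> simp [h1, h2]
  rw [hh, ← bi_mul]; ring

theorem sum_k (M : Finset (Finset ι)) (g : ι → Finset ι → Finset ι → ℝ) :
    ∑ k, ∑ a ∈ M, ∑ b ∈ M, (if k ∈ a ∩ b then g k a b else 0) =
      ∑ a ∈ M, ∑ b ∈ M, ∑ k ∈ a ∩ b, g k a b := by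
  rw [Finset.sum_comm]
  refine Finset.sum_congr rfl fun a _ => ?_
  rw [Finset.sum_comm]
  refine Finset.sum_congr rfl fun b _ => ?_
  rw [← Finset.sum_filter]
  congr 1
  ext; simp

theorem stS_eq (M : Finset (Finset ι)) (p σ : ℝ) (X : Finset ι) :
    stS p (rho M p σ) (ddW M σ) X = ∑ a ∈ M, ∑ b ∈ M, US p ((σ⁻¹) ^ 2) a b X := by
  unfold stS US
  rw [← sum_k]
  refine Finset.sum_congr rfl fun k _ => ?_
  rw [rho_ddW, Finset.mul_sum]
  refine Finset.sum_congr rfl fun a _ => ?_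
  rw [Finset.mul_sum]
  refine Finset.sum_congr rfl fun b _ => ?_
  rw [mul_ite, mul_zero]
  congr 1; ring

theorem stT_eq (M : Finset (Finset ι)) {p σ : ℝ} {e : ℕ} (hp : 0 ≤ p) (hp1 : p ≤ 1)
    (H : SteinData p (WW M p σ) (rho M p σ) (ddW M σ)) (hM : ∀ Γ ∈ M, Γ.card = e)
    (X : Finset ι) :
    stT p (rho M p σ) (ddW M σ) X = ∑ a ∈ M, ∑ b ∈ M, UT p ((σ⁻¹) ^ 2) a b X := by
  have h1 : ∃ C : ℝ, ∀ X, stT p (rho M p σ) (ddW M σ) X =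
      ∑ a ∈ M, ∑ b ∈ M, UT p ((σ⁻¹) ^ 2) a b X + C := by
    refine ⟨∑ a ∈ M, ∑ b ∈ M, ∑ k ∈ a ∩ b, (σ⁻¹) ^ 2 * ((p * (1 - p)) * (p ^ te p a k *
      p ^ (hh p a b k).card)) - 1, fun X => ?_⟩
    unfold stT UT
    rw [← add_sub_assoc, ← Finset.sum_add_distrib]
    congr 1
    simp only [rho_ddW]
    rw [sum_k, Finset.mul_sum]
    refine Finset.sum_congr rfl fun a _ => ?_
    rw [Finset.mul_sum, ← Finset.sum_add_distrib]
    refine Finset.sum_congr rfl fun b _ => ?_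
    rw [Finset.mul_sum, ← Finset.sum_add_distrib]
    refine Finset.sum_congr rfl fun k _ => ?_
    ring
  obtain ⟨C, hC⟩ := h1
  have h2 := H.ExT0
  have h3 : stT p (rho M p σ) (ddW M σ) = fun X => ∑ a ∈ M, ∑ b ∈ M, UT p ((σ⁻¹) ^ 2) a b X + C :=
    funext hC
  rw [h3, Ex_add, Ex_const, Ex_sum] at h2
  have h4 : ∑ a ∈ M, Ex p (fun X => ∑ b ∈ M, UT p ((σ⁻¹) ^ 2) a b X) = 0 := by
    refine Finset.sum_eq_zero fun a ha => ?_
    rw [Ex_sum]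
    refine Finset.sum_eq_zero fun b hb => ?_
    exact (UT_uData M hp hp1 (sq_nonneg _) hM).hmean a ha b hb
  rw [h4, zero_add] at h2
  rw [hC, h2, add_zero]

end UDs

section Count

variable {V₀ : Type*} [Fintype V₀] [DecidableEq V₀] (G₀ : SimpleGraph V₀) [DecidableRel G₀.Adj]
  {n : ℕ}

/-- edge image of an embedding -/
noncomputable def eim (f : V₀ ↪ Fin n) : Finset (Sym2 (Fin n)) :=
  G₀.edgeFinset.image (Sym2.map ⇑f)

theorem mem_copy (Γ : Finset (Sym2 (Fin n))) :
    Γ ∈ copyFinset G₀ n ↔ ∃ f : V₀ ↪ Fin n, eim G₀ f = Γ := by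
  simp only [copyFinset, eim, Finset.mem_filter, Finset.mem_univ, true_and]
  exact exists_congr fun f => eq_comm

theorem eim_card (f : V₀ ↪ Fin n) : (eim G₀ f).card = G₀.edgeFinset.card :=
  Finset.card_image_of_injective _ (Sym2.map.injective f.injective)

theorem mem_eim (f : V₀ ↪ Fin n) (v w : V₀) : s(f v, f w) ∈ eim G₀ f ↔ G₀.Adj v w := by
  have h : s(f v, f w) = Sym2.map f s(v, w) := by simp
  rw [h, eim, Function.Injective.mem_finset_image (Sym2.map.injective f.injective)]
  simp

theorem fiber_card (hniso : ∀ v : V₀, ∃ w, G₀.Adj v w) (f₀ : V₀ ↪ Fin n) :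
    (Finset.univ.filter fun f : V₀ ↪ Fin n => eim G₀ f = eim G₀ f₀).card =
      Nat.card (G₀ ≃g G₀) := by
  rw [← Fintype.card_subtype, ← Nat.card_eq_fintype_card]
  symm
  refine Nat.card_congr (Equiv.ofBijective (fun ψ => ⟨ψ.toEquiv.toEmbedding.trans f₀, ?_⟩) ⟨?_, ?_⟩)
  · ext x
    induction x with | _ x y =>
    simp only [eim, Finset.mem_image, SimpleGraph.mem_edgeFinset]
    constructor
    · rintro ⟨e, he, hxe⟩
      refine ⟨Sym2.map ψ e, ?_, ?_⟩
      · induction e with | _ u v => simpa [SimpleGraph.Iso.map_adj_iff] using he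
      · rw [← hxe, Sym2.map_map]; rfl
    · rintro ⟨e, he, hxe⟩
      refine ⟨Sym2.map ψ.symm e, ?_, ?_⟩
      · induction e with | _ u v => simpa [SimpleGraph.Iso.map_adj_iff] using he
      · rw [← hxe, Sym2.map_map]
        congr 1
        ext; simp
  · intro ψ ψ' h
    ext v
    have := congrArg (fun f => f.1 v) h
    simpa using this
  · rintro ⟨f, hf⟩
    have hr : ∀ v, ∃ w, f₀ w = f v := by
      intro v
      obtain ⟨w, hw⟩ := hniso v
      have h1 : s(f v, f w) ∈ eim G₀ f₀ := by rw [← hf, mem_eim]; exact hw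
      simp only [eim, Finset.mem_image, SimpleGraph.mem_edgeFinset] at h1
      obtain ⟨e, he, h2⟩ := h1
      induction e with | _ x y =>
      simp only [Sym2.map_mk, Sym2.eq_iff] at h2
      rcases h2 with h2 | h2
      · exact ⟨x, h2.1⟩
      · exact ⟨y, h2.2⟩
    choose g hg using hr
    have gi : Function.Injective g := by
      intro x y hxy
      apply f.injective
      rw [← hg, ← hg, hxy]
    refine ⟨⟨Equiv.ofBijective g (Finite.injective_iff_bijective.1 gi), ?_⟩, ?_⟩
    · intro x y
      simp only [Equiv.ofBijective_apply]
      rw [← mem_eim G₀ f₀, ← mem_eim G₀ f, hg, hg, hf]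
    · apply Subtype.ext
      ext v
      simp [hg]

theorem sum_copies (hniso : ∀ v : V₀, ∃ w, G₀.Adj v w) (φ : Finset (Sym2 (Fin n)) → ℝ) :
    (Nat.card (G₀ ≃g G₀) : ℝ) * ∑ Γ ∈ copyFinset G₀ n, φ Γ = ∑ f : V₀ ↪ Fin n, φ (eim G₀ f) := by
  rw [← Finset.sum_fiberwise_of_maps_to (t := copyFinset G₀ n) (g := eim G₀)
    (fun f _ => (mem_copy G₀ _).2 ⟨f, rfl⟩), Finset.mul_sum]
  refine Finset.sum_congr rfl fun Γ hΓ => ?_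
  obtain ⟨f₀, rfl⟩ := (mem_copy G₀ _).1 hΓ
  rw [Finset.sum_congr rfl (g := fun _ => φ (eim G₀ f₀)), Finset.sum_const, nsmul_eq_mul,
    fiber_card G₀ hniso]
  intro f hf
  rw [(Finset.mem_filter.1 hf).2]

/-- vertex support in the host graph -/
noncomputable def vs {V : Type*} [Fintype V] (S : Finset (Sym2 V)) : Finset V :=
  Finset.univ.filter (fun v : V => ∃ e ∈ S, v ∈ e)

theorem count_emb (T : Finset V₀) (K : Finset (Fin n)) :
    (Finset.univ.filter fun f : V₀ ↪ Fin n => ∀ v ∈ T, f v ∈ K).card ≤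
      K.card.descFactorial T.card * n ^ (Fintype.card V₀ - T.card) := by
  rw [← Fintype.card_subtype]
  have h1 : K.card.descFactorial T.card * n ^ (Fintype.card V₀ - T.card) =
      Fintype.card (({x // x ∈ T} ↪ {x // x ∈ K}) × ({x // x ∉ T} → Fin n)) := by
    rw [Fintype.card_prod, Fintype.card_embedding_eq, Fintype.card_fun, Fintype.card_fin,
      Fintype.card_coe, Fintype.card_coe, Fintype.card_subtype_compl, Fintype.card_coe]
  rw [h1]
  refine Fintype.card_le_of_injective (fun f => (⟨fun x => ⟨f.1 x.1, f.2 x.1 x.2⟩, ?_⟩,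
    fun x => f.1 x.1)) ?_
  · intro x y h
    have h2 := congrArg Subtype.val h
    exact Subtype.ext (f.1.injective h2)
  · intro f g h
    simp only [Prod.mk.injEq] at h
    obtain ⟨ha, hb⟩ := h
    apply Subtype.ext
    ext1 v
    by_cases hv : v ∈ T
    · exact congrArg Subtype.val (DFunLike.congr_fun ha ⟨v, hv⟩)
    · exact congrFun hb ⟨v, hv⟩


theorem mem_vs {V : Type*} [Fintype V] (S : Finset (Sym2 V)) (v : V) :
    v ∈ vs S ↔ ∃ e ∈ S, v ∈ e := by
  simp only [vs, Finset.mem_filter, Finset.mem_univ, true_and]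

theorem vs_union {V : Type*} [Fintype V] [DecidableEq V] (S T : Finset (Sym2 V)) :
    vs (S ∪ T) = vs S ∪ vs T := by
  ext v
  simp only [vs, Finset.mem_filter, Finset.mem_univ, true_and, Finset.mem_union, or_and_right,
    exists_or]

theorem vs_eim (f : V₀ ↪ Fin n) : (vs (eim G₀ f)).card ≤ Fintype.card V₀ := by
  have h : vs (eim G₀ f) ⊆ Finset.univ.map f := by
    intro x hx
    simp only [vs, eim, Finset.mem_filter, Finset.mem_univ, true_and, Finset.mem_image] at hx
    obtain ⟨e, ⟨e', he', rfl⟩, hx⟩ := hx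
    rw [Sym2.mem_map] at hx
    obtain ⟨a, _, rfl⟩ := hx
    simp
  refine (Finset.card_le_card h).trans ?_
  rw [Finset.card_map, Finset.card_univ]

theorem UN_vs {r : ℕ} {A : Finset (Sym2 (Fin n))} (h : UN (copyFinset G₀ n) r A) :
    (vs A).card ≤ r * Fintype.card V₀ := by
  induction h with
  | one Γ h =>
    obtain ⟨f, rfl⟩ := (mem_copy G₀ _).1 h
    simpa using vs_eim G₀ f
  | add r A Γ hA h ih =>
    obtain ⟨f, rfl⟩ := (mem_copy G₀ _).1 h
    rw [vs_union]
    have := Finset.card_union_le (vs A) (vs (eim G₀ f))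
    have := vs_eim G₀ f
    rw [add_mul]; omega

theorem Psi_set_finite (p : ℝ) : ({x : ℝ | ∃ S ⊆ G₀.edgeFinset, S.Nonempty ∧
    x = (n : ℝ) ^ (Finset.univ.filter (fun v : V₀ => ∃ e ∈ S, v ∈ e)).card * p ^ S.card}).Finite := by
  refine ((G₀.edgeFinset.powerset : Finset _).finite_toSet.image (fun S : Finset (Sym2 V₀) =>
    (n : ℝ) ^ (Finset.univ.filter (fun v : V₀ => ∃ e ∈ S, v ∈ e)).card * p ^ S.card)).subset ?_
  rintro x ⟨S, hS, _, rfl⟩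
  exact ⟨S, Finset.mem_coe.2 (Finset.mem_powerset.2 hS), rfl⟩

theorem Psi_le (p : ℝ) (S : Finset (Sym2 V₀)) (hS : S ⊆ G₀.edgeFinset) (hne : S.Nonempty) :
    PsiMin G₀ n p ≤ (n : ℝ) ^ (vs S).card * p ^ S.card := by
  refine csInf_le (Psi_set_finite G₀ p).bddBelow ⟨S, hS, hne, ?_⟩
  unfold vs
  congr!

theorem Psi_mem (hedge : G₀.edgeFinset.Nonempty) (p : ℝ) :
    ∃ S ⊆ G₀.edgeFinset, S.Nonempty ∧ PsiMin G₀ n p = (n : ℝ) ^ (vs S).card * p ^ S.card := by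
  have h := Set.Nonempty.csInf_mem (s := {x : ℝ | ∃ S ⊆ G₀.edgeFinset, S.Nonempty ∧
    x = (n : ℝ) ^ (Finset.univ.filter (fun v : V₀ => ∃ e ∈ S, v ∈ e)).card * p ^ S.card})
    ⟨_, G₀.edgeFinset, subset_rfl, hedge, rfl⟩ (Psi_set_finite G₀ p)
  obtain ⟨S, hS, hne, h⟩ := h
  refine ⟨S, hS, hne, ?_⟩
  refine Eq.trans h ?_
  unfold vs
  congr!

theorem Psi_pos (hedge : G₀.edgeFinset.Nonempty) {p : ℝ} (hp : 0 < p) (hn : 0 < n) :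
    0 < PsiMin G₀ n p := by
  obtain ⟨S, -, -, h⟩ := Psi_mem (n := n) G₀ hedge p
  rw [h]; positivity

theorem desc_mono (N k m : ℕ) (hkm : k ≤ m) (hm : m ≤ N) : N.descFactorial k ≤ N.descFactorial m := by
  induction m, hkm using Nat.le_induction with
  | base => exact le_rfl
  | succ m hkm ih =>
    refine (ih (by omega)).trans ?_
    rw [Nat.descFactorial_succ]
    exact Nat.le_mul_of_pos_left _ (by omega)

theorem ratio_le {p : ℝ} (hp : 0 < p) (hn : 0 < n) (hedge : G₀.edgeFinset.Nonempty)
    (S : Finset (Sym2 V₀)) (hS : S ⊆ G₀.edgeFinset) (hne : S.Nonempty) :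
    (n : ℝ) ^ (Fintype.card V₀ - (vs S).card) * p ^ (G₀.edgeFinset.card - S.card) ≤
      (n : ℝ) ^ Fintype.card V₀ * p ^ G₀.edgeFinset.card / PsiMin G₀ n p := by
  rw [le_div_iff₀ (Psi_pos G₀ hedge hp hn)]
  have h1 : (vs S).card ≤ Fintype.card V₀ := Finset.card_le_univ _
  have h2 := Finset.card_le_card hS
  have h3 := Psi_le (n := n) G₀ p S hS hne
  refine (mul_le_mul_of_nonneg_left h3 (by positivity)).trans (le_of_eq ?_)
  rw [mul_mul_mul_comm, ← pow_add, ← pow_add, Nat.sub_add_cancel h1, Nat.sub_add_cancel h2]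

/-- chain constants -/
noncomputable def bet (n : ℕ) (p : ℝ) (r : ℕ) : ℝ :=
  if r = 0 then (n : ℝ) ^ Fintype.card V₀ * p ^ G₀.edgeFinset.card / (Nat.card (G₀ ≃g G₀) : ℝ)
  else (n : ℝ) ^ Fintype.card V₀ * p ^ G₀.edgeFinset.card / PsiMin G₀ n p /
    (Nat.card (G₀ ≃g G₀) : ℝ) * (2 ^ G₀.edgeFinset.card *
      ((r * Fintype.card V₀).descFactorial (Fintype.card V₀) : ℝ))

theorem aut_pos : (0 : ℝ) < (Nat.card (G₀ ≃g G₀) : ℝ) := by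
  have : Nonempty (G₀ ≃g G₀) := ⟨SimpleGraph.Iso.refl⟩
  have : Finite (G₀ ≃g G₀) := DFunLike.finite _
  exact_mod_cast Nat.card_pos

theorem chain_emb {p : ℝ} (hp : 0 < p) (hp1 : p ≤ 1) (hn : 0 < n) (hedge : G₀.edgeFinset.Nonempty)
    (r : ℕ) (hr : 1 ≤ r) (A : Finset (Sym2 (Fin n))) (hA : (vs A).card ≤ r * Fintype.card V₀) :
    ∑ f : V₀ ↪ Fin n, mee (eim G₀ f) A * p ^ (A ∪ eim G₀ f).card ≤
      (n : ℝ) ^ Fintype.card V₀ * p ^ G₀.edgeFinset.card / PsiMin G₀ n p *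
        (2 ^ G₀.edgeFinset.card *
      ((r * Fintype.card V₀).descFactorial (Fintype.card V₀) : ℝ)) * p ^ A.card := by
  set E := G₀.edgeFinset with hE
  set v := Fintype.card V₀
  let Sf : (V₀ ↪ Fin n) → Finset (Sym2 V₀) := fun f => E.filter (fun e => Sym2.map f e ∈ A)
  set P := E.powerset.filter (fun S => S.Nonempty) with hP
  have h1 : ∀ f : V₀ ↪ Fin n, mee (eim G₀ f) A * p ^ (A ∪ eim G₀ f).card ≤
      ∑ S ∈ P, if Sf f = S then p ^ A.card * p ^ (E.card - S.card) else 0 := by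
    intro f
    by_cases hd : Disjoint (eim G₀ f) A
    · rw [mee, if_pos hd, zero_mul]
      refine Finset.sum_nonneg fun S _ => ?_
      split_ifs
      · positivity
      · exact le_rfl
    · rw [mee, if_neg hd, one_mul]
      have hSP : Sf f ∈ P := by
        rw [hP, Finset.mem_filter, Finset.mem_powerset]
        refine ⟨Finset.filter_subset _ _, ?_⟩
        rw [Finset.not_disjoint_iff] at hd
        obtain ⟨x, hx, hxA⟩ := hd
        rw [eim, Finset.mem_image] at hx
        obtain ⟨e, he, rfl⟩ := hx
        exact ⟨e, Finset.mem_filter.2 ⟨he, hxA⟩⟩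
      rw [Finset.sum_ite_eq, if_pos hSP, ← pow_add]
      refine pow_le_pow_of_le_one hp.le hp1 ?_
      have h2 := Finset.card_union_add_card_inter A (eim G₀ f)
      have h3 : (A ∩ eim G₀ f).card ≤ (Sf f).card := by
        have : A ∩ eim G₀ f ⊆ (Sf f).image (Sym2.map f) := by
          intro x hx
          rw [Finset.mem_inter, eim, Finset.mem_image] at hx
          obtain ⟨hxA, e, he, rfl⟩ := hx
          exact Finset.mem_image_of_mem _ (Finset.mem_filter.2 ⟨he, hxA⟩)
        exact (Finset.card_le_card this).trans Finset.card_image_le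
      rw [eim_card, ← hE] at h2
      have h4 : (Sf f).card ≤ E.card := Finset.card_filter_le _ _
      omega
  refine (Finset.sum_le_sum fun f _ => h1 f).trans ?_
  rw [Finset.sum_comm]
  set R := (n : ℝ) ^ v * p ^ E.card / PsiMin G₀ n p with hR
  have h4 : ∀ S ∈ P, ∑ f : V₀ ↪ Fin n, (if Sf f = S then p ^ A.card * p ^ (E.card - S.card) else 0)
      ≤ R * ((r * v).descFactorial v : ℝ) * p ^ A.card := by
    intro S hS
    rw [hP, Finset.mem_filter, Finset.mem_powerset] at hS
    rw [← Finset.sum_filter, Finset.sum_const, nsmul_eq_mul]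
    have hv : (vs S).card ≤ v := Finset.card_le_univ _
    have h5 : (Finset.univ.filter fun f => Sf f = S).card ≤
        (r * v).descFactorial v * n ^ (v - (vs S).card) := by
      refine (Finset.card_le_card (t := Finset.univ.filter fun f : V₀ ↪ Fin n =>
        ∀ x ∈ vs S, f x ∈ vs A) ?_).trans ((count_emb _ _).trans ?_)
      · intro f hf
        rw [Finset.mem_filter] at hf ⊢
        refine ⟨Finset.mem_univ _, fun x hx => ?_⟩
        rw [mem_vs] at hx ⊢
        obtain ⟨e, he, hxe⟩ := hx
        refine ⟨Sym2.map f e, ?_, Sym2.mem_map.2 ⟨x, hxe, rfl⟩⟩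
        rw [← hf.2] at he
        exact (Finset.mem_filter.1 he).2
      · refine Nat.mul_le_mul_right _ ?_
        refine (Nat.descFactorial_le _ hA).trans (desc_mono _ _ _ hv ?_)
        nlinarith
    have h6 : ((Finset.univ.filter fun f => Sf f = S).card : ℝ) ≤
        ((r * v).descFactorial v : ℝ) * (n : ℝ) ^ (v - (vs S).card) := by exact_mod_cast h5
    refine (mul_le_mul_of_nonneg_right h6 (by positivity)).trans ?_
    have h7 := ratio_le G₀ hp hn hedge S hS.1 hS.2
    have h8 := mul_le_mul_of_nonneg_left h7
      (show 0 ≤ ((r * v).descFactorial v : ℝ) * p ^ A.card by positivity)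
    refine le_trans (le_of_eq ?_) (h8.trans (le_of_eq ?_)) <;> ring
  refine (Finset.sum_le_card_nsmul _ _ _ h4).trans ?_
  rw [nsmul_eq_mul]
  have h9 : (P.card : ℝ) ≤ 2 ^ E.card := by
    have : P.card ≤ 2 ^ E.card := by
      rw [← Finset.card_powerset]; exact Finset.card_filter_le _ _
    exact_mod_cast this
  have hR0 : 0 ≤ R := div_nonneg (by positivity) (Psi_pos G₀ hedge hp hn).le
  refine (mul_le_mul_of_nonneg_right h9 (by positivity)).trans (le_of_eq ?_)
  ring

theorem chainCopies {p : ℝ} (hp : 0 < p) (hp1 : p ≤ 1) (hn : 0 < n)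
    (hedge : G₀.edgeFinset.Nonempty) (hniso : ∀ v : V₀, ∃ w, G₀.Adj v w) (D : ℕ)
    (hD : ∀ Γ ∈ copyFinset G₀ n,
      ((copyFinset G₀ n).filter (fun Γ' => (Γ' ∩ Γ).Nonempty)).card = D) :
    ChainData (copyFinset G₀ n) p (bet G₀ n p) D where
  hp := hp.le
  hp1 := hp1
  β0 r := by
    have := (Psi_pos (n := n) G₀ hedge hp hn).le
    unfold bet
    split_ifs <;> positivity
  h0 := by
    rw [bet, if_pos rfl, le_div_iff₀ (aut_pos G₀), mul_comm, sum_copies G₀ hniso]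
    simp only [eim_card]
    rw [Finset.sum_const, nsmul_eq_mul, Finset.card_univ, Fintype.card_embedding_eq,
      Fintype.card_fin]
    refine mul_le_mul_of_nonneg_right ?_ (by positivity)
    exact_mod_cast Nat.descFactorial_le_pow _ _
  hr r A hr hA := by
    have h := chain_emb G₀ hp hp1 hn hedge r hr A (UN_vs G₀ hA)
    rw [← sum_copies G₀ hniso (fun Γ => mee Γ A * p ^ (A ∪ Γ).card)] at h
    rw [bet, if_neg (by omega)]
    have ha := aut_pos G₀
    rw [← mul_le_mul_iff_right₀ ha]
    refine h.trans (le_of_eq ?_)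
    field_simp
  hD Γ hΓ := by
    rw [← hD Γ hΓ, Finset.card_filter, Nat.cast_sum]
    refine Finset.sum_le_sum fun Γ' _ => ?_
    by_cases h1 : Disjoint Γ' Γ
    · rw [mee, if_pos h1]; positivity
    · rw [mee, if_neg h1, if_pos]
      · simp
      · rwa [Finset.nonempty_iff_ne_empty, ne_eq, ← Finset.disjoint_iff_inter_eq_empty]

end Count

section Var

theorem desc_lower (n v : ℕ) (hv : 1 ≤ v) (hn : 4 * v ^ 2 ≤ n) :
    (3 / 4 : ℝ) * (n : ℝ) ^ v ≤ (n.descFactorial v : ℝ) := by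
  have hvn : v ≤ n := by nlinarith
  have hn0 : (0:ℝ) < n := by exact_mod_cast (by omega : 0 < n)
  have h1 : ((n + 1 - v) ^ v : ℕ) ≤ n.descFactorial v := Nat.pow_sub_le_descFactorial n v
  have h2 : (((n + 1 - v : ℕ) : ℝ)) ^ v ≤ (n.descFactorial v : ℝ) := by exact_mod_cast h1
  refine le_trans ?_ h2
  have h3 : (((n + 1 - v : ℕ) : ℝ)) = n * (1 + (-((v - 1) / n))) := by
    rw [Nat.cast_sub (by omega)]
    push_cast
    field_simp
    ring
  rw [h3, mul_pow, mul_comm (3 / 4 : ℝ)]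
  refine mul_le_mul_of_nonneg_left ?_ (by positivity)
  have hv1 : (1:ℝ) ≤ v := by exact_mod_cast hv
  have hn' : (4:ℝ) * v ^ 2 ≤ n := by exact_mod_cast hn
  have h5 : ((v:ℝ) - 1) / n ≤ 1 := by
    rw [div_le_one hn0]; nlinarith
  refine le_trans ?_ (one_add_mul_le_pow (by linarith) v)
  have h6 : (v:ℝ) * ((v - 1) / n) ≤ 1 / 4 := by
    rw [← mul_div_assoc, div_le_iff₀ hn0]; nlinarith
  linarith

theorem var_expand {ι : Type*} [Fintype ι] [DecidableEq ι] (M : Finset (Finset ι)) (p : ℝ) :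
    Ex p (fun X => NN M X ^ 2) - (Ex p (NN M)) ^ 2 =
      ∑ Γ ∈ M, ∑ Γ' ∈ M, (p ^ (Γ ∪ Γ').card - p ^ Γ.card * p ^ Γ'.card) := by
  have h1 : (fun X => NN M X ^ 2) = fun X => ∑ Γ ∈ M, ∑ Γ' ∈ M, bi (Γ ∪ Γ') X := by
    funext X
    rw [pow_two, NN, Finset.sum_mul_sum]
    simp only [bi_mul]
  rw [h1, Ex_sum, Ex_NN, pow_two, Finset.sum_mul_sum, ← Finset.sum_sub_distrib]
  refine Finset.sum_congr rfl fun Γ _ => ?_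
  rw [Ex_sum, ← Finset.sum_sub_distrib]
  refine Finset.sum_congr rfl fun Γ' _ => ?_
  rw [← Ex_bi p (Γ ∪ Γ')]

theorem pairs_lower {α β : Type*} [Fintype α] [Fintype β] [DecidableEq β] (r : α → β) :
    (Fintype.card α : ℝ) ^ 2 ≤ Fintype.card β *
      ∑ f : α, ∑ g : α, if r f = r g then (1:ℝ) else 0 := by
  have h1 : ∑ f : α, ∑ g : α, (if r f = r g then (1:ℝ) else 0) =
      ∑ b : β, (∑ f : α, if r f = b then (1:ℝ) else 0) ^ 2 := by
    simp only [pow_two, Finset.sum_mul_sum]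
    rw [Finset.sum_comm' (t' := Finset.univ) (s' := fun _ => Finset.univ) (by simp)]
    rw [Finset.sum_comm (s := (Finset.univ : Finset β))]
    refine Finset.sum_congr rfl fun f _ => ?_
    rw [Finset.sum_comm (s := (Finset.univ : Finset β))]
    refine Finset.sum_congr rfl fun g _ => ?_
    have : ∀ b, ((if r f = b then (1:ℝ) else 0) * if r g = b then 1 else 0) =
      if r f = b then (if r g = b then (1:ℝ) else 0) else 0 := by intro b; split_ifs <;> simp
    simp only [this, Finset.sum_ite_eq, Finset.mem_univ, if_true]
  rw [h1]
  have h2 : (Fintype.card α : ℝ) = ∑ b : β, ∑ f : α, if r f = b then (1:ℝ) else 0 := by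
    rw [Finset.sum_comm]; simp
  rw [h2, ← Finset.card_univ (α := β)]
  exact sq_sum_le_card_mul_sum_sq

variable {V₀ : Type*} [Fintype V₀] [DecidableEq V₀] (G₀ : SimpleGraph V₀) [DecidableRel G₀.Adj]
  {n : ℕ}

theorem sigma_lower {p : ℝ} (hp : 0 < p) (hp1 : p < 1) 
    (hedge : G₀.edgeFinset.Nonempty) (hniso : ∀ v : V₀, ∃ w, G₀.Adj v w)
    (hv : 1 ≤ Fintype.card V₀)
    (hn : 4 * (Fintype.card V₀) ^ 2 ≤ n) :
    9 / 16 * (((n : ℝ) ^ Fintype.card V₀ * p ^ G₀.edgeFinset.card) ^ 2 * (1 - p)) /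
      ((Nat.card (G₀ ≃g G₀) : ℝ) ^ 2 * PsiMin G₀ n p) ≤
    Ex p (fun X => NN (copyFinset G₀ n) X ^ 2) - (Ex p (NN (copyFinset G₀ n))) ^ 2 := by
  have hn0 : 0 < n := by nlinarith
  have hn0' : (0:ℝ) < n := by exact_mod_cast hn0
  have hΨ := Psi_pos (n := n) G₀ hedge hp hn0
  have ha := aut_pos G₀
  have hq : 0 < 1 - p := by linarith
  set a : ℝ := (Nat.card (G₀ ≃g G₀) : ℝ)
  set E := G₀.edgeFinset with hE
  rw [div_le_iff₀ (by positivity), var_expand]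
  have h1 : a ^ 2 * ∑ Γ ∈ copyFinset G₀ n, ∑ Γ' ∈ copyFinset G₀ n,
      (p ^ (Γ ∪ Γ').card - p ^ Γ.card * p ^ Γ'.card) =
      ∑ f : V₀ ↪ Fin n, ∑ g : V₀ ↪ Fin n, (p ^ (eim G₀ f ∪ eim G₀ g).card - p ^ E.card * p ^ E.card) := by
    rw [pow_two, mul_assoc, Finset.mul_sum]
    simp only [a, sum_copies G₀ hniso]
    simp only [eim_card, hE]
  obtain ⟨S, hS, hne, hΨS⟩ := Psi_mem (n := n) G₀ hedge p
  let r : (V₀ ↪ Fin n) → ({x // x ∈ vs S} → Fin n) := fun f x => f x.1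
  have h2 : ∀ f g : V₀ ↪ Fin n, p ^ (2 * E.card - S.card) * (1 - p) *
      (if r f = r g then (1:ℝ) else 0) ≤
      p ^ (eim G₀ f ∪ eim G₀ g).card - p ^ E.card * p ^ E.card := by
    intro f g
    have hc := Finset.card_union_add_card_inter (eim G₀ f) (eim G₀ g)
    rw [eim_card, eim_card, ← hE] at hc
    rw [← pow_add]
    split_ifs with h
    · have h3 : S.image (Sym2.map f) ⊆ eim G₀ f ∩ eim G₀ g := by
        intro x hx
        rw [Finset.mem_image] at hx
        obtain ⟨e, he, rfl⟩ := hx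
        rw [Finset.mem_inter, eim, eim]
        refine ⟨Finset.mem_image_of_mem _ (hS he), ?_⟩
        have : Sym2.map f e = Sym2.map g e := by
          refine Sym2.map_congr fun x hx => ?_
          exact congrFun h ⟨x, (mem_vs S x).2 ⟨e, he, hx⟩⟩
        rw [this]
        exact Finset.mem_image_of_mem _ (hS he)
      have h4 := Finset.card_le_card h3
      rw [Finset.card_image_of_injective _ (Sym2.map.injective f.injective)] at h4
      have h5 : p ^ (2 * E.card - S.card) ≤ p ^ (eim G₀ f ∪ eim G₀ g).card :=
        pow_le_pow_of_le_one hp.le hp1.le (by omega)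
      have h6 := Finset.card_le_card hS
      have h7 := hne.card_pos
      have h8 : p ^ (E.card + E.card) ≤ p ^ (2 * E.card - S.card) * p := by
        rw [← pow_succ]
        exact pow_le_pow_of_le_one hp.le hp1.le (by omega)
      nlinarith
    · rw [mul_zero, sub_nonneg]
      exact pow_le_pow_of_le_one hp.le hp1.le (by omega)
  have h3 := pairs_lower r
  rw [Fintype.card_fun, Fintype.card_coe, Fintype.card_fin, Fintype.card_embedding_eq,
    Fintype.card_fin] at h3
  have h4 := desc_lower n _ hv hn
  set v := Fintype.card V₀
  set Np := ∑ f : V₀ ↪ Fin n, ∑ g : V₀ ↪ Fin n, (if r f = r g then (1:ℝ) else 0) with hNp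
  have h5 : p ^ (2 * E.card - S.card) * (1 - p) * Np ≤ ∑ f : V₀ ↪ Fin n, ∑ g : V₀ ↪ Fin n,
      (p ^ (eim G₀ f ∪ eim G₀ g).card - p ^ E.card * p ^ E.card) := by
    rw [hNp, Finset.mul_sum]
    refine Finset.sum_le_sum fun f _ => ?_
    rw [Finset.mul_sum]
    exact Finset.sum_le_sum fun g _ => h2 f g
  rw [← h1] at h5
  have h6 : (9 / 16 : ℝ) * ((n:ℝ) ^ v) ^ 2 ≤ (n:ℝ) ^ (vs S).card * Np := by
    push_cast at h3
    refine le_trans ?_ h3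
    have := pow_le_pow_left₀ (by positivity) h4 2
    nlinarith
  have h7 := mul_le_mul_of_nonneg_right h5 hΨ.le
  have h8 := mul_le_mul_of_nonneg_left h6 (show 0 ≤ (p ^ E.card) ^ 2 * (1 - p) by positivity)
  have h9 : (p ^ E.card) ^ 2 = p ^ (2 * E.card - S.card) * p ^ S.card := by
    have : S.card ≤ E.card := Finset.card_le_card hS
    rw [← pow_mul, ← pow_add]; congr 1; omega
  have h10 : (p ^ E.card) ^ 2 * (1 - p) * ((n:ℝ) ^ (vs S).card * Np) =
      p ^ (2 * E.card - S.card) * (1 - p) * Np * PsiMin G₀ n p := by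
    rw [hΨS, h9]; ring
  rw [h10] at h8
  calc _ = (p ^ E.card) ^ 2 * (1 - p) * (9 / 16 * ((n:ℝ) ^ v) ^ 2) := by ring
    _ ≤ _ := h8
    _ ≤ _ := h7
    _ = _ := by ring

end Var

section Transport

variable {ι : Type*} [Fintype ι] [DecidableEq ι] {Ω : Type*} [MeasurableSpace Ω]

/-- random configuration -/
noncomputable def XX (B : ι → Ω → ℝ) (ω : Ω) : Finset ι := Finset.univ.filter fun k => B k ω = 1

theorem XX_eq (B : ι → Ω → ℝ) (X : Finset ι) : {ω | XX B ω = X} =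
    ⋂ k ∈ (Finset.univ : Finset ι), B k ⁻¹' (if k ∈ X then {1} else {1}ᶜ) := by
  ext ω
  simp only [Set.mem_ofPred_eq, Set.mem_iInter, Finset.mem_univ, forall_true_left, XX,
    Finset.ext_iff, Finset.mem_filter, true_and, Set.mem_preimage]
  refine forall_congr' fun k => ?_
  by_cases h : k ∈ X <;> simp [h]

theorem meas_if (P : Prop) [Decidable P] : MeasurableSet (if P then ({1} : Set ℝ) else {1}ᶜ) := by
  split_ifs
  · exact measurableSet_singleton 1
  · exact (measurableSet_singleton 1).compl

theorem XX_meas (B : ι → Ω → ℝ) (hB : ∀ k, Measurable (B k)) (X : Finset ι) :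
    MeasurableSet {ω | XX B ω = X} := by
  rw [XX_eq]
  exact Finset.measurableSet_biInter _ fun k _ => hB k (meas_if _)

theorem XX_measure {p : ℝ} (hp : 0 ≤ p) (hp1 : p ≤ 1) (μ : Measure Ω) [IsProbabilityMeasure μ]
    (B : ι → Ω → ℝ) (hB : ∀ k, Measurable (B k)) (hind : iIndepFun B μ)
    (hmarg : ∀ k, μ {ω | B k ω = 1} = ENNReal.ofReal p) (X : Finset ι) :
    μ.real {ω | XX B ω = X} = wt p X := by
  rw [measureReal_def, XX_eq, hind.measure_inter_preimage_eq_mul Finset.univ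
    (fun k _ => meas_if _), ENNReal.toReal_prod, wt]
  refine Finset.prod_congr rfl fun k _ => ?_
  split_ifs with h
  · have : B k ⁻¹' {1} = {ω | B k ω = 1} := rfl
    rw [this, hmarg, ENNReal.toReal_ofReal hp]
  · have : B k ⁻¹' {1}ᶜ = {ω | B k ω = 1}ᶜ := rfl
    rw [this, ← measureReal_def, probReal_compl_eq_one_sub, measureReal_def, hmarg,
      ENNReal.toReal_ofReal hp]
    exact hB k (measurableSet_singleton 1)

theorem transport {p : ℝ} (hp : 0 ≤ p) (hp1 : p ≤ 1) (μ : Measure Ω) [IsProbabilityMeasure μ]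
    (B : ι → Ω → ℝ) (hB : ∀ k, Measurable (B k)) (hind : iIndepFun B μ)
    (hmarg : ∀ k, μ {ω | B k ω = 1} = ENNReal.ofReal p) (φ : Finset ι → ℝ) :
    ∫ ω, φ (XX B ω) ∂μ = Ex p φ := by
  have h1 : (fun ω => φ (XX B ω)) = fun ω => ∑ X : Finset ι,
      ({ω | XX B ω = X}).indicator (fun _ => φ X) ω := by
    funext ω
    simp [Set.indicator_apply]
  rw [h1, integral_finsetSum]
  · unfold Ex
    refine Finset.sum_congr rfl fun X _ => ?_
    rw [integral_indicator_const _ (XX_meas B hB X), XX_measure hp hp1 μ B hB hind hmarg,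
      smul_eq_mul]
  · intro X _
    exact (integrable_const _).indicator (XX_meas B hB X)

theorem transport_prob {p : ℝ} (hp : 0 ≤ p) (hp1 : p ≤ 1) (μ : Measure Ω) [IsProbabilityMeasure μ]
    (B : ι → Ω → ℝ) (hB : ∀ k, Measurable (B k)) (hind : iIndepFun B μ)
    (hmarg : ∀ k, μ {ω | B k ω = 1} = ENNReal.ofReal p) (W : Finset ι → ℝ) (t : ℝ) :
    (μ {ω | t < W (XX B ω)}).toReal = Ex p (fun X => hstep t (W X)) := by
  rw [← transport hp hp1 μ B hB hind hmarg]
  have hm : MeasurableSet {ω | t < W (XX B ω)} := by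
    have : {ω | t < W (XX B ω)} = ⋃ X ∈ (Finset.univ.filter fun X => t < W X),
        {ω | XX B ω = X} := by
      ext ω; simp
    rw [this]
    exact Finset.measurableSet_biUnion _ fun X _ => XX_meas B hB X
  have h2 : (fun ω => hstep t (W (XX B ω))) = ({ω | t < W (XX B ω)}).indicator (fun _ => (1:ℝ)) := by
    funext ω
    simp [hstep, Set.indicator_apply]
  rw [h2, integral_indicator_const _ hm, measureReal_def]
  simp

theorem prod_bi (B : ι → Ω → ℝ) (hBval : ∀ k ω, B k ω = 0 ∨ B k ω = 1) (Γ : Finset ι) (ω : Ω) :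
    ∏ k ∈ Γ, B k ω = bi Γ (XX B ω) := by
  unfold bi
  split_ifs with h
  · refine Finset.prod_eq_one fun k hk => ?_
    have := h hk
    simpa [XX] using this
  · rw [Finset.not_subset] at h
    obtain ⟨k, hk, hk'⟩ := h
    refine Finset.prod_eq_zero hk ?_
    rcases hBval k ω with h0 | h0
    · exact h0
    · exact absurd (by simpa [XX] using h0) hk'

end Transport

section Transport2

variable {V₀ : Type*} [Fintype V₀] [DecidableEq V₀]
    (G₀ : SimpleGraph V₀) [DecidableRel G₀.Adj]

theorem sigma_eq
    (n : ℕ) {p : ℝ} (hp : 0 < p) (hp1 : p < 1)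
    {Ω : Type*} [MeasurableSpace Ω] (μ : Measure Ω) [IsProbabilityMeasure μ]
    (B : Sym2 (Fin n) → Ω → ℝ) (hBmeas : ∀ k, Measurable (B k))
    (hBval : ∀ k ω, B k ω = 0 ∨ B k ω = 1)
    (hind : iIndepFun B μ)
    (hmarg : ∀ k, μ {ω | B k ω = 1} = ENNReal.ofReal p)
    : subgraphSigma G₀ n μ B = Real.sqrt
    (Ex p (fun X => NN (copyFinset G₀ n) X ^ 2) - (Ex p (NN (copyFinset G₀ n))) ^ 2) := by
  unfold subgraphSigma
  rw [← transport hp.le hp1.le μ B hBmeas hind hmarg, ← transport hp.le hp1.le μ B hBmeas hind hmarg]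
  simp only [NN, prodB, prod_bi B hBval]

theorem W_eq
    (n : ℕ) {p : ℝ} (hp : 0 < p) (hp1 : p < 1)
    {Ω : Type*} [MeasurableSpace Ω] (μ : Measure Ω) [IsProbabilityMeasure μ]
    (B : Sym2 (Fin n) → Ω → ℝ) (hBmeas : ∀ k, Measurable (B k))
    (hBval : ∀ k ω, B k ω = 0 ∨ B k ω = 1)
    (hind : iIndepFun B μ)
    (hmarg : ∀ k, μ {ω | B k ω = 1} = ENNReal.ofReal p)
    (ω : Ω) : subgraphW G₀ n μ B ω =
    WW (copyFinset G₀ n) p (subgraphSigma G₀ n μ B) (XX B ω) := by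
  unfold subgraphW WW
  congr 1
  rw [Ex_NN, NN, ← Finset.sum_sub_distrib]
  refine Finset.sum_congr rfl fun Γ _ => ?_
  simp only [prodB, prod_bi B hBval]
  rw [transport hp.le hp1.le μ B hBmeas hind hmarg, Ex_bi]

theorem prob_eq
    (n : ℕ) {p : ℝ} (hp : 0 < p) (hp1 : p < 1)
    {Ω : Type*} [MeasurableSpace Ω] (μ : Measure Ω) [IsProbabilityMeasure μ]
    (B : Sym2 (Fin n) → Ω → ℝ) (hBmeas : ∀ k, Measurable (B k))
    (hBval : ∀ k ω, B k ω = 0 ∨ B k ω = 1)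
    (hind : iIndepFun B μ)
    (hmarg : ∀ k, μ {ω | B k ω = 1} = ENNReal.ofReal p)
    (t : ℝ) : (μ {ω | subgraphW G₀ n μ B ω > t}).toReal =
    Ex p (fun X => hstep t (WW (copyFinset G₀ n) p (subgraphSigma G₀ n μ B) X)) := by
  rw [← transport_prob hp.le hp1.le μ B hBmeas hind hmarg]
  simp only [W_eq G₀ n hp hp1 μ B hBmeas hBval hind hmarg, gt_iff_lt]

end Transport2

section Consts

theorem num_expand (e q τ P Ψ i : ℝ) (L1 L2 L3 L4 L5 : ℝ) (hq : q ≠ 0) (hΨ : Ψ ≠ 0) :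
    4 * e ^ 2 * (i ^ 2) ^ 2 * (q * (2 * (P * (P / Ψ * L1) * (P / Ψ * L2) * (P / Ψ * L3))) +
      q ^ 2 * (τ * i) ^ 2 * ((P * (P / Ψ * L1) * (P / Ψ * L2)) ^ 2 +
        4 * (P * (P / Ψ * L1) * (P / Ψ * L2) * (P / Ψ * L3) * (P / Ψ * L4) * (P / Ψ * L5))) +
      q ^ 2 * (τ * i) * (2 * (P * (P / Ψ * L1) * (P / Ψ * L2) * (P / Ψ * L3) * (P / Ψ * L4)))) =
    (8 * e ^ 2 * ((P * i) ^ 2 * q / Ψ) ^ 2 * (L1 * L2 * L3) +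
      (4 * e ^ 2 * ((P * i) ^ 2 * q / Ψ) ^ 3 * (L1 * L2) ^ 2 +
        16 * e ^ 2 * ((P * i) ^ 2 * q / Ψ) ^ 3 * (L1 * L2 * L3 * L4 * L5) / Ψ) * τ ^ 2 +
      8 * e ^ 2 * ((P * i) ^ 2 * q / Ψ) ^ 2 * (L1 * L2 * L3 * L4) * (P * i * q / Ψ) * τ) /
        (q * Ψ) := by
  field_simp
  ring

theorem num_bound (e x y f c u z Ψ : ℝ) (L1 L2 L3 L4 L5 : ℝ) (he : 1 ≤ e) (hx : 2 ≤ x)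
    (hy : 1 ≤ y) (hf : 1 ≤ f) (hc : 0 < c) (hyx : y ≤ x ^ 2) (hyf : y ≤ 2 * f)
    (hcc : 512 * x ^ 15 * f ^ 5 * e ^ 2 ≤ c ^ 2) (hu0 : 0 ≤ u) (hu : u ≤ 16 / 9)
    (hz0 : 0 ≤ z) (hz : z * c ≤ 1) (hΨ : 4 * c ^ 2 ≤ Ψ)
    (h1 : L1 = x * f) (h20 : 0 ≤ L2) (h2 : L2 ≤ x * f * y ^ 2)
    (h30 : 0 ≤ L3) (h3 : L3 ≤ x * f * y ^ 3) (h40 : 0 ≤ L4) (h4 : L4 ≤ x * f * y ^ 4)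
    (h50 : 0 ≤ L5) (h5 : L5 ≤ x * f * y ^ 5) :
    8 * e ^ 2 * u ^ 2 * (L1 * L2 * L3) ≤ c ^ 2 / 4 ∧
    4 * e ^ 2 * u ^ 3 * (L1 * L2) ^ 2 + 16 * e ^ 2 * u ^ 3 * (L1 * L2 * L3 * L4 * L5) / Ψ ≤
      c ^ 2 / 4 ∧
    8 * e ^ 2 * u ^ 2 * (L1 * L2 * L3 * L4) * z ≤ c ^ 2 / 2 := by
  have hL1 : 0 ≤ L1 := by rw [h1]; positivity
  have hu2 : u ^ 2 ≤ 4 := by nlinarith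
  have hu3 : u ^ 3 ≤ 6 := by
    have : u ^ 3 ≤ (16 / 9) ^ 3 := pow_le_pow_left₀ hu0 hu 3
    linarith [this, show ((16:ℝ) / 9) ^ 3 ≤ 6 by norm_num]
  have hx1 : 1 ≤ x := by linarith
  have a12 : L1 * L2 ≤ x ^ 6 * f ^ 2 := by
    calc L1 * L2 ≤ (x * f) * (x * f * (x ^ 2) ^ 2) := by rw [h1]; gcongr; exact h2.trans (by gcongr)
      _ = _ := by ring
  have a123 : L1 * L2 * L3 ≤ x ^ 13 * f ^ 3 := by
    calc L1 * L2 * L3 ≤ (x ^ 6 * f ^ 2) * (x * f * (x ^ 2) ^ 3) := by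
          gcongr; exact h3.trans (by gcongr)
      _ = _ := by ring
  have a1234 : L1 * L2 * L3 * L4 ≤ x ^ 22 * f ^ 4 := by
    calc L1 * L2 * L3 * L4 ≤ (x ^ 13 * f ^ 3) * (x * f * (x ^ 2) ^ 4) := by
          gcongr; exact h4.trans (by gcongr)
      _ = _ := by ring
  have a12345 : L1 * L2 * L3 * L4 * L5 ≤ 32 * x ^ 23 * f ^ 10 := by
    calc L1 * L2 * L3 * L4 * L5 ≤ (x * f) * (x * f * y ^ 2) * (x * f * y ^ 3) * (x * f * y ^ 4) *
          (x * f * y ^ 5) := by rw [h1]; gcongr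
      _ = x ^ 5 * f ^ 5 * (y ^ 9 * y ^ 5) := by ring
      _ ≤ x ^ 5 * f ^ 5 * ((x ^ 2) ^ 9 * (2 * f) ^ 5) := by gcongr
      _ = _ := by ring
  have c4 : 262144 * x ^ 30 * f ^ 10 * e ^ 4 ≤ c ^ 2 * c ^ 2 := by
    calc 262144 * x ^ 30 * f ^ 10 * e ^ 4 = (512 * x ^ 15 * f ^ 5 * e ^ 2) *
          (512 * x ^ 15 * f ^ 5 * e ^ 2) := by ring
      _ ≤ _ := by gcongr
  have c1 : x ^ 7 * f ^ 2 * e ≤ c := by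
    refine le_of_sq_le_sq ?_ hc.le
    refine le_trans ?_ hcc
    calc (x ^ 7 * f ^ 2 * e) ^ 2 = 1 * x ^ 14 * f ^ 4 * e ^ 2 := by ring
      _ ≤ 512 * x ^ 15 * f ^ 5 * e ^ 2 := by gcongr <;> first | norm_num | assumption
  have hΨ0 : 0 < Ψ := lt_of_lt_of_le (by positivity) hΨ
  refine ⟨?_, ?_, ?_⟩
  · calc 8 * e ^ 2 * u ^ 2 * (L1 * L2 * L3) ≤ 8 * e ^ 2 * 4 * (x ^ 13 * f ^ 3) := by gcongr
      _ ≤ 8 * e ^ 2 * 4 * (x ^ 15 * f ^ 5) := by gcongr <;> first | norm_num | assumption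
      _ ≤ (512 * x ^ 15 * f ^ 5 * e ^ 2) / 4 := by
          have : 0 ≤ x ^ 15 * f ^ 5 * e ^ 2 := by positivity
          nlinarith
      _ ≤ _ := by gcongr
  · have b1 : 4 * e ^ 2 * u ^ 3 * (L1 * L2) ^ 2 ≤ c ^ 2 / 8 := by
      calc 4 * e ^ 2 * u ^ 3 * (L1 * L2) ^ 2 ≤ 4 * e ^ 2 * 6 * (x ^ 6 * f ^ 2) ^ 2 := by gcongr
        _ = 4 * e ^ 2 * 6 * (x ^ 12 * f ^ 4) := by ring
        _ ≤ 4 * e ^ 2 * 6 * (x ^ 15 * f ^ 5) := by gcongr <;> first | norm_num | assumption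
        _ ≤ (512 * x ^ 15 * f ^ 5 * e ^ 2) / 8 := by
            have : 0 ≤ x ^ 15 * f ^ 5 * e ^ 2 := by positivity
            nlinarith
        _ ≤ _ := by gcongr
    have b2 : 16 * e ^ 2 * u ^ 3 * (L1 * L2 * L3 * L4 * L5) / Ψ ≤ c ^ 2 / 8 := by
      rw [div_le_iff₀ hΨ0]
      calc 16 * e ^ 2 * u ^ 3 * (L1 * L2 * L3 * L4 * L5) ≤
            16 * e ^ 2 * 6 * (32 * x ^ 23 * f ^ 10) := by gcongr
        _ = 3072 * x ^ 23 * f ^ 10 * e ^ 2 := by ring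
        _ ≤ (262144 / 2) * x ^ 30 * f ^ 10 * e ^ 4 := by
            gcongr <;> first | norm_num | assumption
        _ = (262144 * x ^ 30 * f ^ 10 * e ^ 4) / 2 := by ring
        _ ≤ (c ^ 2 * c ^ 2) / 2 := by gcongr
        _ = c ^ 2 / 8 * (4 * c ^ 2) := by ring
        _ ≤ _ := by gcongr
    linarith
  · calc 8 * e ^ 2 * u ^ 2 * (L1 * L2 * L3 * L4) * z ≤ 8 * e ^ 2 * 4 * (x ^ 22 * f ^ 4) * z := by
          gcongr
      _ ≤ 8 * e ^ 2 * 4 * (x ^ 22 * f ^ 7 * e) * z := by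
          have : f ^ 4 * 1 ≤ f ^ 7 * e := by gcongr <;> first | norm_num | assumption
          have := mul_le_mul_of_nonneg_left this
            (show 0 ≤ 8 * e ^ 2 * 4 * x ^ 22 * z by positivity)
          linarith
      _ = 32 * x ^ 15 * f ^ 5 * e ^ 2 * (x ^ 7 * f ^ 2 * e) * z := by ring
      _ ≤ 32 * x ^ 15 * f ^ 5 * e ^ 2 * c * z := by gcongr
      _ = 32 * x ^ 15 * f ^ 5 * e ^ 2 * (z * c) := by ring
      _ ≤ 32 * x ^ 15 * f ^ 5 * e ^ 2 * 1 := by gcongr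
      _ ≤ (512 * x ^ 15 * f ^ 5 * e ^ 2) / 2 := by
          have : 0 ≤ x ^ 15 * f ^ 5 * e ^ 2 := by positivity
          nlinarith
      _ ≤ _ := by gcongr

theorem num_main (e x y f c q τ P Ψ σ : ℝ) (L1 L2 L3 L4 L5 : ℝ) (he : 1 ≤ e) (hx : 2 ≤ x)
    (hy : 1 ≤ y) (hf : 1 ≤ f) (hc : 0 < c) (hyx : y ≤ x ^ 2) (hyf : y ≤ 2 * f)
    (hcc : 512 * x ^ 15 * f ^ 5 * e ^ 2 ≤ c ^ 2)
    (h1 : L1 = x * f) (h20 : 0 ≤ L2) (h2 : L2 ≤ x * f * y ^ 2)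
    (h30 : 0 ≤ L3) (h3 : L3 ≤ x * f * y ^ 3) (h40 : 0 ≤ L4) (h4 : L4 ≤ x * f * y ^ 4)
    (h50 : 0 ≤ L5) (h5 : L5 ≤ x * f * y ^ 5)
    (hq : 0 < q) (hq1 : q ≤ 1) (hP : 0 < P) (hΨ : 0 < Ψ) (hσ : 0 < σ) (hτ : 0 ≤ τ)
    (hqΨ : 4 * c ^ 2 ≤ q * Ψ) (hσP : 9 / 16 * (P ^ 2 * q / Ψ) ≤ σ ^ 2) :
    4 * e ^ 2 * ((σ⁻¹) ^ 2) ^ 2 * (q * (2 * (P * (P / Ψ * L1) * (P / Ψ * L2) * (P / Ψ * L3))) +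
      q ^ 2 * (τ / σ) ^ 2 * ((P * (P / Ψ * L1) * (P / Ψ * L2)) ^ 2 +
        4 * (P * (P / Ψ * L1) * (P / Ψ * L2) * (P / Ψ * L3) * (P / Ψ * L4) * (P / Ψ * L5))) +
      q ^ 2 * (τ / σ) * (2 * (P * (P / Ψ * L1) * (P / Ψ * L2) * (P / Ψ * L3) * (P / Ψ * L4)))) ≤
    c ^ 2 / 4 * (1 + τ) ^ 2 / (q * Ψ) := by
  rw [div_eq_mul_inv τ σ, num_expand _ _ _ _ _ _ _ _ _ _ _ hq.ne' hΨ.ne']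
  have hΨ4 : 4 * c ^ 2 ≤ Ψ := hqΨ.trans (by nlinarith)
  set u := (P * σ⁻¹) ^ 2 * q / Ψ with hu
  set z := P * σ⁻¹ * q / Ψ with hz
  have hu0 : 0 ≤ u := by positivity
  have hz0 : 0 ≤ z := by positivity
  have hu1 : u ≤ 16 / 9 := by
    have e1 : u = (P ^ 2 * q / Ψ) / σ ^ 2 := by rw [hu]; field_simp
    rw [e1, div_le_iff₀ (by positivity)]; linarith
  have hz1 : z * c ≤ 1 := by
    refine le_of_sq_le_sq ?_ zero_le_one
    have e1 : (z * c) ^ 2 = u * q * c ^ 2 / Ψ := by rw [hu, hz]; field_simp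
    rw [e1, div_le_iff₀ hΨ]
    have : u * q ≤ 16 / 9 * 1 := by gcongr
    nlinarith [mul_le_mul_of_nonneg_right this (sq_nonneg c)]
  obtain ⟨b1, b2, b3⟩ := num_bound e x y f c u z Ψ L1 L2 L3 L4 L5 he hx hy hf hc hyx hyf hcc hu0 hu1
    hz0 hz1 hΨ4 h1 h20 h2 h30 h3 h40 h4 h50 h5
  refine div_le_div_of_nonneg_right ?_ (by positivity)
  have t2 := mul_le_mul_of_nonneg_right b2 (sq_nonneg τ)
  have t3 := mul_le_mul_of_nonneg_right b3 hτ
  nlinarith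

end Consts

section Final

theorem triv_regime (R c s t : ℝ) (ht : 0 ≤ t) (hR0 : 0 ≤ R) (hR1 : R ≤ 1) (hcs : 1 / 2 ≤ c * s) :
    |R / (1 - stdNormalCDF t) - 1| ≤ 50 * c * Real.exp (c * t ^ 2 * s) * (1 + t ^ 2) * s := by
  have hT := tail_pos t
  have hl := tail_lower t ht
  set T := 1 - stdNormalCDF t
  have h1 : 25 * Real.exp (t ^ 2 / 2) * (1 + t ^ 2) ≤
      50 * c * Real.exp (c * t ^ 2 * s) * (1 + t ^ 2) * s := by
    have h2 : Real.exp (t ^ 2 / 2) ≤ Real.exp (c * t ^ 2 * s) := by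
      rw [Real.exp_le_exp]; nlinarith [mul_le_mul_of_nonneg_right hcs (sq_nonneg t)]
    calc 25 * Real.exp (t ^ 2 / 2) * (1 + t ^ 2) =
          50 * (1 / 2) * Real.exp (t ^ 2 / 2) * (1 + t ^ 2) := by ring
      _ ≤ 50 * (c * s) * Real.exp (c * t ^ 2 * s) * (1 + t ^ 2) := by gcongr
      _ = _ := by ring
  refine le_trans ?_ h1
  have hE : 1 ≤ Real.exp (t ^ 2 / 2) := Real.one_le_exp (by positivity)
  have h3 : R / T ≤ 25 * Real.exp (t ^ 2 / 2) * (1 + t ^ 2) := by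
    rw [div_le_iff₀ hT]
    have hpi : Real.sqrt (2 * Real.pi) ≤ 3 := by
      rw [Real.sqrt_le_left (by norm_num)]
      nlinarith [Real.pi_lt_d2]
    have hg : 1 / 3 ≤ Real.exp (t ^ 2 / 2) * gphi t := by
      unfold gphi
      rw [mul_div_assoc', ← Real.exp_add]
      rw [show t ^ 2 / 2 + -t ^ 2 / 2 = 0 by ring, Real.exp_zero]
      exact one_div_le_one_div_of_le (by positivity) hpi
    have h4 : Real.exp (t ^ 2 / 2) * gphi t ≤ Real.exp (t ^ 2 / 2) * ((1 + t) * T) := by gcongr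
    have h5 : 1 + t ≤ 2 * (1 + t ^ 2) := by nlinarith [sq_nonneg (t - 1)]
    have h6 := mul_le_mul_of_nonneg_left h5 (show 0 ≤ Real.exp (t ^ 2 / 2) * T by positivity)
    nlinarith
  have h7 : 0 ≤ R / T := by positivity
  rw [abs_le]
  constructor
  · nlinarith [sq_nonneg t, mul_nonneg (show 0 ≤ Real.exp (t ^ 2 / 2) by positivity) (sq_nonneg t)]
  · linarith

variable {ι : Type*} [Fintype ι] [DecidableEq ι]

theorem half_bound {p : ℝ} (hp : 0 ≤ p) (hp1 : p ≤ 1) (Y W : Finset ι → ℝ) (τ h : ℝ) (hh : 0 ≤ h)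
    (hY : Ex p (fun X => Y X ^ 2 * Real.exp (τ * W X)) ≤ h ^ 2 * mg p W τ) :
    Ex p (fun X => |Y X| * Real.exp (τ * W X)) ≤ h * mg p W τ := by
  have hm := mg_nonneg hp hp1 W τ
  refine le_of_sq_le_sq ?_ (by positivity)
  have h1 := Ex_cauchy hp hp1 Y (fun X => Real.exp (τ * W X)) (fun X => (Real.exp_pos _).le)
  refine h1.trans ?_
  refine (mul_le_mul_of_nonneg_right hY hm).trans (le_of_eq ?_)
  ring

theorem stR_bound (M : Finset (Finset ι)) {p σ D τ b : ℝ} {β : ℕ → ℝ} {e : ℕ}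
    (hp : 0 ≤ p) (hp1 : p ≤ 1) (hσ : 0 < σ) (hD : 0 ≤ D) (hτ : 0 ≤ τ) (hb : 0 ≤ b)
    (hM : ∀ Γ ∈ M, Γ.card = e) (H : ChainData M p β D)
    (HS : SteinData p (WW M p σ) (rho M p σ) (ddW M σ))
    (hK : Real.exp (6 * D * τ / σ) * (4 * e ^ 2 * ((σ⁻¹) ^ 2) ^ 2 * (
      (1 - p) * (2 * (β 0 * β 1 * β 2 * β 3)) +
      (1 - p) ^ 2 * (τ / σ) ^ 2 *
        ((β 0 * β 1 * β 2) ^ 2 + 4 * (β 0 * β 1 * β 2 * β 3 * β 4 * β 5)) +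
      (1 - p) ^ 2 * (τ / σ) * (2 * (β 0 * β 1 * β 2 * β 3 * β 4)))) ≤ (b / 2) ^ 2) :
    Ex p (fun X => stR p (rho M p σ) (ddW M σ) X * Real.exp (τ * WW M p σ X)) ≤
      b * mg p (WW M p σ) τ := by
  have hm := mg_nonneg hp hp1 (WW M p σ) τ
  have hK' := mul_le_mul_of_nonneg_right hK hm
  have h1 := (UT_uData M hp hp1 (sq_nonneg (σ⁻¹)) hM).second H hσ hτ hD
  have h2 := (US_uData M hp hp1 (sq_nonneg (σ⁻¹)) hM).second H hσ hτ hD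
  simp only [← stT_eq M hp hp1 HS hM] at h1
  simp only [← stS_eq M p σ] at h2
  have h3 := half_bound hp hp1 _ (WW M p σ) τ (b / 2) (by positivity)
    (h1.trans (le_trans (le_of_eq (by ring)) hK'))
  have h4 := half_bound hp hp1 _ (WW M p σ) τ (b / 2) (by positivity)
    (h2.trans (le_trans (le_of_eq (by ring)) hK'))
  have h5 : (fun X => stR p (rho M p σ) (ddW M σ) X * Real.exp (τ * WW M p σ X)) = fun X =>
      |stT p (rho M p σ) (ddW M σ) X| * Real.exp (τ * WW M p σ X) +
      |stS p (rho M p σ) (ddW M σ) X| * Real.exp (τ * WW M p σ X) := by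
    funext X; unfold stR; ring
  rw [h5, Ex_add]
  linarith

end Final

section Final2

variable {V₀ : Type*} [Fintype V₀] [DecidableEq V₀] (G₀ : SimpleGraph V₀) [DecidableRel G₀.Adj]

theorem aut_le : (Nat.card (G₀ ≃g G₀) : ℝ) ≤ ((Fintype.card V₀).factorial : ℝ) := by
  have : Nat.card (G₀ ≃g G₀) ≤ (Fintype.card V₀).factorial := by
    rw [← Fintype.card_perm, ← Nat.card_eq_fintype_card]
    exact Nat.card_le_card_of_injective (fun ψ : G₀ ≃g G₀ => (ψ.toEquiv : Equiv.Perm V₀))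
      RelIso.toEquiv_injective
  exact_mod_cast this

theorem card_le_two_edges (hniso : ∀ v : V₀, ∃ w, G₀.Adj v w) :
    Fintype.card V₀ ≤ 2 * G₀.edgeFinset.card := by
  rw [← G₀.sum_degrees_eq_twice_card_edges, ← Finset.card_univ, Finset.card_eq_sum_ones]
  refine Finset.sum_le_sum fun v _ => ?_
  rw [Nat.one_le_iff_ne_zero, ← Nat.pos_iff_ne_zero, G₀.degree_pos_iff_exists_adj]
  exact hniso v

theorem two_pow_fact (v : ℕ) : 2 ^ v ≤ 2 * v.factorial := by
  induction v with
  | zero => simp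
  | succ v ih =>
    rcases Nat.eq_zero_or_pos v with rfl | hv
    · simp
    · rw [pow_succ, Nat.factorial_succ]
      nlinarith [Nat.factorial_pos v]

theorem cConst_pos (hedge : G₀.edgeFinset.Nonempty) : 0 < cConst G₀ := by
  have ha := aut_pos G₀
  have he : (0:ℝ) < G₀.edgeFinset.card := by exact_mod_cast hedge.card_pos
  have hf : (0:ℝ) < ((Fintype.card V₀).factorial : ℝ) := by exact_mod_cast Nat.factorial_pos _
  unfold cConst
  positivity

theorem cConst_sq (hedge : G₀.edgeFinset.Nonempty) :
    512 * (2 ^ G₀.edgeFinset.card : ℝ) ^ 15 * ((Fintype.card V₀).factorial : ℝ) ^ 5 *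
      (G₀.edgeFinset.card : ℝ) ^ 2 ≤ cConst G₀ ^ 2 := by
  have ha := aut_pos G₀
  have hl := aut_le G₀
  have hf : (0:ℝ) < ((Fintype.card V₀).factorial : ℝ) := by exact_mod_cast Nat.factorial_pos _
  unfold cConst
  set a := (Nat.card (G₀ ≃g G₀) : ℝ)
  set f := ((Fintype.card V₀).factorial : ℝ)
  set e := G₀.edgeFinset.card
  have h1 : ((2:ℝ) ^ ((9:ℝ) / 2 + 15 / 2 * (e:ℝ))) ^ 2 = 512 * (2 ^ e : ℝ) ^ 15 := by
    rw [← Real.rpow_natCast, ← Real.rpow_mul (by norm_num)]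
    rw [show ((9:ℝ) / 2 + 15 / 2 * (e:ℝ)) * ((2:ℕ):ℝ) = ((9 + e * 15 : ℕ) : ℝ) by push_cast; ring]
    rw [Real.rpow_natCast, pow_add, pow_mul]
    norm_num
  have h2 : (a ^ ((3:ℝ) / 2)) ^ 2 = a ^ 3 := by
    rw [← Real.rpow_natCast, ← Real.rpow_mul ha.le, show (3:ℝ) / 2 * ((2:ℕ):ℝ) = ((3:ℕ):ℝ) by
      push_cast; ring, Real.rpow_natCast]
  rw [div_pow, mul_pow, mul_pow, h1, h2, le_div_iff₀ (by positivity)]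
  calc _ ≤ 512 * (2 ^ e : ℝ) ^ 15 * f ^ 5 * (e:ℝ) ^ 2 * f ^ 3 := by gcongr
    _ = _ := by ring

theorem desc_choose_le (r v : ℕ) : ((r * v).descFactorial v : ℝ) ≤ (v.factorial : ℝ) * (2 ^ v) ^ r := by
  have : (r * v).descFactorial v ≤ v.factorial * (2 ^ v) ^ r := by
    rw [Nat.descFactorial_eq_factorial_mul_choose, ← pow_mul, mul_comm v r]
    exact Nat.mul_le_mul_left _ (Nat.choose_le_two_pow _ _)
  exact_mod_cast this

theorem fin_ineq {c t τ Q E F : ℝ} (h : F ≤ E ^ 2) (hτ : 0 ≤ τ) (hτt : τ ≤ t) (hQ : 0 < Q) :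
    F * (c ^ 2 / 4 * (1 + τ) ^ 2 / Q) ≤ (c * ((1 + t) * (1 / Real.sqrt Q) * E) / 2) ^ 2 := by
  have hfin : (c * ((1 + t) * (1 / Real.sqrt Q) * E) / 2) ^ 2 =
      E ^ 2 * (c ^ 2 / 4 * (1 + t) ^ 2 / Q) := by
    have h2 := Real.sq_sqrt hQ.le
    have h3 : (1 / Real.sqrt Q) ^ 2 = 1 / Q := by rw [div_pow, h2, one_pow]
    calc _ = E ^ 2 * (c ^ 2 / 4 * (1 + t) ^ 2 * (1 / Real.sqrt Q) ^ 2) := by ring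
      _ = _ := by rw [h3, mul_one_div]
  rw [hfin]
  gcongr

theorem bet_ne (n : ℕ) (p : ℝ) (r : ℕ) (hr : r ≠ 0) :
    bet G₀ n p r = (n:ℝ) ^ (Fintype.card V₀) * p ^ G₀.edgeFinset.card / PsiMin G₀ n p /
      (Nat.card (G₀ ≃g G₀) : ℝ) * (2 ^ G₀.edgeFinset.card *
        ((r * Fintype.card V₀).descFactorial (Fintype.card V₀) : ℝ)) := by
  rw [bet, if_neg hr]
  try ring

set_option maxHeartbeats 2000000 in
theorem core {n : ℕ} {p : ℝ} (hp : 0 < p) (hp1 : p < 1)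
    (hedge : G₀.edgeFinset.Nonempty) (hniso : ∀ v : V₀, ∃ w, G₀.Adj v w)
    (hn : 4 * (Fintype.card V₀) ^ 2 ≤ n) (σ : ℝ) (hσ : 0 < σ)
    (hvar : σ ^ 2 = Ex p (fun X => NN (copyFinset G₀ n) X ^ 2) - (Ex p (NN (copyFinset G₀ n))) ^ 2)
    (D : ℕ)
    (hD : ∀ Γ ∈ copyFinset G₀ n,
      ((copyFinset G₀ n).filter (fun Γ' => (Γ' ∩ Γ).Nonempty)).card = D)
    (t : ℝ) (ht : 0 ≤ t)
    (hs : cConst G₀ * sFun (PsiMin G₀ n p) σ (1 - p) D t < 1 / 2) :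
    |Ex p (fun X => hstep t (WW (copyFinset G₀ n) p σ X)) - (1 - stdNormalCDF t)| ≤
      (1 - stdNormalCDF t) * (50 * (cConst G₀ * sFun (PsiMin G₀ n p) σ (1 - p) D t) *
        Real.exp ((cConst G₀ * sFun (PsiMin G₀ n p) σ (1 - p) D t) * t ^ 2) * (1 + t ^ 2)) := by
  have hv : 1 ≤ Fintype.card V₀ := by
    obtain ⟨e, he⟩ := hedge
    induction e with | _ a b => exact Fintype.card_pos_iff.2 ⟨a⟩
  have hn0 : 0 < n := by nlinarith
  have hn0' : (0:ℝ) < n := by exact_mod_cast hn0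
  have hq : 0 < 1 - p := by linarith
  have hΨ := Psi_pos (n := n) G₀ hedge hp hn0
  have hc := cConst_pos G₀ hedge
  have hcc := cConst_sq G₀ hedge
  have ha := aut_pos G₀
  have hM : ∀ Γ ∈ copyFinset G₀ n, Γ.card = G₀.edgeFinset.card := by
    intro Γ hΓ
    obtain ⟨f, rfl⟩ := (mem_copy G₀ _).1 hΓ
    exact eim_card G₀ f
  have HC := chainCopies G₀ hp hp1.le hn0 hedge hniso D hD
  have HS := steinData (copyFinset G₀ n) hp.le hp1.le hσ hvar
  have hlow := sigma_lower G₀ hp hp1 hedge hniso hv hn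
  rw [← hvar] at hlow
  have hyx : Fintype.card V₀ ≤ 2 * G₀.edgeFinset.card := card_le_two_edges G₀ hniso
  have he1 : 1 ≤ G₀.edgeFinset.card := hedge.card_pos
  set c := cConst G₀
  set Ψ := PsiMin G₀ n p with hΨd
  set e := G₀.edgeFinset.card with hed
  set v := Fintype.card V₀ with hvd
  set a := (Nat.card (G₀ ≃g G₀) : ℝ) with had
  set P : ℝ := (n:ℝ) ^ v * p ^ e / a with hP
  have hf1 : (1:ℝ) ≤ (v.factorial : ℝ) := by exact_mod_cast Nat.factorial_pos v
  have he1' : (1:ℝ) ≤ e := by exact_mod_cast he1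
  have hx2 : (2:ℝ) ≤ 2 ^ e := by
    calc (2:ℝ) = 2 ^ 1 := by norm_num
      _ ≤ 2 ^ e := pow_le_pow_right₀ (by norm_num) he1
  have hc1 : 1 ≤ c := by
    refine le_of_sq_le_sq ?_ hc.le
    refine le_trans ?_ hcc
    have h1 : (1:ℝ) ≤ (2 ^ e) ^ 15 := one_le_pow₀ (by linarith)
    calc (1:ℝ) ^ 2 ≤ 512 * 1 * 1 ^ 5 * 1 ^ 2 := by norm_num
      _ ≤ _ := by gcongr
  -- reduce s
  set E5 := Real.exp (5 * (D:ℝ) * t / σ) with hE5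
  have hE51 : 1 ≤ E5 := Real.one_le_exp (by positivity)
  have hsq : 0 < Real.sqrt ((1 - p) * Ψ) := Real.sqrt_pos.2 (by positivity)
  have hmin : 0 < min (Real.sqrt Ψ) 1 := lt_min (Real.sqrt_pos.2 hΨ) one_pos
  have hs1 : 1 / Real.sqrt ((1 - p) * Ψ) ≤ sFun Ψ σ (1 - p) D t := by
    unfold sFun
    have h1 : 1 ≤ 1 + t / min (Real.sqrt Ψ) 1 := by
      have : 0 ≤ t / min (Real.sqrt Ψ) 1 := by positivity
      linarith
    calc 1 / Real.sqrt ((1 - p) * Ψ) = 1 * (1 / Real.sqrt ((1 - p) * Ψ)) * 1 := by ring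
      _ ≤ _ := by gcongr
  have hqΨ : 4 * c ^ 2 ≤ (1 - p) * Ψ := by
    have h1 : c * (1 / Real.sqrt ((1 - p) * Ψ)) < 1 / 2 :=
      lt_of_le_of_lt (mul_le_mul_of_nonneg_left hs1 hc.le) hs
    rw [mul_one_div, div_lt_iff₀ hsq] at h1
    have h2 := Real.sq_sqrt (show 0 ≤ (1 - p) * Ψ by positivity)
    nlinarith
  have hΨ1 : 1 ≤ Ψ := by nlinarith
  have hs2 : sFun Ψ σ (1 - p) D t = (1 + t) * (1 / Real.sqrt ((1 - p) * Ψ)) * E5 := by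
    unfold sFun
    rw [min_eq_right (Real.one_le_sqrt.2 hΨ1), div_one]
  set s := sFun Ψ σ (1 - p) D t
  have hs0 : 0 ≤ s := le_trans (by positivity) hs1
  have hPpos : 0 < P := by positivity
  have hσP : 9 / 16 * (P ^ 2 * (1 - p) / Ψ) ≤ σ ^ 2 := by
    refine le_trans (le_of_eq ?_) hlow
    rw [hP]; field_simp
  have b0 : bet G₀ n p 0 = P := by rw [bet, if_pos rfl]
  have br : ∀ r, r ≠ 0 → bet G₀ n p r = P / Ψ * (2 ^ e * ((r * v).descFactorial v : ℝ)) := by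
    intro r hr
    have hb := bet_ne G₀ n p r hr
    rw [← hvd, ← hed, ← hΨd, ← had] at hb
    rw [hb, hP]
    clear_value P Ψ a e v
    field_simp
  have hL : ∀ r : ℕ, (2:ℝ) ^ e * ((r * v).descFactorial v : ℝ) ≤
      2 ^ e * (v.factorial : ℝ) * (2 ^ v) ^ r := by
    intro r
    rw [mul_assoc]
    exact mul_le_mul_of_nonneg_left (desc_choose_le r v) (by positivity)
  have hL0 : ∀ r : ℕ, 0 ≤ (2:ℝ) ^ e * ((r * v).descFactorial v : ℝ) := fun r => by positivity
  refine HS.final t (c * s) ht (by positivity) fun τ hτ hτt => ?_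
  refine stR_bound (copyFinset G₀ n) hp.le hp1.le hσ (Nat.cast_nonneg D) hτ (by positivity) hM HC HS ?_
  rw [b0, br 1 (by norm_num), br 2 (by norm_num), br 3 (by norm_num), br 4 (by norm_num),
    br 5 (by norm_num)]
  have hmain := num_main (e:ℝ) (2 ^ e) (2 ^ v) (v.factorial : ℝ) c (1 - p) τ P Ψ σ
    (2 ^ e * ((1 * v).descFactorial v : ℝ)) (2 ^ e * ((2 * v).descFactorial v : ℝ))
    (2 ^ e * ((3 * v).descFactorial v : ℝ)) (2 ^ e * ((4 * v).descFactorial v : ℝ))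
    (2 ^ e * ((5 * v).descFactorial v : ℝ)) he1' hx2 (one_le_pow₀ (by norm_num)) hf1 hc
    (by rw [← pow_mul, mul_comm e 2]; exact pow_le_pow_right₀ (by norm_num) hyx)
    (by exact_mod_cast two_pow_fact v) hcc (by rw [one_mul, Nat.descFactorial_self])
    (hL0 2) (hL 2) (hL0 3) (hL 3) (hL0 4) (hL 4) (hL0 5) (hL 5) hq (by linarith) hPpos hΨ hσ hτ
    hqΨ hσP
  refine (mul_le_mul_of_nonneg_left hmain (Real.exp_pos _).le).trans ?_
  have hexp : Real.exp (6 * (D:ℝ) * τ / σ) ≤ E5 ^ 2 := by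
    rw [hE5, ← Real.exp_nat_mul, Real.exp_le_exp, ← mul_div_assoc]
    refine div_le_div_of_nonneg_right ?_ hσ.le
    push_cast
    have hD0 : (0:ℝ) ≤ D := Nat.cast_nonneg D
    nlinarith [mul_le_mul_of_nonneg_left hτt hD0, mul_nonneg hD0 ht]
  rw [hs2]
  exact fin_ineq hexp hτ hτt (by positivity)

end Final2

/-- Subgraph counts in the Erdős–Rényi random graph — general result:
for `n ≥ 4v_{G₀}²` and all `t ≥ 0`,
`|ℙ(W > t)/(1 − Φ(t)) − 1| ≤ 50·c_{G₀}·exp(c_{G₀}·t²·s(t))·(1 + t²)·s(t)`. -/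
theorem stmt_1 {V₀ : Type*} [Fintype V₀] [DecidableEq V₀]
    (G₀ : SimpleGraph V₀) [DecidableRel G₀.Adj]
    (hedge : G₀.edgeFinset.Nonempty)
    (hniso : ∀ v : V₀, ∃ w, G₀.Adj v w)
    (n : ℕ) (hn : 4 * (Fintype.card V₀) ^ 2 ≤ n)
    (p : ℝ) (hp : 0 < p) (hp1 : p < 1)
    {Ω : Type*} [MeasurableSpace Ω] (μ : Measure Ω) [IsProbabilityMeasure μ]
    (B : Sym2 (Fin n) → Ω → ℝ) (hBmeas : ∀ k, Measurable (B k))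
    (hBval : ∀ k ω, B k ω = 0 ∨ B k ω = 1)
    (hind : iIndepFun B μ)
    (hmarg : ∀ k, μ {ω | B k ω = 1} = ENNReal.ofReal p)
    (hσ : 0 < subgraphSigma G₀ n μ B)
    (D : ℕ)
    (hD : ∀ Γ ∈ copyFinset G₀ n,
      ((copyFinset G₀ n).filter (fun Γ' => (Γ' ∩ Γ).Nonempty)).card = D)
    (t : ℝ) (ht : 0 ≤ t) :
    |(μ {ω | subgraphW G₀ n μ B ω > t}).toReal / (1 - stdNormalCDF t) - 1| ≤
      50 * cConst G₀ *
        Real.exp (cConst G₀ * t ^ 2 *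
          sFun (PsiMin G₀ n p) (subgraphSigma G₀ n μ B) (1 - p) D t) *
        (1 + t ^ 2) *
        sFun (PsiMin G₀ n p) (subgraphSigma G₀ n μ B) (1 - p) D t := by
  by_cases hs : cConst G₀ * sFun (PsiMin G₀ n p) (subgraphSigma G₀ n μ B) (1 - p) D t < 1 / 2
  · have hvar : (subgraphSigma G₀ n μ B) ^ 2 =
        Ex p (fun X => NN (copyFinset G₀ n) X ^ 2) - (Ex p (NN (copyFinset G₀ n))) ^ 2 := by
      have h1 := sigma_eq G₀ n hp hp1 μ B hBmeas hBval hind hmarg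
      rw [h1, Real.sq_sqrt]
      rw [h1] at hσ
      exact (Real.sqrt_pos.1 hσ).le
    have h := core G₀ hp hp1 hedge hniso hn _ hσ hvar D hD t ht hs
    rw [prob_eq G₀ n hp hp1 μ B hBmeas hBval hind hmarg]
    have hT := tail_pos t
    rw [div_sub_one hT.ne', abs_div, abs_of_pos hT, div_le_iff₀ hT]
    refine h.trans (le_of_eq ?_)
    rw [mul_right_comm (cConst G₀) _ (t ^ 2)]
    ring
  · refine triv_regime _ _ _ t ht ENNReal.toReal_nonneg ?_ (not_lt.1 hs)
    exact measureReal_le_one
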